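/- arXiv:1412.3309 — 2 statements merged into one kernel-verified Lean document; each statement's English description precedes it below -/
import Mathlib

section
/- For every nonnegative integer n, dim_{F_2}(QP_4)_n ≤ (2 − 1)(2^2 − 1)(2^3 − 1)(2^4 − 1) = 315; that is, Kameko's conjecture holds for k = 4. -/
open MvPolynomial

/-- The total Steenrod square on `P_k = F_2[x_1,…,x_k]`, the algebra map with
`Sq(x_j) = x_j + x_j^2`. -/
noncomputable def SqTotal (k : ℕ) :
    MvPolynomial (Fin k) (ZMod 2) →ₐ[ZMod 2] MvPolynomial (Fin k) (ZMod 2) :=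
  aeval fun j => X j + X j ^ 2

/-- The Steenrod square `Sq^i : P_k → P_k`, sending a homogeneous polynomial `f` of
degree `d` to the degree-`d + i` homogeneous component of `Sq(f)`, extended additively. -/
noncomputable def SqOp (k i : ℕ) (f : MvPolynomial (Fin k) (ZMod 2)) :
    MvPolynomial (Fin k) (ZMod 2) :=
  ∑ d ∈ Finset.range (f.totalDegree + 1),
    homogeneousComponent (d + i) (SqTotal k (homogeneousComponent d f))

/-- The space of hit polynomials: finite sums of `Sq^i (f_i)` with `i > 0`. -/
noncomputable def hitSubmodule (k : ℕ) :
    Submodule (ZMod 2) (MvPolynomial (Fin k) (ZMod 2)) :=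
  Submodule.span (ZMod 2) {g | ∃ i f, 0 < i ∧ g = SqOp k i f}

/-- A polynomial is hit if it is a finite sum of `Sq^i (f_i)` with `i > 0`. -/
def IsHit (k : ℕ) (f : MvPolynomial (Fin k) (ZMod 2)) : Prop := f ∈ hitSubmodule k

/-- `(QP_k)_n`: the space of homogeneous polynomials of degree `n` modulo hit polynomials. -/
abbrev QP (k n : ℕ) :=
  ↥(homogeneousSubmodule (Fin k) (ZMod 2) n) ⧸
    ((hitSubmodule k).comap (homogeneousSubmodule (Fin k) (ZMod 2) n).subtype)

namespace Kameko

/-- The polynomial algebra `P_4`. -/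
abbrev P := MvPolynomial (Fin 4) (ZMod 2)

section SteenrodSquares

open Polynomial in
/-- The total Steenrod square with a variable recording the degree of its components. -/
noncomputable def gradedSq : P →ₐ[ZMod 2] P[X] :=
  aeval fun j => Polynomial.C (X j) + Polynomial.X * Polynomial.C (X j ^ 2)

/-- The Steenrod square `Sq^i` on `P_4`, as a linear map. -/
noncomputable def sq (i : ℕ) : P →ₗ[ZMod 2] P :=
  (Polynomial.lcoeff P i).restrictScalars (ZMod 2) ∘ₗ gradedSq.toLinearMap

lemma sq_apply (i : ℕ) (f : P) : sq i f = (gradedSq f).coeff i := rfl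

lemma gradedSq_X (j : Fin 4) :
    gradedSq (X j) = Polynomial.C (X j) + Polynomial.X * Polynomial.C (X j ^ 2) := by
  simp [gradedSq]

lemma sq_one (u : ℕ) : sq u 1 = if u = 0 then 1 else 0 := by
  simp [sq_apply, Polynomial.coeff_one]

/-- The coefficient of `T^i` is homogeneous of degree `d + i`. -/
def IsGraded (d : ℕ) (p : Polynomial P) : Prop := ∀ i, (p.coeff i).IsHomogeneous (d + i)

lemma IsGraded.mul {d e : ℕ} {p q : Polynomial P} (hp : IsGraded d p) (hq : IsGraded e q) :
    IsGraded (d + e) (p * q) := fun i => by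
  rw [Polynomial.coeff_mul]
  refine IsHomogeneous.sum _ _ _ fun x hx => ?_
  have h := (hp x.1).mul (hq x.2)
  rw [Finset.HasAntidiagonal.mem_antidiagonal] at hx
  rwa [show d + e + i = d + x.1 + (e + x.2) by omega]

lemma IsGraded.one : IsGraded 0 1 := fun i => by
  rw [Polynomial.coeff_one]
  split_ifs with h
  · subst h; exact isHomogeneous_one _ _
  · exact isHomogeneous_zero _ _ _

lemma IsGraded.pow {d : ℕ} {p : Polynomial P} (hp : IsGraded d p) (m : ℕ) :
    IsGraded (m * d) (p ^ m) := by
  induction m with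
  | zero => simpa using IsGraded.one
  | succ m ih => rw [pow_succ, Nat.succ_mul]; exact ih.mul hp

lemma isGraded_gradedSq_X (j : Fin 4) : IsGraded 1 (gradedSq (X j)) := fun i => by
  rw [gradedSq_X, Polynomial.coeff_add]
  rcases i with _ | _ | i
  · simpa using isHomogeneous_X (ZMod 2) j
  · rw [Polynomial.coeff_X_mul, Polynomial.coeff_C_zero, Polynomial.coeff_C_succ, zero_add]
    exact isHomogeneous_X_pow j 2
  · rw [Polynomial.coeff_X_mul, Polynomial.coeff_C_succ, Polynomial.coeff_C_succ, zero_add]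
    exact isHomogeneous_zero _ _ _

lemma monomial_eq_prod (e : Fin 4 →₀ ℕ) :
    monomial e (1 : ZMod 2) = X 0 ^ e 0 * X 1 ^ e 1 * X 2 ^ e 2 * X 3 ^ e 3 := by
  rw [monomial_eq, Finsupp.prod_fintype _ _ fun _ => pow_zero _, Fin.prod_univ_four]
  simp

lemma isGraded_gradedSq_monomial (e : Fin 4 →₀ ℕ) :
    IsGraded e.degree (gradedSq (monomial e 1)) := by
  rw [monomial_eq_prod, map_mul, map_mul, map_mul, map_pow, map_pow, map_pow, map_pow]
  have h := (((isGraded_gradedSq_X 0).pow (e 0)).mul ((isGraded_gradedSq_X 1).pow (e 1))).mul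
    ((isGraded_gradedSq_X 2).pow (e 2)) |>.mul ((isGraded_gradedSq_X 3).pow (e 3))
  rwa [show e.degree = e 0 * 1 + e 1 * 1 + e 2 * 1 + e 3 * 1 by
    rw [Finsupp.degree_eq_sum, Fin.sum_univ_four]; omega]

lemma sq_isHomogeneous {d : ℕ} {f : P} (hf : f.IsHomogeneous d) (i : ℕ) :
    (sq i f).IsHomogeneous (d + i) := by
  rw [f.as_sum, map_sum]
  refine IsHomogeneous.sum _ _ _ fun e he => ?_
  have hd : e.degree = d := by
    by_contra h
    exact mem_support_iff.1 he (hf.coeff_eq_zero h)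
  rw [← mul_one (coeff e f), ← smul_eq_mul, ← smul_monomial, map_smul, smul_eq_C_mul]
  have h := (isHomogeneous_C (Fin 4) (coeff e f)).mul (isGraded_gradedSq_monomial e i)
  rw [zero_add, hd] at h
  exact h

lemma eval_one_gradedSq (f : P) : (gradedSq f).eval 1 = SqTotal 4 f := by
  induction f using MvPolynomial.induction_on with
  | C a => simp [SqTotal, gradedSq, Polynomial.algebraMap_apply, MvPolynomial.algebraMap_eq]
  | add f g hf hg => simp [hf, hg]
  | mul_X f j hf => simp [hf, gradedSq_X, SqTotal]

lemma homogeneousComponent_sqTotal {d : ℕ} {f : P} (hf : f.IsHomogeneous d) (i : ℕ) :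
    homogeneousComponent (d + i) (SqTotal 4 f) = sq i f := by
  rw [← eval_one_gradedSq, Polynomial.eval_eq_sum_range, map_sum]
  simp only [one_pow, mul_one, ← sq_apply]
  have h (j : ℕ) : homogeneousComponent (d + i) (sq j f) = if i = j then sq j f else 0 := by
    rw [homogeneousComponent_of_mem (sq_isHomogeneous hf j)]
    simp
  simp only [h]
  rw [Finset.sum_ite_eq, ite_eq_left_iff]
  intro hi
  rw [Finset.mem_range, Nat.lt_succ_iff, not_le] at hi
  exact (Polynomial.coeff_eq_zero_of_natDegree_lt hi).symm

lemma sqOp_eq (i : ℕ) (f : P) : SqOp 4 i f = sq i f := by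
  have h : ∀ d, homogeneousComponent (d + i) (SqTotal 4 (homogeneousComponent d f)) =
      sq i (homogeneousComponent d f) := fun d =>
    homogeneousComponent_sqTotal (homogeneousComponent_isHomogeneous d f) i
  simp only [SqOp, h]
  rw [← map_sum, sum_homogeneousComponent]

lemma sq_mem_hitSubmodule {u : ℕ} (hu : 0 < u) (f : P) : sq u f ∈ hitSubmodule 4 :=
  Submodule.subset_span ⟨u, f, hu, (sqOp_eq u f).symm⟩

lemma homogeneousComponent_mem_hitSubmodule (n : ℕ) {f : P} (hf : f ∈ hitSubmodule 4) :
    homogeneousComponent n f ∈ hitSubmodule 4 := by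
  induction hf using Submodule.span_induction with
  | zero => simp
  | add f g _ _ hf hg => rw [map_add]; exact add_mem hf hg
  | smul c f _ hf => rw [map_smul]; exact Submodule.smul_mem _ _ hf
  | mem f hf =>
    obtain ⟨u, f, hu, rfl⟩ := hf
    rw [sqOp_eq, ← sum_homogeneousComponent f, map_sum, map_sum]
    refine Submodule.sum_mem _ fun d _ => ?_
    rw [homogeneousComponent_of_mem
      (sq_isHomogeneous (homogeneousComponent_isHomogeneous d f) u)]
    split_ifs
    · exact sq_mem_hitSubmodule hu _
    · exact zero_mem _

lemma sq_mul (u : ℕ) (f g : P) :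
    sq u (f * g) = ∑ x ∈ Finset.HasAntidiagonal.antidiagonal u, sq x.1 f * sq x.2 g := by
  rw [sq_apply, map_mul, Polynomial.coeff_mul]
  rfl

lemma sq_pow_two_pow (s u : ℕ) (f : P) :
    sq u (f ^ 2 ^ s) = if 2 ^ s ∣ u then sq (u / 2 ^ s) f ^ 2 ^ s else 0 := by
  rw [sq_apply, map_pow, ← Polynomial.map_iterateFrobenius_expand, Polynomial.coeff_map,
    Polynomial.coeff_expand (by positivity)]
  split_ifs
  · rfl
  · simp

lemma sq_zero (f : P) : sq 0 f = f := by
  induction f using MvPolynomial.induction_on with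
  | C a => simp [sq_apply, gradedSq, Polynomial.algebraMap_apply, MvPolynomial.algebraMap_eq]
  | add f g hf hg => rw [map_add, hf, hg]
  | mul_X f j hf => rw [sq_mul]; simp [hf, sq_apply (f := X j), gradedSq_X]

/-- Multiplication by a `2^s`-th power commutes with `Sq^u` for `u < 2^s`. -/
lemma sq_mul_pow_two_pow {s u : ℕ} (hu : u < 2 ^ s) (f g : P) :
    sq u (f * g ^ 2 ^ s) = sq u f * g ^ 2 ^ s := by
  rw [sq_mul, Finset.sum_eq_single (u, 0)]
  · rw [sq_zero]
  · intro x hx hne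
    rw [Finset.HasAntidiagonal.mem_antidiagonal] at hx
    rw [sq_pow_two_pow, if_neg, mul_zero]
    intro h
    have := Nat.eq_zero_of_dvd_of_lt h (by omega)
    exact hne (Prod.ext (by simp; omega) this)
  · simp

end SteenrodSquares

section Words

/-- The number of elements of a letter, where a letter is a number below 16 standing for the set
of positions of its nonzero binary digits. -/
def letterSize (A : ℕ) : ℕ := A % 2 + A / 2 % 2 + A / 4 % 2 + A / 8 % 2

/-- The squarefree monomial of a letter. -/
noncomputable def letterMonomial (A : ℕ) : P :=
  X 0 ^ (A % 2) * X 1 ^ (A / 2 % 2) * X 2 ^ (A / 4 % 2) * X 3 ^ (A / 8 % 2)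

/-- The monomial whose exponents have the letters of a word as binary digits, lowest digit first. -/
noncomputable def wordMonomial : List ℕ → P
  | [] => 1
  | A :: l => letterMonomial A * wordMonomial l ^ 2

/-- The degree of the monomial of a word. -/
def wordDegree : List ℕ → ℕ
  | [] => 0
  | A :: l => letterSize A + 2 * wordDegree l

/-- All entries of a list are letters. -/
def IsWord (l : List ℕ) : Prop := ∀ A ∈ l, A < 16

lemma letterSize_le (A : ℕ) : letterSize A ≤ 4 := by
  unfold letterSize; omega

lemma letterMonomial_zero : letterMonomial 0 = 1 := by simp [letterMonomial]

lemma isHomogeneous_letterMonomial (A : ℕ) :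
    (letterMonomial A).IsHomogeneous (letterSize A) :=
  (((isHomogeneous_X_pow 0 _).mul (isHomogeneous_X_pow 1 _)).mul (isHomogeneous_X_pow 2 _)).mul
    (isHomogeneous_X_pow 3 _)

lemma isHomogeneous_wordMonomial (l : List ℕ) : (wordMonomial l).IsHomogeneous (wordDegree l) := by
  induction l with
  | nil => exact isHomogeneous_one _ _
  | cons A l ih =>
    rw [wordDegree, mul_comm 2]
    exact (isHomogeneous_letterMonomial A).mul (ih.pow 2)

lemma IsWord.cons {A : ℕ} {l : List ℕ} (hA : A < 16) (hl : IsWord l) : IsWord (A :: l) :=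
  List.forall_mem_cons.2 ⟨hA, hl⟩

lemma IsWord.append {l t : List ℕ} (hl : IsWord l) (ht : IsWord t) : IsWord (l ++ t) :=
  List.forall_mem_append.2 ⟨hl, ht⟩

lemma exists_wordMonomial_eq_prod (L : ℕ) : ∀ a b c d : ℕ, a < 2 ^ L → b < 2 ^ L → c < 2 ^ L →
    d < 2 ^ L → ∃ l, l.length = L ∧ IsWord l ∧
      wordMonomial l = X 0 ^ a * X 1 ^ b * X 2 ^ c * X 3 ^ d := by
  induction L with
  | zero =>
    intro a b c d ha hb hc hd
    refine ⟨[], rfl, by simp [IsWord], ?_⟩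
    simp_all [wordMonomial]
  | succ L ih =>
    intro a b c d ha hb hc hd
    rw [pow_succ] at ha hb hc hd
    obtain ⟨l, hL, hl, h⟩ := ih (a / 2) (b / 2) (c / 2) (d / 2)
      (by omega) (by omega) (by omega) (by omega)
    refine ⟨(a % 2 + 2 * (b % 2) + 4 * (c % 2) + 8 * (d % 2)) :: l, by simp [hL],
      hl.cons (by omega), ?_⟩
    have hm (j : Fin 4) (n : ℕ) : (X j : P) ^ n = X j ^ (n % 2) * (X j ^ (n / 2)) ^ 2 := by
      rw [← pow_mul, ← pow_add]; congr 1; omega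
    rw [wordMonomial, h, letterMonomial, hm 0 a, hm 1 b, hm 2 c, hm 3 d,
      show (a % 2 + 2 * (b % 2) + 4 * (c % 2) + 8 * (d % 2)) % 2 = a % 2 by omega,
      show (a % 2 + 2 * (b % 2) + 4 * (c % 2) + 8 * (d % 2)) / 2 % 2 = b % 2 by omega,
      show (a % 2 + 2 * (b % 2) + 4 * (c % 2) + 8 * (d % 2)) / 4 % 2 = c % 2 by omega,
      show (a % 2 + 2 * (b % 2) + 4 * (c % 2) + 8 * (d % 2)) / 8 % 2 = d % 2 by omega]
    ring

lemma exists_wordMonomial_eq (L : ℕ) (e : Fin 4 →₀ ℕ) (he : e.degree < 2 ^ L) :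
    ∃ l, l.length = L ∧ IsWord l ∧ wordMonomial l = monomial e 1 := by
  rw [monomial_eq_prod]
  exact exists_wordMonomial_eq_prod L _ _ _ _ ((Finsupp.le_degree 0 e).trans_lt he)
    ((Finsupp.le_degree 1 e).trans_lt he) ((Finsupp.le_degree 2 e).trans_lt he)
    ((Finsupp.le_degree 3 e).trans_lt he)

lemma wordDegree_eq {e : Fin 4 →₀ ℕ} {l : List ℕ} (h : wordMonomial l = monomial e 1) :
    wordDegree l = e.degree := by
  refine (isHomogeneous_wordMonomial l).inj_right (h ▸ isHomogeneous_monomial 1 rfl) ?_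
  rw [h]
  exact monomial_eq_zero.not.2 one_ne_zero

/-- Homogeneous polynomials are sums of monomials of words of a fixed sufficient length. -/
lemma mem_span_wordMonomial {n L : ℕ} (hn : n < 2 ^ L) {f : P} (hf : f.IsHomogeneous n) :
    f ∈ Submodule.span (ZMod 2)
      {g | ∃ l, l.length = L ∧ IsWord l ∧ wordDegree l = n ∧ g = wordMonomial l} := by
  rw [f.as_sum]
  refine Submodule.sum_mem _ fun e he => ?_
  have hd : e.degree = n := by
    by_contra h
    exact mem_support_iff.1 he (hf.coeff_eq_zero h)
  obtain ⟨l, hL, hl, h⟩ := exists_wordMonomial_eq L e (hd ▸ hn)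
  rw [← mul_one (coeff e f), ← smul_eq_mul, ← smul_monomial, ← h]
  exact Submodule.smul_mem _ _ (Submodule.subset_span
    ⟨l, hL, hl, (wordDegree_eq h).trans hd, rfl⟩)

lemma span_wordMonomial_eq_top :
    Submodule.span (ZMod 2) {g : P | ∃ l, IsWord l ∧ g = wordMonomial l} = ⊤ := by
  refine eq_top_iff.2 fun f _ => ?_
  rw [← sum_homogeneousComponent f]
  refine Submodule.sum_mem _ fun n _ => ?_
  refine Submodule.span_mono ?_
    (mem_span_wordMonomial n.lt_two_pow_self (homogeneousComponent_isHomogeneous n f))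
  rintro _ ⟨l, -, hl, -, rfl⟩
  exact ⟨l, hl, rfl⟩

/-- Multiplication of a square by the monomial of a letter, as a linear map. -/
noncomputable def prependLetter (A : ℕ) : P →ₗ[ZMod 2] P where
  toFun f := letterMonomial A * f ^ 2
  map_add' f g := by rw [CharTwo.add_sq, mul_add]
  map_smul' c f := by
    have hc : c ^ 2 = c := by revert c; decide
    rw [smul_pow, hc, mul_smul_comm, RingHom.id_apply]

lemma prependLetter_apply (A : ℕ) (f : P) : prependLetter A f = letterMonomial A * f ^ 2 := rfl

/-- Prepends the letters of a word to a polynomial, extending concatenation of words. -/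
noncomputable def prepend : List ℕ → P →ₗ[ZMod 2] P
  | [] => LinearMap.id
  | A :: l => prependLetter A ∘ₗ prepend l

lemma prepend_nil (f : P) : prepend [] f = f := rfl

lemma prepend_cons (A : ℕ) (l : List ℕ) (f : P) :
    prepend (A :: l) f = letterMonomial A * prepend l f ^ 2 := rfl

lemma prepend_append (l t : List ℕ) (f : P) : prepend (l ++ t) f = prepend l (prepend t f) := by
  induction l with
  | nil => rfl
  | cons A l ih => rw [List.cons_append, prepend_cons, prepend_cons, ih]

lemma prepend_one (l : List ℕ) : prepend l 1 = wordMonomial l := by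
  induction l with
  | nil => rfl
  | cons A l ih => rw [prepend_cons, ih, wordMonomial]

lemma wordMonomial_append (l t : List ℕ) :
    wordMonomial (l ++ t) = prepend l (wordMonomial t) := by
  rw [← prepend_one, prepend_append, prepend_one]

lemma prepend_mul (l : List ℕ) (f g : P) :
    prepend l (f * g) = prepend l f * g ^ 2 ^ l.length := by
  induction l with
  | nil => simp [prepend_nil]
  | cons A l ih =>
    rw [prepend_cons, ih, prepend_cons, List.length_cons, pow_succ 2, pow_mul]
    ring

lemma wordMonomial_append_eq_mul (l t : List ℕ) :
    wordMonomial (l ++ t) = wordMonomial l * wordMonomial t ^ 2 ^ l.length := by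
  rw [wordMonomial_append, ← one_mul (wordMonomial t), prepend_mul, prepend_one, one_mul]

end Words

section Subletters

/-- The subsets of a letter. -/
def subletters (A : ℕ) : List ℕ :=
  [[0], [0, 1], [0, 2], [0, 1, 2, 3], [0, 4], [0, 1, 4, 5], [0, 2, 4, 6], [0, 1, 2, 3, 4, 5, 6, 7],
    [0, 8], [0, 1, 8, 9], [0, 2, 8, 10], [0, 1, 2, 3, 8, 9, 10, 11], [0, 4, 8, 12],
    [0, 1, 4, 5, 8, 9, 12, 13], [0, 2, 4, 6, 8, 10, 12, 14],
    [0, 1, 2, 3, 4, 5, 6, 7, 8, 9, 10, 11, 12, 13, 14, 15]].getD A []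

/-- The subsets `B` of a letter `A` for which `Sq^((u - |B|) / 2) f` occurs in the Cartan formula
for `Sq^u` of the product of the monomial of `A` and `f ^ 2`. -/
def sublettersFor (A u : ℕ) : List ℕ :=
  (subletters A).filter fun B => Nat.ble (letterSize B) u && Nat.beq ((u - letterSize B) % 2) 0

lemma gradedSq_letterMonomial {A : ℕ} (hA : A < 16) :
    gradedSq (letterMonomial A) = ((subletters A).map fun B =>
      Polynomial.C (letterMonomial (A ^^^ B) * letterMonomial B ^ 2) *
        Polynomial.X ^ letterSize B).sum := by
  interval_cases A <;> simp [subletters, letterMonomial, gradedSq_X, letterSize] <;> ring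

lemma coeff_gradedSq_sq (f : P) (u : ℕ) :
    (gradedSq f ^ 2).coeff u = if u % 2 = 0 then sq (u / 2) f ^ 2 else 0 := by
  have h := sq_pow_two_pow 1 u f
  rw [pow_one, sq_apply, map_pow] at h
  rw [h]
  simp only [Nat.dvd_iff_mod_eq_zero]

lemma sum_map_filter {α M : Type*} [AddCommMonoid M] (p : α → Bool) (f : α → M) (l : List α) :
    ((l.filter p).map f).sum = (l.map fun x => if p x then f x else 0).sum := by
  induction l with
  | nil => rfl
  | cons a l ih => by_cases h : p a <;> simp [h, ih]

/-- The Cartan formula for the product of the monomial of a letter and a square. -/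
lemma sq_prependLetter {A : ℕ} (hA : A < 16) (u : ℕ) (f : P) :
    sq u (prependLetter A f) = ((sublettersFor A u).map fun B =>
      letterMonomial (A ^^^ B) *
        (letterMonomial B * sq ((u - letterSize B) / 2) f) ^ 2).sum := by
  rw [sublettersFor, sum_map_filter, prependLetter_apply, sq_apply, map_mul, map_pow,
    gradedSq_letterMonomial hA, ← List.sum_map_mul_right]
  rw [show ∀ l : List (Polynomial P), l.sum.coeff u = (l.map fun p => p.coeff u).sum from
    fun l => map_list_sum (Polynomial.lcoeff P u) l, List.map_map]
  refine congrArg List.sum (List.map_congr_left fun B _ => ?_)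
  rw [Function.comp_apply, mul_assoc, Polynomial.coeff_C_mul, Polynomial.coeff_X_pow_mul',
    coeff_gradedSq_sq]
  by_cases h₁ : letterSize B ≤ u <;> by_cases h₂ : (u - letterSize B) % 2 = 0
  · simp [h₁, h₂]; ring
  all_goals simp [h₁, h₂]

lemma subletters_eq_cons : ∀ A < 16, subletters A = 0 :: (subletters A).tail := by decide

lemma letterSize_xor_lt : ∀ A < 16, ∀ B ∈ (subletters A).tail,
    A ^^^ B < 16 ∧ letterSize (A ^^^ B) < letterSize A := by decide

set_option maxRecDepth 10000 in
lemma exponents_mul : ∀ A < 16, ∀ B ∈ subletters A, ∀ C < 16,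
    A ^^^ B ^^^ C < 16 ∧ B ||| (A &&& C) < 16 ∧ ∀ i ∈ [1, 2, 4, 8],
      C / i % 2 + (A ^^^ B) / i % 2 + 2 * (B / i % 2) =
        (A ^^^ B ^^^ C) / i % 2 + 2 * ((B ||| (A &&& C)) / i % 2) := by
  decide +kernel

lemma letterMonomial_mul {A B C : ℕ} (hA : A < 16) (hB : B ∈ subletters A) (hC : C < 16) :
    letterMonomial C * (letterMonomial (A ^^^ B) * letterMonomial B ^ 2) =
      letterMonomial (A ^^^ B ^^^ C) * letterMonomial (B ||| (A &&& C)) ^ 2 := by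
  have h := (exponents_mul A hA B hB C hC).2.2
  simp only [List.forall_mem_cons, List.not_mem_nil, Nat.div_one, false_implies, implies_true,
    and_true] at h
  obtain ⟨h₀, h₁, h₂, h₃⟩ := h
  have hm (x : P) (a b c : ℕ) : x ^ (a + b + 2 * c) = x ^ a * x ^ b * (x ^ c) ^ 2 := by
    rw [pow_add, pow_add, mul_comm 2, pow_mul]
  have hm' (x : P) (a c : ℕ) : x ^ (a + 2 * c) = x ^ a * (x ^ c) ^ 2 := by
    rw [pow_add, mul_comm 2, pow_mul]
  have e (j : Fin 4) {a b c a' c' : ℕ} (h : a + b + 2 * c = a' + 2 * c') :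
      (X j : P) ^ a * X j ^ b * (X j ^ c) ^ 2 = X j ^ a' * (X j ^ c') ^ 2 := by
    rw [← hm, h, hm']
  have h := congrArg₂ (· * ·) (congrArg₂ (· * ·) (e 0 h₀) (e 1 h₁))
    (congrArg₂ (· * ·) (e 2 h₂) (e 3 h₃))
  unfold letterMonomial
  linear_combination h

/-- The Cartan formula with a further letter multiplied in, sorted by letters. -/
lemma letterMonomial_mul_sq_prependLetter {A C : ℕ} (hA : A < 16) (hC : C < 16) (u : ℕ) (f : P) :
    letterMonomial C * sq u (prependLetter A f) = ((sublettersFor A u).map fun B =>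
      prependLetter (A ^^^ B ^^^ C)
        (letterMonomial (B ||| (A &&& C)) * sq ((u - letterSize B) / 2) f)).sum := by
  rw [sq_prependLetter hA, ← List.sum_map_mul_left]
  refine congrArg List.sum (List.map_congr_left fun B hB => ?_)
  rw [prependLetter_apply, mul_pow, mul_pow, ← mul_assoc (letterMonomial (A ^^^ B)),
    ← mul_assoc (letterMonomial C), letterMonomial_mul hA (List.mem_of_mem_filter hB) hC, mul_assoc]

end Subletters

section Ideals

/-- The sequence of letter sizes of the second word, padded by zeros, is lexicographically smaller
than the given sequence. -/
def Lower : List ℕ → List ℕ → Prop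
  | [], _ => False
  | a :: ω, t => letterSize (t.headD 0) < a ∨ letterSize (t.headD 0) = a ∧ Lower ω t.tail

/-- The span of the monomials of words whose sequence of letter sizes is smaller than `ω`. -/
noncomputable def low (ω : List ℕ) : Submodule (ZMod 2) P :=
  Submodule.span (ZMod 2) {g | ∃ t, IsWord t ∧ Lower ω t ∧ g = wordMonomial t}

/-- The span of the images of the operations `Sq^u` with `0 < u < 2^s`. -/
noncomputable def short (s : ℕ) : Submodule (ZMod 2) P :=
  Submodule.span (ZMod 2) {g | ∃ u f, 0 < u ∧ u < 2 ^ s ∧ g = sq u f}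

lemma IsWord.headD {t : List ℕ} (ht : IsWord t) : t.headD 0 < 16 := by
  cases t with
  | nil => simp
  | cons A t => exact ht A (by simp)

lemma IsWord.tail {t : List ℕ} (ht : IsWord t) : IsWord t.tail :=
  fun A hA => ht A (List.mem_of_mem_tail hA)

lemma wordMonomial_eq_prependLetter (t : List ℕ) :
    wordMonomial t = prependLetter (t.headD 0) (wordMonomial t.tail) := by
  cases t with
  | nil => simp [prependLetter_apply, wordMonomial, letterMonomial_zero]
  | cons A t => rfl

lemma prependLetter_mem_low {A a : ℕ} (hA : A < 16) (h : letterSize A < a) (ω : List ℕ) (f : P) :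
    prependLetter A f ∈ low (a :: ω) := by
  have h : Submodule.span (ZMod 2) {g : P | ∃ l, IsWord l ∧ g = wordMonomial l} ≤
      (low (a :: ω)).comap (prependLetter A) := by
    rw [Submodule.span_le]
    rintro _ ⟨l, hl, rfl⟩
    exact Submodule.subset_span ⟨A :: l, hl.cons hA, Or.inl h, rfl⟩
  rw [span_wordMonomial_eq_top] at h
  exact h trivial

lemma prependLetter_mem_low_cons {A : ℕ} (hA : A < 16) {ω : List ℕ} {f : P} (hf : f ∈ low ω) :
    prependLetter A f ∈ low (letterSize A :: ω) := by
  have h : low ω ≤ (low (letterSize A :: ω)).comap (prependLetter A) := by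
    rw [low, Submodule.span_le]
    rintro _ ⟨l, hl, h, rfl⟩
    exact Submodule.subset_span ⟨A :: l, hl.cons hA, Or.inr ⟨rfl, h⟩, rfl⟩
  exact h hf

lemma mul_mem_low {ω : List ℕ} {f : P} (hf : f ∈ low ω) (g : P) :
    f * g ^ 2 ^ ω.length ∈ low ω := by
  induction ω generalizing f with
  | nil =>
    have : low [] = ⊥ := by simp [low, Lower]
    rw [this, Submodule.mem_bot] at hf ⊢
    rw [hf, zero_mul]
  | cons a ω ih =>
    induction hf using Submodule.span_induction with
    | zero => rw [zero_mul]; exact zero_mem _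
    | add f f' _ _ hf hf' => rw [add_mul]; exact add_mem hf hf'
    | smul c f _ hf => rw [smul_mul_assoc]; exact Submodule.smul_mem _ _ hf
    | mem f hf =>
      obtain ⟨t, ht, h, rfl⟩ := hf
      have e : wordMonomial t * g ^ 2 ^ (a :: ω).length =
          prependLetter (t.headD 0) (wordMonomial t.tail * g ^ 2 ^ ω.length) := by
        rw [wordMonomial_eq_prependLetter, prependLetter_apply, prependLetter_apply,
          List.length_cons, pow_succ 2, pow_mul]
        ring
      rw [e]
      obtain h | ⟨rfl, h⟩ := h
      · exact prependLetter_mem_low ht.headD h _ _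
      · exact prependLetter_mem_low_cons ht.headD
          (ih (Submodule.subset_span ⟨t.tail, ht.tail, h, rfl⟩))

lemma mul_mem_short {s : ℕ} {f : P} (hf : f ∈ short s) (g : P) : f * g ^ 2 ^ s ∈ short s := by
  induction hf using Submodule.span_induction with
  | zero => rw [zero_mul]; exact zero_mem _
  | add f f' _ _ hf hf' => rw [add_mul]; exact add_mem hf hf'
  | smul c f _ hf => rw [smul_mul_assoc]; exact Submodule.smul_mem _ _ hf
  | mem f hf =>
    obtain ⟨u, f, hu, hs, rfl⟩ := hf
    exact Submodule.subset_span ⟨u, f * g ^ 2 ^ s, hu, hs, (sq_mul_pow_two_pow hs f g).symm⟩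

lemma prependLetter_mem_of_short {A s : ℕ} (hA : A < 16) (ω : List ℕ) {f : P} (hf : f ∈ short s) :
    prependLetter A f ∈ short (s + 1) ⊔ low (letterSize A :: ω) := by
  induction hf using Submodule.span_induction with
  | zero => rw [map_zero]; exact zero_mem _
  | add f f' _ _ hf hf' => rw [map_add]; exact add_mem hf hf'
  | smul c f _ hf => rw [map_smul]; exact Submodule.smul_mem _ _ hf
  | mem f hf =>
    obtain ⟨u, f, hu, hs, rfl⟩ := hf
    have h := sq_prependLetter hA (2 * u) f
    rw [sublettersFor, subletters_eq_cons A hA, List.filter_cons_of_pos (by simp [letterSize]),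
      List.map_cons, List.sum_cons, Nat.xor_zero, letterMonomial_zero, one_mul,
      show (2 * u - letterSize 0) / 2 = u by simp [letterSize], ← prependLetter_apply] at h
    rw [eq_sub_of_add_eq h.symm]
    refine sub_mem (Submodule.mem_sup_left (Submodule.subset_span
      ⟨2 * u, _, by omega, by rw [pow_succ]; omega, rfl⟩)) (Submodule.mem_sup_right ?_)
    refine list_sum_mem fun g hg => ?_
    obtain ⟨B, hB, rfl⟩ := List.mem_map.1 hg
    have := letterSize_xor_lt A hA B (List.mem_of_mem_filter hB)
    exact prependLetter_mem_low this.1 this.2 _ _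

lemma prepend_mem {p : List ℕ} (hp : IsWord p) {s : ℕ} {ω : List ℕ} {f : P}
    (hf : f ∈ short s ⊔ low ω) :
    prepend p f ∈ short (s + p.length) ⊔ low (p.map letterSize ++ ω) := by
  induction p with
  | nil => exact hf
  | cons A p ih =>
    have hA : A < 16 := hp A (by simp)
    obtain ⟨x, hx, y, hy, h⟩ := Submodule.mem_sup.1 (ih fun B hB => hp B (by simp [hB]))
    change prependLetter A (prepend p f) ∈ _
    rw [← h, map_add]
    exact add_mem (prependLetter_mem_of_short hA _ hx)
      (Submodule.mem_sup_right (prependLetter_mem_low_cons hA hy))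

lemma Lower.of_append_zero {ω t : List ℕ} (h : Lower (ω ++ [0]) t) : Lower ω t := by
  induction ω generalizing t with
  | nil => simp [Lower] at h
  | cons a ω ih => exact h.imp_right (And.imp_right ih)

lemma low_append_zero (ω : List ℕ) : low (ω ++ [0]) ≤ low ω :=
  Submodule.span_mono fun _ ⟨t, ht, h, e⟩ => ⟨t, ht, h.of_append_zero, e⟩

end Ideals

section Certificates

/-- The number whose base 16 digits are the letters of a word, the last letter being the lowest. -/
def code (l : List ℕ) : ℕ := l.foldl (fun v A => 16 * v + A) 0

/-- The `s` lowest base 16 digits of a number, lowest digit first. -/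
def digits : ℕ → ℕ → List ℕ
  | 0, _ => []
  | s + 1, m => m % 16 :: digits s (m / 16)

/-- The word with `s` letters and the given code. -/
def word (s m : ℕ) : List ℕ := (digits s m).reverse

/-- Adds a number to a set of numbers, or removes it if it is present. -/
def toggle (v : ℕ) : List ℕ → List ℕ
  | [] => [v]
  | a :: l => bif Nat.beq a v then l else a :: toggle v l

/-- `f n`, written so that the kernel evaluates `n` first. -/
def force {α : Type} : ℕ → (ℕ → α) → α
  | 0, f => f 0
  | n + 1, f => f (Nat.succ n)

/-- Adds to `acc` the codes of the terms of `Sq^u` of the monomial of a word, multiplied by the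
monomial of the letter `C` and prepended by the word with code `v`. -/
def steenrod : (h : List ℕ) → (u C v : ℕ) → List ℕ → List ℕ
  | [], u, C, v, acc => bif Nat.beq u 0 then toggle (16 * v + C) acc else acc
  | A :: h, u, C, v, acc => force u fun u => force C fun C =>
      (sublettersFor A u).foldr (fun B acc =>
        steenrod h ((u - letterSize B) / 2) (B ||| (A &&& C)) (16 * v + (A ^^^ B ^^^ C)) acc) acc

/-- Like `steenrod`, leaving out terms whose sequence of letter sizes is below `ω`, and terms whose
sequence of letter sizes is `ω` and whose code is below `W`. -/
def boundedSteenrod (W : ℕ) : (h ω : List ℕ) → (u C v : ℕ) → List ℕ → List ℕ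
  | [], _, u, C, v, acc => bif Nat.beq u 0 then
       (bif Nat.beq C 0 && Nat.blt (16 * v + C) W then acc else toggle (16 * v + C) acc) else acc
  | A :: h, ω, u, C, v, acc => force u fun u => force C fun C =>
      (sublettersFor A u).foldr (fun B acc =>
        force (A ^^^ B ^^^ C) fun x =>
        bif Nat.blt (letterSize x) (ω.headD 0) then acc else
          (bif Nat.beq (letterSize x) (ω.headD 0) then boundedSteenrod W h ω.tail else steenrod h)
            ((u - letterSize B) / 2) (B ||| (A &&& C)) (16 * v + x) acc) acc

/-- The monomial of the word `w` with `s` letters agrees with the sum of the images of the monomials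
of the words `hs` under operations `Sq^u` with `0 < u < 2^s`, up to lower terms. -/
def isCertificate (s : ℕ) (w : List ℕ) (hs : List (List ℕ)) : Bool :=
  (hs.all fun h => Nat.blt (wordDegree h) (wordDegree w) &&
    Nat.blt (wordDegree w) (wordDegree h + 2 ^ s)) &&
  decide (hs.foldr (fun h acc => boundedSteenrod (256 * code w) h (w.map letterSize ++ [0])
    (wordDegree w - wordDegree h) 0 0 acc) [] = [256 * code w])

/-- Each entry of the table consists of the code of a word with `s` letters and of the codes of
words with `s + 1` letters certifying that it is reducible. -/
def checkTable (s : ℕ) (c : List (ℕ × List ℕ)) : Bool :=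
  c.all fun p => isCertificate s (word s p.1) (p.2.map (word (s + 1)))

lemma code_append (l : List ℕ) (A : ℕ) : code (l ++ [A]) = 16 * code l + A := by simp [code]

lemma word_succ (s m : ℕ) : word (s + 1) m = word s (m / 16) ++ [m % 16] := by
  simp [word, digits]

lemma word_succ_mul_add {s v A : ℕ} (hA : A < 16) :
    word (s + 1) (16 * v + A) = word s v ++ [A] := by
  rw [word_succ, show (16 * v + A) / 16 = v by omega, show (16 * v + A) % 16 = A by omega]

lemma length_word (s m : ℕ) : (word s m).length = s := by
  induction s generalizing m with
  | zero => rfl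
  | succ s ih => rw [word_succ, List.length_append, ih]; rfl

lemma isWord_word (s m : ℕ) : IsWord (word s m) := by
  induction s generalizing m with
  | zero => simp [IsWord, word, digits]
  | succ s ih =>
    rw [word_succ]
    exact (ih _).append (by simp [IsWord]; omega)

lemma code_word_le (s m : ℕ) : code (word s m) ≤ m := by
  induction s generalizing m with
  | zero => simp [word, digits, code]
  | succ s ih =>
    rw [word_succ, code_append]
    have := ih (m / 16)
    omega

lemma word_code {w : List ℕ} (hw : IsWord w) : word w.length (code w) = w := by
  induction w using List.reverseRecOn with
  | nil => rfl
  | append_singleton w A ih =>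
    rw [code_append, List.length_append, List.length_singleton,
      word_succ_mul_add (hw A (by simp)), ih fun B hB => hw B (by simp [hB])]

lemma force_eq {α : Type} (n : ℕ) (f : ℕ → α) : force n f = f n := by
  cases n <;> rfl

lemma wordMonomial_append_zero (l : List ℕ) : wordMonomial (l ++ [0]) = wordMonomial l := by
  rw [wordMonomial_append, ← prepend_one l]
  simp [wordMonomial, letterMonomial_zero]

/-- The sum of the monomials of the words with `s` letters and the given codes. -/
noncomputable def monomialSum (s : ℕ) (l : List ℕ) : P :=
  (l.map fun m => wordMonomial (word s m)).sum

lemma monomialSum_toggle (s v : ℕ) (l : List ℕ) :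
    monomialSum s (toggle v l) = wordMonomial (word s v) + monomialSum s l := by
  induction l with
  | nil => rfl
  | cons a l ih =>
    rw [toggle]
    cases h : Nat.beq a v with
    | true =>
      rw [Nat.eq_of_beq_eq_true h, cond_true]
      simp [monomialSum, ← add_assoc, CharTwo.add_self_eq_zero]
    | false =>
      rw [cond_false, monomialSum, List.map_cons, List.sum_cons, ← monomialSum, ih, monomialSum,
        monomialSum, List.map_cons, List.sum_cons, add_left_comm]

lemma mkQ_monomialSum_foldr {α : Type} (M : Submodule (ZMod 2) P) {s : ℕ} {g : α → P} {l : List α}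
    {F : α → List ℕ → List ℕ}
    (h : ∀ B ∈ l, ∀ acc, M.mkQ (monomialSum s (F B acc)) = M.mkQ (g B + monomialSum s acc))
    (acc : List ℕ) :
    M.mkQ (monomialSum s (l.foldr F acc)) = M.mkQ ((l.map g).sum + monomialSum s acc) := by
  induction l with
  | nil => simp
  | cons B l ih =>
    rw [List.foldr_cons, h B (by simp), map_add, ih fun B hB => h B (by simp [hB]),
      List.map_cons, List.sum_cons, add_assoc, map_add _ (g B)]

lemma prepend_sq_nil (k u v : ℕ) {C : ℕ} (hC : C < 16) :
    prepend (word k v) (letterMonomial C * sq u (wordMonomial [])) =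
      if u = 0 then wordMonomial (word (k + 1) (16 * v + C)) else 0 := by
  rw [wordMonomial, sq_one, word_succ_mul_add hC, wordMonomial_append]
  split_ifs <;> simp [wordMonomial]

lemma prepend_sq_cons (k u v : ℕ) {A C : ℕ} (hA : A < 16) (hC : C < 16) (h : List ℕ) :
    prepend (word k v) (letterMonomial C * sq u (wordMonomial (A :: h))) =
      ((sublettersFor A u).map fun B => prepend (word (k + 1) (16 * v + (A ^^^ B ^^^ C)))
        (letterMonomial (B ||| (A &&& C)) *
          sq ((u - letterSize B) / 2) (wordMonomial h))).sum := by
  rw [show wordMonomial (A :: h) = prependLetter A (wordMonomial h) from rfl,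
    letterMonomial_mul_sq_prependLetter hA hC, map_list_sum, List.map_map]
  refine congrArg List.sum (List.map_congr_left fun B hB => ?_)
  rw [word_succ_mul_add (exponents_mul A hA B (List.mem_of_mem_filter hB) C hC).1, prepend_append]
  rfl

lemma mkQ_steenrod (M : Submodule (ZMod 2) P) {h : List ℕ} (hh : IsWord h) (k u v : ℕ) {C : ℕ}
    (hC : C < 16) (acc : List ℕ) :
    M.mkQ (monomialSum (k + h.length + 1) (steenrod h u C v acc)) =
      M.mkQ (prepend (word k v) (letterMonomial C * sq u (wordMonomial h)) +
        monomialSum (k + h.length + 1) acc) := by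
  induction h generalizing k u v C acc with
  | nil =>
    rw [prepend_sq_nil k u v hC, steenrod, List.length_nil, add_zero]
    cases hu : Nat.beq u 0 with
    | true => rw [if_pos (Nat.eq_of_beq_eq_true hu), cond_true, monomialSum_toggle]
    | false => rw [if_neg (Nat.ne_of_beq_eq_false hu), cond_false, zero_add]
  | cons A h ih =>
    have hA : A < 16 := hh A (by simp)
    rw [prepend_sq_cons k u v hA hC, steenrod, force_eq, force_eq]
    refine mkQ_monomialSum_foldr M (fun B hB acc => ?_) acc
    have := ih (fun B hB => hh B (by simp [hB])) (k + 1) ((u - letterSize B) / 2)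
      (16 * v + (A ^^^ B ^^^ C)) (exponents_mul A hA B (List.mem_of_mem_filter hB) C hC).2.1 acc
    rwa [show k + 1 + h.length + 1 = k + (A :: h).length + 1 by simp; omega] at this

/-- The span of the monomials of words with the same letter sizes as `w` and smaller code. -/
noncomputable def small (w : List ℕ) : Submodule (ZMod 2) P :=
  Submodule.span (ZMod 2) {g | ∃ t, t.length = w.length ∧ IsWord t ∧
    t.map letterSize = w.map letterSize ∧ code t < code w ∧ g = wordMonomial t}

/-- The monomial of the word is a sum of images of short Steenrod operations and of lower terms. -/
def IsReducible (w : List ℕ) : Prop :=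
  wordMonomial w ∈ short w.length ⊔ (low (w.map letterSize) ⊔ small w)

lemma prepend_mem_low {p : List ℕ} (hp : IsWord p) {ω : List ℕ} {f : P} (hf : f ∈ low ω) :
    prepend p f ∈ low (p.map letterSize ++ ω) := by
  induction p with
  | nil => exact hf
  | cons A p ih =>
    exact prependLetter_mem_low_cons (hp A (by simp)) (ih fun B hB => hp B (by simp [hB]))

lemma eq_zero_of_letterSize_eq_zero : ∀ A < 16, letterSize A = 0 → A = 0 := by decide

lemma wordMonomial_mem_small {w : List ℕ} {k v : ℕ}
    (h : w.map letterSize ++ [0] = (word k v).map letterSize) (hv : v < 16 * code w) :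
    wordMonomial (word k v) ∈ small w := by
  have hk := congrArg List.length h
  rw [List.length_append, List.length_map, List.length_map, length_word] at hk
  obtain ⟨rfl⟩ : w.length + 1 = k := hk
  rw [word_succ, List.map_append] at h
  obtain ⟨h, h'⟩ := List.append_inj' h rfl
  have : v % 16 = 0 := eq_zero_of_letterSize_eq_zero _ (by omega) (by simpa using h'.symm)
  rw [word_succ, this, wordMonomial_append_zero]
  refine Submodule.subset_span ⟨_, length_word _ _, isWord_word _ _, h.symm, ?_, rfl⟩
  have := code_word_le w.length (v / 16)
  omega

lemma mkQ_eq_zero {M : Submodule (ZMod 2) P} {f : P} (hf : f ∈ M) : M.mkQ f = 0 :=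
  (Submodule.Quotient.mk_eq_zero M).2 hf

lemma mkQ_boundedSteenrod {w h ω : List ℕ} (hh : IsWord h) (k u v : ℕ) {C : ℕ}
    (hC : C < 16) (hω : ω.length = h.length)
    (hw : w.map letterSize ++ [0] = (word k v).map letterSize ++ ω) (acc : List ℕ) :
    (low (w.map letterSize) ⊔ small w).mkQ
        (monomialSum (k + h.length + 1) (boundedSteenrod (256 * code w) h ω u C v acc)) =
      (low (w.map letterSize) ⊔ small w).mkQ
        (prepend (word k v) (letterMonomial C * sq u (wordMonomial h)) +
          monomialSum (k + h.length + 1) acc) := by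
  induction h generalizing ω k u v C acc with
  | nil =>
    rw [prepend_sq_nil k u v hC, boundedSteenrod, List.length_nil, add_zero]
    cases hu : Nat.beq u 0 with
    | false => rw [if_neg (Nat.ne_of_beq_eq_false hu), cond_false, zero_add]
    | true =>
      rw [if_pos (Nat.eq_of_beq_eq_true hu), cond_true]
      cases hd : Nat.beq C 0 && Nat.blt (16 * v + C) (256 * code w) with
      | false => rw [cond_false, monomialSum_toggle]
      | true =>
        rw [Bool.and_eq_true] at hd
        obtain rfl := Nat.eq_of_beq_eq_true hd.1
        rw [List.length_eq_zero_iff.1 hω, List.append_nil] at hw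
        have hv : v < 16 * code w := by
          have := Nat.le_of_ble_eq_true hd.2
          omega
        have := mkQ_eq_zero (Submodule.mem_sup_right (S := low (w.map letterSize))
          (wordMonomial_mem_small hw hv))
        rw [cond_true, map_add, word_succ_mul_add (by omega), wordMonomial_append_zero, this,
          zero_add]
  | cons A h ih =>
    have hA : A < 16 := hh A (by simp)
    obtain _ | ⟨a, ω⟩ := ω
    · simp at hω
    have hh' : IsWord h := fun B hB => hh B (by simp [hB])
    rw [prepend_sq_cons k u v hA hC, boundedSteenrod, force_eq, force_eq]
    refine mkQ_monomialSum_foldr _ (fun B hB acc => ?_) acc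
    obtain ⟨hx, hC', -⟩ := exponents_mul A hA B (List.mem_of_mem_filter hB) C hC
    rw [force_eq, show k + (A :: h).length + 1 = k + 1 + h.length + 1 by simp; omega]
    cases h₁ : Nat.blt (letterSize (A ^^^ B ^^^ C)) ((a :: ω).headD 0) with
    | true =>
      have hm : _ ∈ low (w.map letterSize) := low_append_zero _
        (hw ▸ prepend_mem_low (isWord_word k v) (prependLetter_mem_low hx
          (Nat.le_of_ble_eq_true h₁) ω (letterMonomial (B ||| (A &&& C)) *
            sq ((u - letterSize B) / 2) (wordMonomial h))))
      rw [cond_true, map_add, word_succ_mul_add hx, prepend_append,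
        show ∀ x, prepend [x] = prependLetter x from fun _ => rfl,
        mkQ_eq_zero (Submodule.mem_sup_left hm), zero_add]
    | false =>
      rw [cond_false]
      cases h₂ : Nat.beq (letterSize (A ^^^ B ^^^ C)) ((a :: ω).headD 0) with
      | true =>
        refine ih hh' (k + 1) _ _ hC' (by simpa using hω) ?_ acc
        rw [hw, word_succ_mul_add hx, List.map_append, List.append_assoc, List.map_singleton,
          Nat.eq_of_beq_eq_true h₂]
        rfl
      | false => exact mkQ_steenrod _ hh' (k + 1) _ _ hC' acc

lemma isReducible_of_isCertificate {w : List ℕ} (hw : IsWord w) {hs : List (List ℕ)}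
    (hhs : ∀ h ∈ hs, IsWord h ∧ h.length = w.length + 1)
    (h : isCertificate w.length w hs = true) : IsReducible w := by
  rw [isCertificate, Bool.and_eq_true, List.all_eq_true, decide_eq_true_iff] at h
  obtain ⟨hu, h⟩ := h
  have key := mkQ_monomialSum_foldr (low (w.map letterSize) ⊔ small w) (s := w.length + 2)
    (g := fun h => sq (wordDegree w - wordDegree h) (wordMonomial h)) (l := hs)
    (F := fun h acc => boundedSteenrod (256 * code w) h (w.map letterSize ++ [0])
      (wordDegree w - wordDegree h) 0 0 acc) (fun h hh acc => by
        have := mkQ_boundedSteenrod (w := w) (hhs h hh).1 0 (wordDegree w - wordDegree h) 0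
          (C := 0) (by omega) (ω := w.map letterSize ++ [0]) (by simp [(hhs h hh).2]) rfl acc
        rw [(hhs h hh).2, zero_add, letterMonomial_zero, one_mul] at this
        exact this) []
  rw [h] at key
  have e : monomialSum (w.length + 2) [256 * code w] = wordMonomial w := by
    have : 256 * code w = 16 * (16 * code w + 0) + 0 := by omega
    rw [monomialSum, List.map_singleton, List.sum_singleton, this, word_succ_mul_add (by omega),
      word_succ_mul_add (by omega), wordMonomial_append_zero, wordMonomial_append_zero,
      word_code hw]
  rw [e, show monomialSum (w.length + 2) [] = 0 from rfl, add_zero, Submodule.mkQ_apply,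
    Submodule.mkQ_apply, Submodule.Quotient.eq] at key
  rw [IsReducible, ← sub_add_cancel (wordMonomial w) (List.sum _)]
  refine add_mem (Submodule.mem_sup_right key) (Submodule.mem_sup_left ?_)
  refine list_sum_mem fun g hg => ?_
  obtain ⟨h, hh, rfl⟩ := List.mem_map.1 hg
  have := hu h hh
  rw [Bool.and_eq_true] at this
  have h₁ := Nat.le_of_ble_eq_true this.1
  have h₂ := Nat.le_of_ble_eq_true this.2
  exact Submodule.subset_span ⟨_, _, by omega, by omega, rfl⟩

lemma isReducible_of_checkTable {s : ℕ} {c : List (ℕ × List ℕ)} (h : checkTable s c = true)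
    {p : ℕ × List ℕ} (hp : p ∈ c) : IsReducible (word s p.1) := by
  have h := List.all_eq_true.1 h p hp
  have hs := length_word s p.1
  refine isReducible_of_isCertificate (isWord_word _ _) (hs := p.2.map (word (s + 1))) ?_
    (by rwa [hs])
  intro h hh
  obtain ⟨m, -, rfl⟩ := List.mem_map.1 hh
  rw [hs]
  exact ⟨isWord_word _ _, length_word _ _⟩

end Certificates

section Reduction

lemma code_append_eq (l t : List ℕ) : code (l ++ t) = code l * 16 ^ t.length + code t := by
  induction t using List.reverseRecOn with
  | nil => simp [code]
  | append_singleton t A ih =>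
    rw [← List.append_assoc, code_append, code_append, ih, List.length_append,
      List.length_singleton, pow_succ]
    ring

lemma code_cons (A : ℕ) (l : List ℕ) : code (A :: l) = A * 16 ^ l.length + code l := by
  have := code_append_eq [A] l
  rwa [List.singleton_append, show code [A] = A by simp [code]] at this

lemma code_lt {l : List ℕ} (hl : IsWord l) : code l < 16 ^ l.length := by
  induction l with
  | nil => simp [code]
  | cons A l ih =>
    have hA := hl A (by simp)
    have := ih fun B hB => hl B (by simp [hB])
    rw [code_cons, List.length_cons, pow_succ]
    nlinarith

lemma isWord_map_letterSize (l : List ℕ) : IsWord (l.map letterSize) := fun a ha => by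
  obtain ⟨A, -, rfl⟩ := List.mem_map.1 ha
  have := letterSize_le A
  omega

lemma Lower.code_map_letterSize_lt {ω ω' t l : List ℕ} (h : Lower ω t)
    (hl : l.map letterSize = ω ++ ω') (ht : t.length = l.length) :
    code (t.map letterSize) < code (l.map letterSize) := by
  induction ω generalizing t l with
  | nil => exact h.elim
  | cons a ω ih =>
    obtain _ | ⟨A, l⟩ := l
    · simp at hl
    obtain _ | ⟨B, t⟩ := t
    · simp at ht
    rw [List.map_cons, List.cons_append, List.cons.injEq] at hl
    rw [List.length_cons, List.length_cons, Nat.add_right_cancel_iff] at ht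
    rw [List.map_cons, List.map_cons, code_cons, code_cons, List.length_map, List.length_map, ht]
    obtain h | ⟨h, h'⟩ := h
    · have h₁ := code_lt (isWord_map_letterSize t)
      rw [List.length_map, ht] at h₁
      have h₂ : letterSize B + 1 ≤ letterSize A := by rw [hl.1]; exact h
      nlinarith
    · have : code (t.map letterSize) < code (l.map letterSize) := ih h' hl.2 ht
      have h₂ : letterSize B = letterSize A := by rw [hl.1]; exact h
      rw [h₂]
      omega

/-- Truncates a word to its first `L` letters, or pads it with zeros to `L` letters. -/
def resize : ℕ → List ℕ → List ℕ
  | 0, _ => []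
  | L + 1, t => t.headD 0 :: resize L t.tail

lemma length_resize (L : ℕ) (t : List ℕ) : (resize L t).length = L := by
  induction L generalizing t with
  | zero => rfl
  | succ L ih => rw [resize, List.length_cons, ih]

lemma IsWord.resize {t : List ℕ} (ht : IsWord t) (L : ℕ) : IsWord (resize L t) := by
  induction L generalizing t with
  | zero => simp [IsWord, Kameko.resize]
  | succ L ih => exact (ih ht.tail).cons ht.headD

lemma Lower.resize {ω t : List ℕ} (h : Lower ω t) {L : ℕ} (hL : ω.length ≤ L) :
    Lower ω (resize L t) := by
  induction ω generalizing t L with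
  | nil => exact h
  | cons a ω ih =>
    obtain _ | L := L
    · simp at hL
    · exact h.imp_right (And.imp_right fun h => ih h (by simpa using hL))

lemma wordMonomial_eq_one {t : List ℕ} (ht : IsWord t) (h : wordDegree t = 0) :
    wordMonomial t = 1 := by
  induction t with
  | nil => rfl
  | cons A t ih =>
    rw [wordDegree] at h
    rw [wordMonomial, ih (fun B hB => ht B (by simp [hB])) (by omega),
      eq_zero_of_letterSize_eq_zero A (ht A (by simp)) (by omega), letterMonomial_zero, one_pow,
      one_mul]

lemma wordDegree_eq_headD_tail (t : List ℕ) :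
    wordDegree t = letterSize (t.headD 0) + 2 * wordDegree t.tail := by
  cases t with
  | nil => rfl
  | cons A t => rfl

lemma resize_spec {t : List ℕ} (ht : IsWord t) {L : ℕ} (h : wordDegree t < 2 ^ L) :
    wordMonomial (resize L t) = wordMonomial t ∧ wordDegree (resize L t) = wordDegree t := by
  induction L generalizing t with
  | zero =>
    have h : wordDegree t = 0 := by omega
    exact ⟨(wordMonomial_eq_one ht h).symm, h.symm⟩
  | succ L ih =>
    rw [wordDegree_eq_headD_tail, pow_succ] at h
    obtain ⟨h₁, h₂⟩ := ih ht.tail (by omega)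
    rw [wordMonomial_eq_prependLetter t, wordDegree_eq_headD_tail t, resize, wordMonomial, h₁,
      wordDegree, h₂]
    exact ⟨rfl, rfl⟩

lemma short_le_hitSubmodule (s : ℕ) : short s ≤ hitSubmodule 4 := by
  rw [short, Submodule.span_le]
  rintro _ ⟨u, f, hu, -, rfl⟩
  exact sq_mem_hitSubmodule hu f

/-- The monomial of a word with a reducible factor is, modulo hit polynomials, a sum of monomials
with smaller sequence of letter sizes, or with the same such sequence and smaller code. -/
lemma wordMonomial_mem_of_isReducible {p w z : List ℕ} (hp : IsWord p) (hz : IsWord z)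
    (h : IsReducible w) :
    wordMonomial (p ++ w ++ z) ∈ hitSubmodule 4 ⊔
      Submodule.span (ZMod 2) {g | ∃ t, IsWord t ∧ g = wordMonomial t ∧
        (Lower ((p ++ w).map letterSize) t ∨ t.length = (p ++ w ++ z).length ∧
          t.map letterSize = (p ++ w ++ z).map letterSize ∧ code t < code (p ++ w ++ z))} := by
  obtain ⟨a, ha, d, hd, h⟩ := Submodule.mem_sup.1 h
  obtain ⟨b, hb, c, hc, rfl⟩ := Submodule.mem_sup.1 hd
  set m := wordMonomial z
  rw [List.append_assoc, wordMonomial_append, wordMonomial_append_eq_mul, ← h,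
    show (a + (b + c)) * m ^ 2 ^ w.length = (a * m ^ 2 ^ w.length + b * m ^ 2 ^ w.length) +
      c * m ^ 2 ^ w.length by ring, map_add]
  refine add_mem ?_ ?_
  · have hb' := mul_mem_low hb m
    rw [List.length_map] at hb'
    have := prepend_mem hp (add_mem (Submodule.mem_sup_left (mul_mem_short ha m))
      (Submodule.mem_sup_right hb'))
    refine sup_le_sup (short_le_hitSubmodule _) (Submodule.span_mono ?_) this
    rintro _ ⟨t, ht, h, rfl⟩
    exact ⟨t, ht, rfl, Or.inl (by rwa [List.map_append])⟩
  · refine Submodule.mem_sup_right ?_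
    rw [← List.append_assoc]
    clear h hd
    induction hc using Submodule.span_induction with
    | zero => rw [zero_mul, map_zero]; exact zero_mem _
    | add f f' _ _ hf hf' => rw [add_mul, map_add]; exact add_mem hf hf'
    | smul c f _ hf => rw [smul_mul_assoc, map_smul]; exact Submodule.smul_mem _ _ hf
    | mem f hf =>
      obtain ⟨t, hl, ht, hs, ho, rfl⟩ := hf
      refine Submodule.subset_span ⟨p ++ (t ++ z), hp.append (ht.append hz), ?_,
        Or.inr ⟨?_, ?_, ?_⟩⟩
      · rw [wordMonomial_append, wordMonomial_append_eq_mul, hl]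
      · simp [hl]
      · simp [hs]
      · have : 0 < 16 ^ z.length := by positivity
        rw [List.append_assoc, code_append_eq, code_append_eq p, List.length_append,
          List.length_append, hl, code_append_eq, code_append_eq w]
        nlinarith

/-- No factor of the word is reducible. -/
def IsAdmissible (l : List ℕ) : Prop := ∀ p w z, l = p ++ w ++ z → ¬ IsReducible w

lemma wordMonomial_mem_sup {n L : ℕ} (hn : n < 2 ^ L) {l : List ℕ} (hl : IsWord l)
    (hL : l.length = L) (hd : wordDegree l = n) :
    wordMonomial l ∈ hitSubmodule 4 ⊔ Submodule.span (ZMod 2)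
      {g | ∃ t, t.length = L ∧ IsWord t ∧ wordDegree t = n ∧ IsAdmissible t ∧
        g = wordMonomial t} := by
  obtain ⟨a, ha⟩ : ∃ a, code (l.map letterSize) = a := ⟨_, rfl⟩
  induction a using Nat.strong_induction_on generalizing l with | _ a ih
  obtain ⟨b, hb⟩ : ∃ b, code l = b := ⟨_, rfl⟩
  induction b using Nat.strong_induction_on generalizing l with | _ b ih'
  by_cases h : IsAdmissible l
  · exact Submodule.mem_sup_right (Submodule.subset_span ⟨l, hL, hl, hd, h, rfl⟩)
  · simp only [IsAdmissible, not_forall, not_not] at h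
    obtain ⟨p, w, z, rfl, h⟩ := h
    have hp : IsWord p := fun A hA => hl A (by simp [hA])
    have hz : IsWord z := fun A hA => hl A (by simp [hA])
    obtain ⟨x, hx, y, hy, h⟩ := Submodule.mem_sup.1 (wordMonomial_mem_of_isReducible hp hz h)
    have hc : wordMonomial (p ++ w ++ z) = homogeneousComponent n x + homogeneousComponent n y := by
      rw [← map_add, h, homogeneousComponent_of_mem (hd ▸ isHomogeneous_wordMonomial _), if_pos rfl]
    rw [hc]
    refine add_mem (Submodule.mem_sup_left (homogeneousComponent_mem_hitSubmodule n hx)) ?_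
    clear hc h
    induction hy using Submodule.span_induction with
    | zero => rw [map_zero]; exact zero_mem _
    | add f f' _ _ hf hf' => rw [map_add]; exact add_mem hf hf'
    | smul c f _ hf => rw [map_smul]; exact Submodule.smul_mem _ _ hf
    | mem f hf =>
      obtain ⟨t, ht, rfl, h⟩ := hf
      rw [homogeneousComponent_of_mem (isHomogeneous_wordMonomial t)]
      split_ifs with e
      · obtain h | ⟨h₁, h₂, h₃⟩ := h
        · obtain ⟨e₁, e₂⟩ := resize_spec ht (e ▸ hn)
          rw [← e₁]
          refine ih _ ?_ (ht.resize L) (length_resize L t) (e₂.trans e.symm) rfl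
          rw [← ha]
          exact (h.resize (by rw [← hL]; simp)).code_map_letterSize_lt (List.map_append)
            ((length_resize L t).trans hL.symm)
        · exact ih' _ (hb ▸ h₃) ht (h₁.trans hL) e.symm (by rw [h₂, ha]) rfl
      · exact zero_mem _

end Reduction

section Tables

/-- Reducible words with two letters and their certificates. -/
def certificatesTwo : List (ℕ × List ℕ) := [
  (1, [256]), (2, [512]), (3, [528]), (4, [1024]), (5, [1280]), (6, [1056]), (7, [592]), (8,
    [2048]), (9, [384]), (10, [2080]), (11, [2096]), (12, [3072]), (13, [2128]), (14, [1184]), (15,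
    [1200]), (19, [784]), (21, [1296]), (22, [1552, 1792]), (23, [848]), (25, [2320]), (26, [2576,
    2816]), (27, [912]), (28, [3088, 3328]), (29, [2384]), (31, [2416]), (33, [768]), (35, [800]),
    (37, [832]), (38, [1568]), (39, [1584]), (41, [896]), (42, [2592]), (43, [2608]), (44, [3104,
    3584]), (45, [960]), (46, [1696]), (47, [2672]), (55, [1840]), (59, [2864]), (63, [1968]), (65,
    [1280]), (66, [1536]), (67, [1552]), (69, [1344]), (70, [1600]), (71, [1376]), (73, [1408]),
    (74, [1664]), (75, [1440]), (76, [3136]), (77, [3152]), (78, [3168]), (79, [3184]), (83,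
    [1808]), (87, [1872]), (91, [1936]), (93, [3408]), (95, [3440]), (97, [1792]), (99, [1824]),
    (101, [1856]), (103, [1888]), (105, [1920]), (107, [1952]), (109, [1984]), (110, [3680]), (111,
    [2016]), (127, [3952]), (129, [2304]), (130, [2560]), (131, [2336]), (132, [3072]), (133,
    [2368]), (134, [3104]), (135, [2640]), (137, [2432]), (138, [2688]), (139, [2704]), (140,
    [3200]), (141, [2496]), (142, [3232]), (143, [2528]), (147, [2832]), (149, [3344]), (150, [3600,
    3840]), (151, [3376]), (155, [2960]), (157, [3472]), (159, [3024]), (161, [2816]), (163,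
    [2848]), (165, [2880]), (166, [3616]), (167, [2912]), (169, [2944]), (171, [2976]), (173,
    [3008]), (174, [3744]), (175, [3760]), (183, [3888]), (191, [4016]), (193, [3328]), (194,
    [3584]), (195, [3600]), (197, [3392]), (198, [3648]), (199, [3664]), (201, [3456]), (202,
    [3712]), (203, [3488]), (205, [3520]), (206, [3776]), (207, [3552]), (211, [3856]), (215,
    [3920]), (219, [3984]), (223, [4048]), (225, [3840]), (227, [3872]), (229, [3904]), (231,
    [3936]), (233, [3968]), (235, [4000]), (237, [4032]), (239, [4064])]

/-- Reducible words with three letters and their certificates. -/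
def certificatesThree : List (ℕ × List ℕ) := [
  (286, [20656, 5536, 17296]), (290, [12320, 13056, 8960]), (324, [20544, 21760, 17664]), (392,
    [36992, 39168, 35072]), (482, [42272, 45632, 46592]), (484, [49984, 54304, 54784]), (486,
    [42336, 45572, 46176]), (488, [27008, 30848, 28800]), (490, [27040, 29192, 30880]), (492,
    [42432, 46272, 47108]), (494, [15584, 42704, 12224]), (580, [24640, 26112, 17920]), (648,
    [41088, 43520, 35328]), (798, [29448, 13968, 14208]), (829, [45424, 15184, 38704]), (830,
    [45680, 15200, 42800]), (853, [29008, 30480, 22288]), (862, [31492, 15952, 16192]), (870,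
    [29280, 30496, 26400]), (921, [45456, 47888, 39696]), (926, [31496, 16016, 16256]), (938,
    [45728, 47904, 43808]), (977, [54032, 61712, 61456]), (978, [54048, 61968, 62208]), (980,
    [54080, 62480, 62720]), (981, [54096, 61776, 62465]), (984, [54144, 63504, 63744]), (985,
    [54160, 61840, 63489]), (989, [46544, 55664, 40784]), (994, [58144, 61984, 61472]), (996,
    [58176, 62496, 62976]), (998, [58208, 62048, 62466]), (1000, [58240, 63520, 64000]), (1002,
    [58272, 62112, 63490]), (1006, [46816, 60016, 44896]), (1160, [49280, 52224, 35840]), (1310,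
    [28880, 21440, 26000]), (1374, [29904, 22464, 27984]), (1378, [29248, 29728, 30464, 26368]),
    (1382, [29792, 30528, 26432]), (1386, [29376, 29856, 30592, 26496]), (1433, [53648, 56592,
    40208]), (1434, [53952, 57792, 45504, 53664, 56608, 61632, 51072, 52032, 40464, 52992, 40704]),
    (1438, [30928, 23488, 28048]), (1450, [46240, 57760, 45504, 47936, 53664, 61600, 42880, 44320,
    40464, 44800, 40704]), (1484, [54464, 56640, 52544]), (1506, [58656, 62016, 62976]), (1508,
    [58688, 62528, 61504]), (1510, [58720, 61956, 62560]), (1512, [58752, 63552, 64512]), (1514,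
    [31424, 31904, 59024, 28544]), (1516, [58816, 62656, 63492]), (1518, [55008, 60528, 53088]),
    (1706, [58016, 60960, 44576]), (1740, [58560, 60992, 52800]), (1853, [63233, 32048, 32528]),
    (1854, [63234, 32304, 32544]), (1979, [62384, 65328, 48944]), (2013, [62928, 65360, 57168]),
    (2030, [63200, 65376, 61280]), (2334, [45264, 37824, 42384]), (2462, [47312, 39872, 44432]),
    (2466, [45696, 47136, 47872, 43776]), (2474, [47264, 48000, 43904]), (2500, [54400, 55360,
    56576, 52480]), (2508, [55488, 56704, 52608]), (2530, [59680, 62080, 64000]), (2532, [59712,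
    62592, 64512]), (2534, [48224, 58304, 59984, 44864]), (2536, [59776, 63616, 61568]), (2538,
    [59808, 61960, 63648]), (2540, [59840, 62472, 63680]), (2542, [48352, 60112, 44992]), (2756,
    [58496, 59456, 60928, 52736]), (2764, [59584, 61056, 52864]), (2877, [61872, 46992, 56112]),
    (2878, [62128, 47008, 60208]), (3029, [62864, 63824, 65296, 57104]), (3037, [63952, 65424,
    57232]), (3046, [63136, 64096, 65312, 61216]), (3054, [64224, 65440, 61344]), (3554, [63104,
    64064, 64544, 65280, 61184]), (3558, [63168, 64608, 65344, 61248]), (3562, [64192, 64672, 65408,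
    61312]), (3566, [64736, 65472, 61376])]

/-- Reducible words with four letters and their certificates. -/
def certificatesFour : List (ℕ × List ℕ) := [
  (13260, [464288, 727392, 487840, 766304, 227520, 242880, 253216, 356768, 635232, 258240, 249120,
    249360, 249600]), (13380, [459840, 483392, 479296, 471104, 352320, 413760, 415232, 353536,
    222464, 422912, 357376, 226304]), (13602, [468736, 475424, 464640, 488192, 225344, 226816,
    225312, 422656, 226560, 357120, 226048, 218624, 222464, 353024, 221952]), (13636, [463936,
    487488, 463168, 488704, 356416, 357632, 419072, 353536]), (13668, [464448, 467776, 476448,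
    463680, 489216, 356928, 225856, 423680, 358144, 354048]), (13676, [464576, 488128, 488608,
    463808, 489344, 357056, 357536, 358272, 419712, 354176]), (13724, [466112, 489664, 465344,
    490880, 251072, 358592, 253248, 359808, 421248, 249152, 355712]), (13764, [465984, 488576,
    489536, 465216, 490752, 357504, 358464, 359680, 421120, 355584]), (13892, [468032, 467520,
    487488, 488960, 421952, 423424, 415232, 349696]), (13996, [470208, 469696, 489664, 491136,
    255168, 257600, 424128, 425600, 249408, 417408, 351872]), (14020, [470080, 469568, 488576,
    489536, 491008, 423040, 424000, 425472, 417280, 351744]), (14472, [723072, 721536, 757888,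
    733312, 630912, 633344, 692352, 667776, 236032, 633088, 625152, 636928, 243712]), (14626,
    [725632, 765984, 727808, 766720, 241792, 634912, 241696, 243968, 635648, 242432, 604672, 697088,
    239872, 631552, 238336]), (14660, [863488, 882944, 898304, 909328, 249984, 252928, 249920,
    448768, 709888, 252160, 1005824, 1021184, 251136, 1032208, 236544, 248064, 247040, 416000,
    693504, 1036288]), (14728, [727168, 766080, 725376, 768256, 635008, 637184, 698624, 633088]),
    (14756, [727616, 732928, 754976, 728832, 767744, 250496, 635456, 256768, 702208, 252672, 636672,
    228096, 248576, 632576]), (14760, [727680, 729984, 756000, 725888, 768768, 635520, 242304,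
    703232, 637696, 633600]), (14764, [727744, 730048, 756064, 725952, 768832, 635584, 242368,
    703296, 637760, 633664]), (14792, [728192, 767104, 768064, 726400, 769280, 636032, 636992,
    638208, 699648, 634112]), (14916, [730240, 468096, 732672, 470528, 975616, 974864, 254080,
    254016, 256512, 255488, 422016, 700480, 424448, 701952, 248320, 247296, 670720, 416256, 693760,
    420096, 697600, 836352]), (14984, [731264, 729728, 766080, 768512, 700544, 702976, 694784,
    629248]), (15048, [732288, 730752, 767104, 768064, 769536, 701568, 702528, 704000, 695808,
    630272]), (15564, [494784, 871104, 489664, 906400, 936384, 976016, 387264, 448704, 832704,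
    848064, 351872, 421248, 837504]), (15714, [865824, 1000224, 1004064, 1003552]), (15716, [865856,
    1000256, 1004576, 1005056]), (15718, [474944, 259168, 259904, 255808]), (15720, [865920,
    1000320, 1005600, 1006080]), (15724, [865984, 1000384, 1000864, 1004224, 1004704]), (15778,
    [866848, 1016608, 1020448, 1019936]), (15780, [866880, 1016640, 1020960, 1021440]), (15784,
    [866944, 1016704, 1021984, 1022464]), (15786, [737152, 260256, 260992, 256896]), (15788,
    [867008, 1016768, 1018208, 1020608, 1022048]), (15812, [867392, 1001792, 1004672, 1006592]),
    (15816, [867456, 1017216, 1022016, 1022976]), (15820, [867520, 1000712, 1001920, 1004552,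
    1005760]), (15840, [867840, 994560, 1002240, 1017600, 1044480]), (15852, [499392, 876192,
    511632, 945552, 391872, 392352, 457872, 388992]), (16068, [932928, 1002048, 1008768, 1010688]),
    (16072, [932992, 1002112, 1009792, 1007744]), (16076, [933056, 991364, 1017536, 1025216,
    1026052]), (21794, [487456, 488192, 226048, 418560]), (22664, [854144, 853120, 888960, 872576,
    639104, 642048, 823424, 807040, 367616, 641280, 625664, 645120, 382976]), (22818, [487552,
    466176, 489728, 465664, 372768, 251136, 358656, 227584, 373504, 420096, 369408]), (22852,
    [857216, 905280, 859392, 906496, 381056, 643136, 380992, 383232, 644352, 382208, 613376, 836864,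
    379136, 640256, 378112]), (22920, [858240, 905344, 856448, 907520, 643200, 645376, 837888,
    641280]), (22984, [859264, 869760, 887104, 857472, 908544, 644224, 382080, 843008, 646400,
    642304]), (23074, [470528, 477216, 469024, 492064, 489984, 503840, 255488, 424448, 438304,
    227840, 243200, 258560]), (23076, [477248, 492608, 469056, 478720, 512064, 490496, 385088,
    386560, 446528, 424960, 386304, 378368, 390144]), (23080, [739456, 754816, 778368, 737920,
    922240, 774272, 726144, 769024, 856704, 647296, 983680, 708736, 703488, 715008, 649472, 718848,
    653312]), (23108, [477248, 492608, 871936, 870432, 512064, 906752, 905248, 385152, 388096,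
    446528, 841216, 839712, 359424, 382464, 371712, 379392, 824832, 390144, 628224]), (23176,
    [923776, 922752, 946304, 965632, 922240, 973312, 647296, 385152, 650240, 1007744, 1027072,
    983680, 1034752, 649728, 999552, 633856, 641536, 1017856]), (23240, [871040, 870016, 905856,
    908800, 907296, 387200, 386176, 840320, 843264, 841760, 826880, 630272]), (23688, [870528,
    869504, 905344, 908288, 839808, 842752, 826368, 629760]), (26760, [919680, 966784, 958592,
    942208, 704640, 827520, 830464, 437248, 707072, 845824, 714752, 452608]), (27204, [937472,
    950848, 929280, 976384, 450688, 453632, 450624, 845312, 453120, 714240, 452096, 437248, 444928,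
    706048, 443904]), (27272, [927872, 974976, 926336, 977408, 712832, 715264, 838144, 707072]),
    (27336, [928896, 935552, 952896, 927360, 978432, 713856, 451712, 847360, 716288, 708096]),
    (27784, [936064, 935040, 974976, 977920, 843904, 846848, 830464, 699392]), (31129, [989584,
    988560, 1028496, 1012112, 1030145, 1013761, 774544, 777488, 897424, 881040, 776976, 514832,
    761104, 784656, 522512]), (31402, [993952, 992928, 1012384, 1013762, 992160, 778912, 781856,
    963232, 946848, 750240, 507424, 965408, 765472, 522784, 961312]), (31573, [996752, 1044816,
    999184, 1046288, 520592, 782672, 520528, 523024, 784144, 522000, 752912, 907024, 514832, 775952,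
    513808]), (31590, [1011488, 1024864, 999200, 1046304, 520864, 523808, 520800, 980768, 523040,
    784160, 522016, 507424, 518944, 780064, 517920]), (31641, [997776, 1044880, 996240, 1047312,
    782736, 785168, 908048, 776976]), (31658, [998048, 1045152, 996256, 1047328, 783008, 785184,
    977696, 781088]), (31705, [998800, 1045904, 1046864, 997264, 1048336, 783760, 784720, 786192,
    909072, 778000]), (31722, [999072, 1046176, 1047136, 997280, 1048352, 784032, 784992, 786208,
    978720, 782112]), (31948, [1002688, 1001152, 1012928, 1013764, 1000896, 910528, 912960, 971968,
    947392, 881856, 515648, 974144, 904768, 523328, 970048]), (32102, [1005248, 1045600, 1007424,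
    1046336, 521408, 914528, 521312, 523584, 915264, 522048, 884288, 976704, 519488, 911168,
    517952]), (32153, [1005968, 1004944, 1044880, 1047824, 913808, 916752, 900368, 769296]), (32154,
    [1006272, 1045664, 1007488, 1020864, 1046400, 1005984, 1021344, 1004960, 1022304, 1044896,
    1047840, 522432, 520896, 914592, 521376, 523648, 915328, 522112, 913824, 916768, 884352, 977728,
    519552, 912192, 518016, 777744, 769552, 978688, 913152, 777984, 769792]), (32170, [998080,
    1045184, 997824, 1044928, 999296, 1046400, 996288, 1047360, 783040, 520896, 522400, 521376,
    782784, 523136, 784256, 522112, 785216, 978208, 519040, 518016, 781600, 908816, 777744, 978688,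
    782080, 909056, 777984]), (32204, [1006784, 1045696, 1004992, 1047872, 914624, 916800, 978240,
    912704]), (32236, [1007296, 1046208, 1047648, 1005504, 1048384, 915136, 916576, 917312, 978752,
    913216]), (32426, [1010336, 1009312, 1045152, 1048096, 979616, 982560, 966176, 769568]), (32460,
    [1010880, 1009344, 1045696, 1048128, 980160, 982592, 974400, 908864]), (37410, [721440, 721184,
    667680, 668416, 664320]), (39202, [765984, 766720, 242432, 697088]), (39236, [905280, 906496,
    382208, 836864]), (39492, [885312, 870432, 905248, 647232, 839712, 824832]), (42052, [918592,
    918080, 811072, 812544, 804352]), (42056, [918656, 942208, 811136, 437248, 452608]), (43588,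
    [974912, 976384, 452096, 837120]), (46028, [989600, 988576, 1028752, 1012368, 1030192, 1013808,
    767168, 776288, 774560, 777504, 897440, 881056, 780368, 507408, 781072, 761408, 765248, 771968,
    761120, 891680, 875296, 784912, 522768, 961296, 944912, 773888]), (46444, [1002176, 1017536,
    992960, 990400, 1012744, 1013952, 1029312, 1030148, 1012896, 1013856, 910016, 781888, 948416,
    963776, 946880, 775360, 515616, 909760, 519552, 781632, 777536, 773696, 913600, 523392, 785472,
    523296, 876064, 773440, 945680, 945920]), (46492, [989632, 1028544, 897472, 774560, 781584,
    783744, 784704, 760640, 761360, 785664, 761600]), (46764, [993984, 1029280, 1030240, 963264,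
    778656, 781600, 782496, 785440, 892448, 761376, 962064, 962304]), (47957, [1044816, 1046288,
    522000, 907024]), (47974, [1045088, 1046304, 522016, 976672]), (48332, [1019072, 1018560,
    1037320, 1038528, 1029128, 1030336, 911552, 913024, 972992, 964800, 777856, 912768, 904832,
    916608, 785536]), (48486, [999232, 783456, 523072, 784192, 780096]), (48492, [1021632, 1045184,
    1045664, 1007488, 1020864, 1046400, 914112, 914592, 523648, 915328, 522112, 884352, 976768,
    911232]), (48554, [1022656, 1046688, 1023872, 1047424, 784576, 915616, 784544, 785792, 916352,
    785280, 900736, 977792, 781696, 912256, 781184]), (48588, [1023168, 1046720, 1022400, 1047936,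
    915648, 916864, 978304, 912768]), (48612, [1007232, 1023552, 1009536, 1026880, 1035552, 1005440,
    1022784, 1048320, 915072, 916032, 784960, 982784, 917248, 913152]), (48620, [1023680, 1047232,
    1047712, 1022912, 1048448, 916160, 916640, 917376, 978816, 913280]), (48844, [1027264, 1026752,
    1046720, 1048192, 981184, 982656, 974464, 908928]), (53794, [983584, 983328, 929824, 930560,
    926464]), (54946, [993856, 1002016, 1012352, 1013792, 946816, 948256, 507392, 933376, 522752]),
    (54948, [994368, 1001088, 1002048, 1012864, 1013824, 947328, 948288, 519424, 523264]), (54956,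
    [994496, 1002176, 1012744, 1013952, 948416, 515712, 523392]), (56678, [1045600, 1046336, 522048,
    976704]), (56738, [1045120, 1046560, 1047296, 785152, 977664]), (56746, [1046688, 1047424,
    785280, 977792])]

/-- Reducible words with five letters and their certificates. -/
def certificatesFive : List (ℕ × List ℕ) := [
  (212104, [7447616, 7809152, 7809088, 7832192, 7832128, 7509120, 7885440, 7467136, 7467072,
    7843968, 7843904, 7426688, 7429632, 7803520, 7806464, 7889280, 3885184, 3900544, 3638400,
    3622976, 3638336, 5711936, 4017664, 5980800, 5734976, 3883648, 3902976, 6165120, 7017600,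
    3657856, 3657792, 5992576, 5746752, 3649664, 3914752, 6099584, 4002432, 4052480, 5706368,
    5709312, 4050976, 4080000, 4071808, 3883392, 3902720, 3793024, 3533824, 5496896, 3795456,
    6729856, 6729792, 3854464, 3592256, 5681216, 3986944, 3856896, 3985440, 6910080, 3764352,
    3783680, 3374080, 3397120, 3860736, 3856640, 3517440, 3501056, 3787264, 3955200, 3970560,
    3404800, 3496448, 3773952, 3852544, 6236160]), (218760, [7509120, 7532672, 7805056, 7843968,
    7831936, 3885184, 3900544, 3638400, 3924096, 3661952, 3875968, 6756480, 6795392, 3871872,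
    4042880, 3895424, 3914752, 4096384, 6783360, 3793024, 3530880, 3854464, 3856896, 6541440,
    6664320, 5615744, 3795200, 3864576, 3799040]), (246852, [7636032, 7881792, 7504960, 8258624,
    7423104, 8193088, 7800896, 8062016, 6161472, 7144512, 7168064, 6180928, 4083776, 7290944,
    5488704, 6242368, 4145216, 5621248, 3524096, 6735104, 5458944, 5628928, 3531776, 6738944]),
    (246856, [12076160, 11831360, 12452992, 11682944, 12387456, 11617408, 11994240, 12307456,
    10355840, 11338880, 11381760, 10394624, 4083840, 3984384, 11504640, 10456064, 4145280, 3517440,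
    9866240, 10849280, 3532800]), (474248, [15883776, 15897152, 15807616, 15855680, 16040224,
    16206592, 16221952, 8079488, 8094848, 8079424, 7817280, 8094784, 7832640, 8118400, 8070272,
    8080896, 7818752, 8094272, 7832128, 8114304, 7852096, 8237120, 14119040, 14135360, 8109056,
    12024832, 7830528, 12038208, 7843904, 7806464, 8245280, 8290624, 8266112, 15158016, 15173376,
    7807360, 7834368, 8264448, 8311552, 7987328, 7987264, 7725120, 7597056, 7988736, 7726592,
    8048768, 8048704, 7786560, 14053504, 14069824, 11959296, 7764992, 11972672, 7778368, 8051200,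
    14077984, 14931456, 11762688, 11776064, 7961088, 7698944, 7976448, 14012448, 15065856, 7989504,
    11920640, 7726336, 7595264, 8372992, 14017280, 7780608, 7980544, 7718400, 14040064, 8058880,
    14047744, 14063104, 7993344, 11877376, 11924480, 7730176, 11793408, 7599104, 13982208, 13997568,
    7952896, 7776512, 8368128]), (488396, [16717152, 15952464, 16136784, 16409424, 16729392,
    8333904, 12527184, 15672144, 7829696, 7845056, 7846720, 12285760, 7855392, 7852384, 14512480,
    12051024, 12481104, 15184464, 7853104, 14513200, 15628048, 7860416, 7849856, 7850816, 7822624,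
    14505760, 7851776]), (489882, [16118176, 16332192, 15987104, 16741008, 16742448, 8329632,
    8376736, 14643616, 8368544, 12546464, 8114592, 8237472, 12415392, 7858960, 12270400, 7839008,
    14506784, 7862800, 15624976, 12271360]), (489884, [15948224, 16717248, 15987136, 16740800,
    8329664, 12522944, 8368576, 12546496, 7845056, 12046784, 14512576, 8237504, 12415424, 7830912,
    7854912, 7857296, 7843136, 7863312, 7863552]), (490156, [15967936, 16721600, 15987392, 16741056,
    8334016, 12527296, 8368832, 12546752, 8118976, 15626944, 8303296, 12481216, 7831168, 7853216,
    7859008, 7863328, 7863808]), (493704, [15763584, 15746176, 15737984, 15737472, 15926400,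
    15734912, 15733888, 15733376, 12322944, 12372992, 14289024, 14025856, 14049408, 11952256,
    11928192, 14330368, 15272064, 15008896, 14877824, 14877312, 11864192, 11863168, 13830272,
    13829248, 11862656, 13828736, 11948160, 8035328, 15306880, 15028352, 14889088, 12107904,
    14196864, 13918336, 11821184, 11690112, 11649152, 11652096, 12009600, 8096768, 13738112,
    11624576, 13740544, 15241344, 14962816, 14823552, 12094464, 14191104, 11635712, 13732352]),
    (498056, [15833216, 15816832, 16193664, 15808640, 16220544, 15831424, 15815040, 16191872,
    15806848, 16222224, 12392576, 12439680, 14358656, 14096512, 11999360, 8237184, 14397568,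
    8290688, 12390784, 12441856, 14356864, 14094720, 11997568, 8116480, 14399744, 12177536, 8360064,
    14266496, 12179712, 8362240, 14268672, 12372224, 8169728, 14330112, 12175616, 11782400,
    14264576, 14002432, 15112448]), (498312, [15837312, 15820928, 16197760, 15843968, 16220800,
    15835776, 15808640, 15855744, 15815296, 15807104, 16195968, 16222976, 12396672, 12395648,
    14362752, 14100608, 12003456, 12419712, 12422656, 14123648, 12026496, 14361216, 8302720,
    12431488, 12415104, 14397568, 14135424, 12284032, 12442112, 14094976, 11997824, 14400000,
    12460416, 8304896, 12181632, 11919488, 12184576, 8364160, 15118464, 12365952, 12349568,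
    14332032, 14069888, 11972736, 12376576, 14334464, 7977984, 11779072, 14006784, 12183808,
    8366336, 15120640, 12168192, 14326272, 12187648, 7993344, 11794432, 14260736, 13998592,
    15116544]), (498376, [15838336, 15821440, 16291456, 16292416, 15881856, 16004736, 15809664,
    15857728, 15817344, 15859200, 15809088, 15809568, 16304416, 15836544, 16005504, 16052608,
    8096832, 14363776, 12405376, 12012160, 8096320, 8201856, 14101120, 15144576, 8116288, 12416128,
    14399552, 14137408, 12023936, 12301440, 14537344, 12443136, 8117760, 12049920, 14401024,
    14384640, 14490656, 12441632, 14606720, 12509568, 14558080, 14561024, 8202624, 8249728,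
    14100864, 14147968, 12002688, 12029696, 15145344, 15192448, 11921536, 8050752, 12350592,
    14333056, 14070912, 14334016, 14071872, 11973760, 11957376, 12374656, 12377600, 14078592,
    8052224, 14070400, 14073344, 15325216, 11908224, 13858944, 11760768, 14013056, 11787776,
    11910656, 11985280, 11988224, 14347008, 11922688, 11975936, 14930304, 14086272, 14065152,
    15310336, 11926528, 14261760, 13999616, 12164608, 11902464, 11877888, 13843968, 11971840,
    11991040]), (498824, [15845504, 15844480, 16205952, 16221312, 15820928, 15836288, 15816832,
    15815808, 15855744, 15807616, 16204160, 16223488, 12404864, 12403840, 14370944, 14108800,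
    14386304, 14124160, 12011648, 12027008, 14409856, 14361728, 8310912, 12439680, 12442624,
    14405760, 14357632, 12046464, 11998336, 14381184, 14400512, 14107008, 14126336, 8097024,
    8251648, 8372352, 14278784, 15126656, 12374144, 12377088, 14340224, 14078080, 11980928,
    14342656, 13884416, 11787264, 7985664, 8374528, 14280960, 15128832, 14080256, 12360704,
    14350336, 12164096, 13868032, 11770880, 14284800, 7993344, 15124736, 14076160]), (502408,
    [15902848, 15886464, 15901312, 15884928, 16459904, 16197760, 16458368, 16196224, 12462208,
    12509312, 12460672, 12511744, 15411328, 15149184, 15409792, 15147648, 12497024, 8302720,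
    12499456, 8305152, 12247168, 12249600, 12558464, 8364160, 8323712, 12560896, 8366592, 12372480,
    12241408, 12525696, 12175872, 12552704, 8358400]), (502920, [15911040, 15910016, 15886464,
    15885440, 16468096, 16483456, 15836288, 16507008, 16458880, 16204416, 16223744, 15897728,
    16052352, 12470400, 12469376, 12509312, 12512256, 15419520, 15157376, 15434880, 15172736,
    15458432, 15196288, 15410304, 15148160, 12011648, 12027008, 12290112, 12443776, 8249472,
    14147712, 12457088, 12480640, 12499968, 8313344, 15192192, 12378240, 12381184, 15327360,
    15065216, 12566656, 14278784, 11919488, 12184576, 11791360, 12569088, 8374784, 14019072,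
    7989760, 15126656, 15132928, 12364800, 12233728, 12533888, 12576768, 11774976, 14010880,
    15136768, 12229632]), (505188, [15963712, 16717376, 16094752, 16340512, 16717344, 16720704,
    16729376, 15962944, 16716608, 16742144, 16094496, 16340256, 16717088, 8328832, 12523072,
    8328768, 14620192, 8332096, 8340768, 8331008, 12522304, 8328000, 8353536, 14619936, 8114752,
    14512704, 8237632, 12415552, 8221248, 8090176, 8115232, 8238112, 12416032, 12284960, 15628032,
    8288000, 7847168, 8115968, 14513920, 8238848, 12416768, 8222464, 12285696, 8084992, 8207872,
    8111872, 14509824, 8234752, 12412672, 8218368, 12281600]), (505992, [15960192, 16713856,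
    15935616, 16752768, 15931520, 16748672, 15970432, 16724096, 12519552, 12558464, 12554368,
    12529792, 14524544, 12427392, 15634560, 15636992, 12488832, 12491264, 7838208, 14526720,
    12429568, 8104192, 15644672, 12498944, 14530560, 12433408, 8108032, 7845888]), (506276,
    [15989504, 16341280, 16079136, 16765216, 16149008, 16426512, 16769552, 8329856, 8328832,
    8332160, 8335104, 8358176, 8341792, 8328064, 8331008, 8370944, 12548864, 14668064, 15720976,
    8237696, 8221312, 8093184, 8116256, 7858944, 8305408, 8289024, 7847168, 8092928, 8239872,
    8223488, 7846656, 12302080, 14405920, 12509712, 8101376, 8235776, 8219392]), (506280, [15964800,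
    16718464, 15940224, 16720768, 16746784, 15963008, 16716672, 15938432, 16759552, 12524160,
    12526464, 12552480, 12522368, 12565248, 14529152, 12432000, 12038784, 15645440, 12499712,
    14531328, 12434176, 14527232, 12430080]), (506284, [15964864, 15940288, 16757440, 16730528,
    16745888, 15963552, 16717216, 15938976, 16760096, 12563136, 12524704, 12522912, 12565792,
    15643328, 15643808, 15644768, 12309664, 12432544, 12433504, 14541216, 15651232, 14531872,
    12434720, 14542896, 15613568, 15638048, 12033664, 12426784, 15641888, 12494720, 12495680,
    12430624, 14535456, 12496640]), (506312, [15965312, 16718976, 15940736, 16757888, 16758848,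
    15963520, 16717184, 15938944, 16760064, 12524672, 12563584, 12564544, 12522880, 12565760,
    14529664, 14530624, 12432512, 12433472, 14531840, 12434688, 15641856, 12496128, 14527744,
    12430592]), (506568, [15969408, 16723072, 15967872, 16721536, 15940736, 16757888, 16758848,
    15939200, 16760320, 12528768, 12527232, 12563584, 12564544, 12566016, 15643776, 15644736,
    15646208, 12498048, 12499008, 12500480, 15638016, 12492288, 14523904, 12426752]), (507076,
    [16108576, 16731168, 16079904, 16765984, 16174096, 16149520, 16731152, 16770064, 8342656,
    8358976, 14634016, 8329792, 14668832, 8333632, 8343296, 15682576, 15721488, 8250496, 8251456,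
    15651872, 8311936, 8312896, 14603296, 8224256, 7859456, 8289536, 15590416, 14541840, 8244736,
    8310016]), (507080, [15977600, 15953024, 16107136, 16729728, 16447552, 16554560, 15948928,
    16381056, 16118912, 15987840, 16741504, 16758848, 16371456, 12536960, 8358976, 12575872,
    14632576, 8341120, 8358464, 15710272, 12571776, 8378432, 14644352, 14661696, 12547200, 8352896,
    12564544, 8370240, 12444800, 8251456, 8252928, 15627392, 12506240, 8312896, 14578816, 14596160,
    8287360, 8304704, 12508672, 14382208, 14399552, 12443136, 8117760, 8252672, 8244736, 12516352,
    8256512, 14416896, 8125440]), (507272, [15980672, 16087168, 16364672, 15956096, 16773248,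
    15978880, 16085376, 16366848, 15954304, 16775424, 12540032, 8345728, 14676096, 12578944,
    12538240, 8343936, 14678272, 12581120, 12447872, 12450048, 15657216, 14608640, 12511488,
    12445952]), (507308, [16365248, 15956672, 16773824, 15957152, 16774304, 15982464, 16088960,
    16364480, 15957888, 16775040, 14676672, 12579520, 14677152, 12580000, 12541824, 8347520,
    14677888, 8339328, 12580736, 8124608, 12448448, 12448928, 8125824, 7863680, 12449664, 7863168,
    7862144, 12418688, 14122624, 15656832, 14608256, 12511104, 8121728, 12445568]), (507368,
    [15982208, 16735872, 16752192, 15957632, 16738176, 16755520, 16764192, 15980416, 16734080,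
    16751424, 15955840, 16776960, 12541568, 12557888, 12543872, 12561216, 12569888, 12539776,
    12557120, 12582656, 14546560, 14547520, 12449408, 12450368, 12056192, 15662848, 12517120,
    14548736, 12451584, 14544640, 12447488]), (507528, [15984768, 15983232, 16152704, 16430208,
    16151168, 16432640, 15956096, 16773248, 15954560, 16775680, 12544128, 8349824, 12542592,
    8348288, 15724672, 15727104, 12578944, 12581376, 12513408, 12515840, 12507648, 15587840,
    14539264, 12442112]), (511112, [16042112, 16041088, 16017536, 16016512, 16205952, 16204928,
    16013440, 16012416, 14567552, 14566528, 14606464, 14609408, 15550592, 15549568, 15157376,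
    15156352, 14108800, 14107776, 8249472, 8313856, 15585408, 15588352, 14475392, 14478336, 8372352,
    8375296, 15519872, 15522816, 14461952, 14330880, 8358912, 15506432, 15309824, 8341504]),
    (514184, [16091264, 16074880, 16713856, 16760960, 16062592, 16061568, 16748672, 16732288,
    14616704, 14663808, 14651520, 14635136, 8244224, 14401664, 12304512, 15634560, 15637504,
    14585984, 14588928, 7838720, 14403840, 14141696, 12306688, 15652864, 14604288, 14407680,
    14145536, 12310528, 7854080]), (514504, [16096384, 16718976, 16106880, 16729472, 16746816,
    16094592, 16078208, 16717184, 16768256, 14621824, 14632320, 14649664, 14620032, 14671104,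
    8246400, 14406784, 12309632, 15654144, 14605568, 14408960, 12311808, 14404864, 12307712]),
    (514760, [16100480, 16107136, 16730752, 16729728, 16079488, 16078464, 16765568, 16768512,
    16767008, 14633600, 14632576, 14668416, 14671360, 14669856, 8250496, 14149760, 15651456,
    15654400, 15652896, 14602880, 14605824, 14604320, 15638016, 14589440, 14392832, 12295680]),
    (515720, [16115840, 16114816, 16152704, 16151680, 16568960, 16571904, 16087168, 16086144,
    16773248, 16776192, 14641280, 14640256, 8349824, 8348800, 15724672, 15727616, 14676096,
    14679040, 14610560, 14613504, 14597120, 15449088, 14400512, 12303360]), (518280, [16156800,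
    16155776, 16132224, 16441472, 16179328, 16393344, 16713856, 16712832, 16752768, 16736384,
    15665280, 15664256, 15704192, 15687808, 8301568, 12503552, 15450240, 15453184, 15573120,
    15556736, 12304512, 12307456, 14524544, 14508160, 7842816, 12306944, 12511232, 8316928,
    15436800, 12291072, 12314624, 7858176]), (518856, [16166016, 16172672, 16164480, 16148096,
    16723072, 16729728, 16747072, 16721536, 16772608, 15674496, 15681152, 15698496, 15672960,
    15724032, 8316032, 15459456, 15592960, 15461888, 12313728, 14544384, 12316160, 15453696,
    12307968]), (736392, [15820864, 15835776, 15898752, 16267392, 16028224, 15883776, 15808640,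
    15855680, 16454208, 15807104, 16467712, 12273792, 12272768, 12026944, 14100544, 12312704,
    12050496, 12422656, 12272256, 8080896, 14361216, 12458112, 12457088, 12456576, 15407232,
    15405632, 15537184, 11999360, 12046400, 8237120, 14397568, 14381120, 7843904, 11997824,
    12416512, 14400000, 12471552, 14557504, 12511488, 12510464, 15419136, 12509200, 12181632,
    12184576, 11919424, 7597056, 7988736, 11983872, 11980864, 12349568, 14332032, 14069824,
    12218496, 11972672, 12376576, 12245504, 14334464, 14931456, 15300096, 7568384, 12539392,
    14251520, 12379392, 12378128, 12168192, 11967488, 11951104, 12253184, 11990016, 14326272,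
    15046144, 7599104, 14260736, 14243328, 12347648, 12363008, 11954432, 12231936, 12527616]),
    (738372, [15746112, 15737920, 15733824, 16122176, 14025792, 14049344, 15008832, 14877760,
    15028288, 15020096, 14025024, 8152320, 13918272, 14962752, 14831680, 13783104, 15142976,
    8275200]), (743048, [15837312, 15835776, 15808640, 15807104, 12027008, 12272768, 12443776,
    14362752, 12312704, 12026496, 12395136, 14361216, 12458112, 14397568, 12303360, 12442112,
    14400000, 12181632, 12518016, 14332032, 12218496, 12376576, 12245504, 14334464, 12380416,
    12384256, 12253184, 14326272, 14260736, 12552192, 12535808]), (744516, [15844416, 16205888,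
    16221248, 15843648, 15896896, 16650560, 16663568, 14108736, 14124096, 8249408, 12260416,
    12390976, 14565696, 14123328, 14369088, 12026176, 12271936, 15561984, 8372288, 15126592,
    14078016, 12152896, 15684864, 15123712, 14443776, 14619648]), (744520, [15844480, 16205952,
    16221312, 15832192, 15815808, 16240768, 16192640, 14108800, 14124160, 8310912, 14143616,
    14095488, 8220800, 8240128, 8372352, 15126656, 14078080, 8051712, 8374528, 8378368]), (748612,
    [15909952, 15909440, 16205888, 16221248, 16207360, 16220736, 15157312, 15172672, 15158784,
    15172160, 8310848, 8312320, 15065152, 15066624, 8372288, 14016576, 8373760, 14018048, 7726592,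
    15058432, 14009856]), (748616, [15910016, 15901824, 15885440, 16205952, 16221312, 16244864,
    16196736, 15157376, 15172736, 15196288, 15148160, 8310912, 8313344, 15065216, 8372352, 14016640,
    8347776, 8367104, 7989760, 8382464]), (767332, [16717376, 16720704, 16729376, 16716608,
    16742144, 8353536, 14512704, 12284480, 15628032, 14513920, 14509824]), (769220, [16370240,
    16730752, 16746112, 16747072, 16718976, 16382016, 16742528, 16757888, 16758848, 12553280,
    14649920, 12572736, 14661696, 8353920, 12445760, 14541440, 15628416, 15643776, 15644736,
    12507200, 14596160, 14541184, 12315904, 14545024, 12319744]), (775236, [16090176, 16335936,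
    16712768, 16109632, 16323648, 16732224, 14615616, 14635072, 15618112, 14569536, 7822336,
    8242432, 8246272, 7853056]), (779332, [16155712, 16401472, 16179264, 16393280, 16712768,
    16736320, 15664192, 15687744, 8308224, 15556672, 14508096, 7826432, 8315904, 7857152])]

/-- The transitions of an automaton that accepts all words without reducible factors. The entry
`16 * q + A` in the list of a state stands for a transition to the state `q` with the letter `A`. -/
def transitions : List (List ℕ) := [
  [16, 33, 50, 67, 84, 101, 118, 135, 152, 169, 186, 203, 220, 237, 254, 15], [16], [16, 257, 274,
    292, 24, 30], [16, 50, 292, 24], [16, 257, 50, 307, 276, 325, 342, 296, 361, 378, 396, 413,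
    430], [16, 84, 24], [16, 257, 50, 84, 437, 454, 296, 473, 490, 92, 30], [16, 50, 84, 118, 296,
    378, 92], [16, 33, 50, 499, 84, 101, 118, 519, 536, 553, 570, 587, 604, 621, 638], [16, 152],
    [16, 257, 642, 84, 152, 665, 682, 156, 30], [16, 50, 692, 152, 714, 156], [16, 33, 50, 307, 724,
    741, 758, 152, 169, 186, 779, 796, 813, 830], [16, 84, 152, 220], [16, 33, 642, 84, 101, 838,
    152, 169, 186, 220, 861, 222], [16, 50, 84, 118, 152, 186, 220, 254], [16, 257, 274, 292, 24],
    [16, 292, 24], [16, 24], [16, 257, 50, 307, 276, 325, 342, 296, 361, 378, 876], [16, 257, 274,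
    292, 294, 296, 265, 490, 300], [16, 50, 292, 296, 58, 300], [16, 257, 274, 292, 24, 26, 28],
    [16, 50, 292, 24, 28], [16, 692, 152, 892], [16, 902, 26, 28, 926], [16, 28], [16, 257, 274, 84,
    437, 454, 296, 473, 490, 92], [16, 84, 296, 92], [16, 257, 274, 292, 24, 28], [16, 18, 292, 24,
    28], [16, 257, 50, 307, 276, 325, 342, 296, 361, 378, 940], [16, 33, 50, 307, 84, 101, 118, 519,
    536, 953, 970, 587, 604, 621, 638], [16, 296], [16, 257, 642, 84, 152, 985, 1002, 300, 30], [16,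
    50, 692, 152, 1018, 300], [16, 33, 50, 307, 724, 1029, 1046, 296, 1065, 1082, 1100, 1117, 1134],
    [16, 84, 152, 92], [16, 33, 642, 84, 101, 1142, 296, 1161, 1082, 892, 94], [16, 50, 84, 118,
    296, 1082, 892], [16, 274, 292, 24], [16, 257, 274, 292, 152, 665, 682, 156], [16, 292, 152,
    156], [16, 20, 24], [16, 50, 292, 152, 714, 156], [16, 276, 24], [16, 257, 50, 84, 437, 86, 296,
    265, 490, 700, 30], [16, 50, 84, 118, 296, 58, 700], [16, 33, 50, 307, 724, 1029, 1046, 152,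
    169, 186, 779, 1180, 813, 830], [16, 84, 152, 892], [16, 33, 642, 276, 1190, 152, 169, 1210,
    892, 158], [16, 50, 276, 152, 186, 892], [16, 50, 84, 118, 296, 298, 92], [16, 33, 642, 84, 101,
    1142, 152, 169, 1226, 220, 861, 222], [16, 692, 24], [16, 84, 152], [16, 298], [84, 152], [16,
    692, 24, 892], [16, 257, 642, 84, 152, 265, 1002, 300, 30], [16, 50, 692, 152, 58, 300], [16,
    257, 274, 292, 24, 682, 156], [16, 292, 24, 28], [16, 50, 292, 24, 156], [16, 257, 50, 84, 294,
    296, 265, 490, 700, 30], [16, 50, 84, 296, 58, 700], [16, 257, 642, 84, 152, 26, 28, 30], [16,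
    50, 692, 152, 28], [16, 84, 152, 28], [16, 33, 642, 276, 1190, 24, 1242, 892, 30], [16, 50, 276,
    24, 892], [16, 50, 84, 296, 298, 92], [16, 257, 642, 84, 152, 28, 30], [16, 84, 152, 156], [16,
    50, 84, 296, 298], [16, 50, 692, 152, 156], [16, 692, 152, 156], [16, 50, 692, 152]]

/-- The states of the automaton. The list of a length contains the pairs of the code of a word of
that length and the state that is reached when the word read so far ends in it. -/
def suffixes : List (ℕ × List (ℕ × ℕ)) := [
  (0, [(0, 0)]), (1, [(0, 1), (1, 2), (2, 3), (3, 4), (4, 5), (5, 6), (6, 7), (7, 8), (8, 9), (9,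
    10), (10, 11), (11, 12), (12, 13), (13, 14), (14, 15)]), (2, [(17, 16), (18, 17), (20, 18), (24,
    1), (30, 1), (36, 18), (40, 1), (49, 16), (51, 19), (52, 17), (53, 20), (54, 21), (56, 18), (57,
    22), (58, 23), (60, 24), (61, 25), (62, 26), (72, 1), (81, 16), (85, 27), (86, 28), (88, 18),
    (89, 29), (90, 30), (92, 5), (94, 1), (104, 18), (106, 23), (108, 5), (115, 31), (119, 32),
    (120, 33), (121, 34), (122, 35), (123, 36), (124, 37), (125, 38), (126, 39), (145, 16), (146,
    40), (153, 41), (154, 42), (156, 9), (158, 1), (164, 43), (170, 44), (172, 9), (179, 19), (180,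
    45), (181, 46), (182, 47), (187, 48), (188, 49), (189, 50), (190, 51), (210, 40), (214, 52),
    (221, 53), (222, 13)]), (3, [(828, 54), (836, 18), (850, 17), (852, 18), (854, 18), (857, 16),
    (860, 18), (868, 18), (874, 3), (876, 18), (904, 1), (914, 17), (916, 18), (920, 1), (922, 1),
    (924, 1), (932, 18), (936, 1), (940, 1), (964, 43), (972, 55), (982, 56), (986, 1), (988, 1),
    (990, 57), (1004, 1), (1362, 17), (1416, 1), (1426, 17), (1428, 18), (1432, 1), (1436, 1),
    (1442, 1), (1444, 18), (1448, 1), (1452, 1), (1480, 1), (1672, 1), (1700, 18), (1704, 1), (1708,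
    1), (1736, 1), (1852, 58), (1907, 19), (1913, 59), (1914, 60), (1928, 18), (1945, 61), (1946,
    62), (1948, 18), (1962, 63), (1964, 18), (1973, 64), (1974, 65), (1976, 18), (1977, 66), (1978,
    67), (1980, 68), (1981, 69), (1982, 70), (1996, 5), (2006, 71), (2008, 18), (2009, 72), (2010,
    67), (2012, 55), (2014, 5), (2024, 18), (2026, 67), (2028, 55), (2338, 17), (2450, 17), (2452,
    18), (2468, 18), (2628, 1), (2724, 18), (2876, 54), (2884, 17), (2902, 5), (2905, 16), (2908,
    43), (2922, 3), (2924, 43), (2997, 64), (2998, 65), (3004, 73), (3020, 55), (3028, 17), (3030,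
    74), (3034, 75), (3036, 55), (3038, 9), (3044, 17), (3052, 55), (3362, 17), (3434, 18), (3542,
    71), (3546, 76)]), (4, [(13256, 1), (13672, 1), (15428, 1), (29640, 1), (30524, 54), (30617,
    16), (30634, 3), (30856, 1), (31128, 1), (31144, 1), (31148, 1), (31176, 1), (31400, 1), (31432,
    1), (31574, 18), (31624, 1), (31642, 1), (31644, 1), (31660, 1), (31692, 1), (31704, 1), (31706,
    77), (31710, 1), (31720, 1), (31944, 1), (32136, 1), (32156, 1), (32172, 1), (32232, 1), (32392,
    1), (32428, 1), (46024, 1), (46148, 18), (46440, 1), (46532, 1), (46788, 1), (47958, 18),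
    (48076, 9), (48452, 18), (48708, 18)])]

/-- The lengths and tables of reducible words. -/
def reducibleTables : List (ℕ × List (ℕ × List ℕ)) :=
  [(2, certificatesTwo), (3, certificatesThree), (4, certificatesFour), (5, certificatesFive)]

end Tables

section Automaton

/-- The list of transitions of a state. -/
def successors (q : ℕ) : List ℕ := transitions.getD q []

/-- Some suffix of the word with `n` letters and code `m` is listed as reducible. -/
def isDead (n m : ℕ) : Bool :=
  reducibleTables.any fun p => Nat.ble p.1 n && p.2.any fun x => Nat.beq x.1 (m % 16 ^ p.1)

/-- Some suffix of the word with `n` letters and code `m` belongs to the state `q`. -/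
def isLive (n m q : ℕ) : Bool :=
  suffixes.any fun p => Nat.ble p.1 n &&
    p.2.any fun x => Nat.beq x.2 q && Nat.beq x.1 (m % 16 ^ p.1)

/-- Each state has a transition for each letter that does not create a reducible suffix. -/
def checkSuffixes : Bool :=
  suffixes.all fun p => p.2.all fun x => (List.range 16).all fun A =>
    ((successors x.2).any fun t =>
      Nat.beq (t % 16) A && isLive (p.1 + 1) (16 * x.1 + A) (t / 16)) ||
    isDead (p.1 + 1) (16 * x.1 + A)

/-- The automaton accepts the word when started in the given state. -/
def Accepts : ℕ → List ℕ → Prop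
  | _, [] => True
  | q, A :: l => ∃ t ∈ successors q, t % 16 = A ∧ Accepts (t / 16) l

lemma word_mod (s m : ℕ) : word s (m % 16 ^ s) = word s m := by
  induction s generalizing m with
  | zero => rfl
  | succ s ih =>
    rw [word_succ, word_succ, pow_succ', Nat.mod_mul_right_div_self, ih, Nat.mod_mul_right_mod]

lemma exists_append_word_eq {s n : ℕ} (h : s ≤ n) (m : ℕ) : ∃ p, word n m = p ++ word s m := by
  obtain ⟨k, rfl⟩ := Nat.exists_eq_add_of_le' h
  induction s generalizing m with
  | zero => exact ⟨word k m, by simp [word, digits]⟩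
  | succ s ih =>
    obtain ⟨p, hp⟩ := ih (m / 16) (Nat.le_add_left _ _)
    exact ⟨p, by rw [← add_assoc, word_succ, hp, word_succ, List.append_assoc]⟩

lemma exists_isReducible_of_isDead
    (hr : ∀ p ∈ reducibleTables, ∀ x ∈ p.2, IsReducible (word p.1 x.1)) {n m : ℕ}
    (h : isDead n m = true) : ∃ p w, word n m = p ++ w ∧ IsReducible w := by
  obtain ⟨p, hp, h⟩ := List.any_eq_true.1 h
  rw [Bool.and_eq_true] at h
  obtain ⟨x, hx, h'⟩ := List.any_eq_true.1 h.2
  obtain ⟨a, ha⟩ := exists_append_word_eq (Nat.le_of_ble_eq_true h.1) m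
  refine ⟨a, _, ha, ?_⟩
  rw [← word_mod, ← Nat.eq_of_beq_eq_true h']
  exact hr p hp x hx

lemma exists_suffix_of_isLive {n m q : ℕ} (h : isLive n m q = true) :
    ∃ p ∈ suffixes, ∃ x ∈ p.2, x.2 = q ∧ ∃ a, word n m = a ++ word p.1 x.1 := by
  obtain ⟨p, hp, h⟩ := List.any_eq_true.1 h
  rw [Bool.and_eq_true] at h
  obtain ⟨x, hx, h'⟩ := List.any_eq_true.1 h.2
  rw [Bool.and_eq_true] at h'
  obtain ⟨a, ha⟩ := exists_append_word_eq (Nat.le_of_ble_eq_true h.1) m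
  exact ⟨p, hp, x, hx, Nat.eq_of_beq_eq_true h'.1, a,
    by rw [Nat.eq_of_beq_eq_true h'.2, word_mod, ha]⟩

lemma accepts_of_isAdmissible (hc : checkSuffixes = true)
    (hr : ∀ p ∈ reducibleTables, ∀ x ∈ p.2, IsReducible (word p.1 x.1)) {r l : List ℕ}
    (hl : IsWord l) (h : IsAdmissible (r ++ l)) {p : ℕ × List (ℕ × ℕ)} (hp : p ∈ suffixes)
    {x : ℕ × ℕ} (hx : x ∈ p.2) {a : List ℕ} (ha : r = a ++ word p.1 x.1) : Accepts x.2 l := by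
  induction l generalizing r p x a with
  | nil => trivial
  | cons A l ih =>
    have hA : A < 16 := hl A (by simp)
    have hw := word_succ_mul_add (s := p.1) (v := x.1) hA
    have hc' := List.all_eq_true.1 (List.all_eq_true.1 (List.all_eq_true.1 hc p hp) x hx) A
      (List.mem_range.2 hA)
    rw [Bool.or_eq_true] at hc'
    obtain hc' | hc' := hc'
    · obtain ⟨t, ht, h'⟩ := List.any_eq_true.1 hc'
      rw [Bool.and_eq_true] at h'
      refine ⟨t, ht, Nat.eq_of_beq_eq_true h'.1, ?_⟩
      obtain ⟨p', hp', x', hx', e, b, hb⟩ := exists_suffix_of_isLive h'.2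
      rw [← e]
      refine ih (r := r ++ [A]) (a := a ++ b) (fun B hB => hl B (by simp [hB])) ?_ hp' hx' ?_
      · rwa [List.append_assoc]
      · rw [ha, List.append_assoc, ← hw, hb, List.append_assoc]
    · obtain ⟨b, w, hb, hw'⟩ := exists_isReducible_of_isDead hr hc'
      refine absurd hw' (h (a ++ b) w l ?_)
      rw [ha, List.append_assoc a b, ← hb, hw]
      simp

end Automaton

section Counting

/-- The accepted words with `L` letters, when the automaton is started in the state `k / 4`, such
that the degree of their monomial is `n - k % 4`. -/
def acceptedWords : (L k n : ℕ) → List (List ℕ)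
  | 0, k, n => if k % 4 = n then [[]] else []
  | L + 1, k, n => (successors (k / 4)).flatMap fun t =>
      if (letterSize (t % 16) + k % 4) % 2 = n % 2 then
        (acceptedWords L (4 * (t / 16) + (letterSize (t % 16) + k % 4) / 2) (n / 2)).map
          (t % 16 :: ·)
      else []

lemma mem_acceptedWords {l : List ℕ} {k n : ℕ} (h : Accepts (k / 4) l)
    (hn : wordDegree l + k % 4 = n) : l ∈ acceptedWords l.length k n := by
  induction l generalizing k n with
  | nil =>
    rw [wordDegree, zero_add] at hn
    simp [acceptedWords, hn]
  | cons A l ih =>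
    obtain ⟨t, ht, rfl, h⟩ := h
    rw [wordDegree] at hn
    have hs := letterSize_le (t % 16)
    rw [List.length_cons, acceptedWords, List.mem_flatMap]
    refine ⟨t, ht, ?_⟩
    rw [if_pos (by omega)]
    refine List.mem_map.2 ⟨l, ih ?_ ?_, rfl⟩
    · rwa [show (4 * (t / 16) + (letterSize (t % 16) + k % 4) / 2) / 4 = t / 16 by omega]
    · omega

/-- Adds `c` to the multiplicity of `k` in a multiset sorted by its elements. -/
def addEntry (k c : ℕ) : List (ℕ × ℕ) → List (ℕ × ℕ)
  | [] => [(k, c)]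
  | (j, b) :: v => bif Nat.beq j k then (k, b + c) :: v
      else bif Nat.blt k j then (k, c) :: (j, b) :: v else (j, b) :: addEntry k c v

/-- Adds the states reached from `k` by a letter fitting the binary digit `d`, with
multiplicity `c`. -/
def stepEntry (d k c : ℕ) (acc : List (ℕ × ℕ)) : List (ℕ × ℕ) :=
  (successors (k / 4)).foldr (fun t acc =>
    bif Nat.beq ((letterSize (t % 16) + k % 4) % 2) d then
      addEntry (4 * (t / 16) + (letterSize (t % 16) + k % 4) / 2) c acc else acc) acc

/-- The multiset of states reached from a multiset of states by letters fitting the binary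
digit `d`. -/
def step (d : ℕ) (v : List (ℕ × ℕ)) : List (ℕ × ℕ) :=
  v.foldr (fun x acc => stepEntry d x.1 x.2 acc) []

/-- The number of elements of a multiset of states that have no carry. -/
def finalCount (v : List (ℕ × ℕ)) : ℕ :=
  v.foldr (fun x s => bif Nat.beq (x.1 % 4) 0 then x.2 + s else s) 0

/-- A number that allows multisets of states to be compared quickly. -/
def hash (v : List (ℕ × ℕ)) : ℕ := v.foldr (fun x s => (s * 1024 + x.1) * 1024 + x.2) 0

/-- Searches the multisets of states reached from `todo`, except those already in `seen`, and checks
the number of words they contribute. -/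
def explore : ℕ → List (List (ℕ × ℕ)) → List (ℕ × List (ℕ × ℕ)) → Bool
  | _, [], _ => true
  | 0, _ :: _, _ => false
  | f + 1, v :: todo, seen =>
    bif seen.any fun x => Nat.beq x.1 (hash v) && decide (x.2 = v) then explore f todo seen
    else Nat.ble (finalCount (step 0 v)) 315 &&
      explore f (step 0 v :: step 1 v :: todo) ((hash v, v) :: seen)

/-- The number of accepted words, summed over a multiset of states. -/
def wordCount (L n : ℕ) (v : List (ℕ × ℕ)) : ℕ :=
  (v.map fun x => x.2 * (acceptedWords L x.1 n).length).sum

lemma wordCount_cons (L n : ℕ) (x : ℕ × ℕ) (v : List (ℕ × ℕ)) :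
    wordCount L n (x :: v) = x.2 * (acceptedWords L x.1 n).length + wordCount L n v := rfl

lemma wordCount_addEntry (L n k c : ℕ) (v : List (ℕ × ℕ)) :
    wordCount L n (addEntry k c v) = c * (acceptedWords L k n).length + wordCount L n v := by
  induction v with
  | nil => rfl
  | cons x v ih =>
    obtain ⟨j, b⟩ := x
    rw [addEntry]
    cases h : Nat.beq j k with
    | true =>
      obtain rfl := Nat.eq_of_beq_eq_true h
      rw [cond_true, wordCount_cons, wordCount_cons]
      ring
    | false =>
      rw [cond_false]
      cases Nat.blt k j with
      | true => rfl
      | false =>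
        rw [cond_false, wordCount_cons, wordCount_cons, ih]
        ring

lemma wordCount_stepEntry (L n k c : ℕ) (acc : List (ℕ × ℕ)) :
    wordCount L (n / 2) (stepEntry (n % 2) k c acc) =
      c * (acceptedWords (L + 1) k n).length + wordCount L (n / 2) acc := by
  rw [stepEntry, acceptedWords, List.length_flatMap]
  induction successors (k / 4) with
  | nil => simp
  | cons t l ih =>
    rw [List.foldr_cons, List.map_cons, List.sum_cons]
    cases h : Nat.beq ((letterSize (t % 16) + k % 4) % 2) (n % 2) with
    | true =>
      rw [if_pos (Nat.eq_of_beq_eq_true h), cond_true, wordCount_addEntry, ih, List.length_map]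
      ring
    | false =>
      rw [if_neg (Nat.ne_of_beq_eq_false h), cond_false, ih]
      simp

lemma wordCount_step (L n : ℕ) (v : List (ℕ × ℕ)) :
    wordCount L (n / 2) (step (n % 2) v) = wordCount (L + 1) n v := by
  induction v with
  | nil => rfl
  | cons x v ih =>
    rw [step, List.foldr_cons, ← step, wordCount_stepEntry, ih, wordCount_cons]

lemma wordCount_zero (v : List (ℕ × ℕ)) : wordCount 0 0 v = finalCount v := by
  induction v with
  | nil => rfl
  | cons x v ih =>
    rw [wordCount_cons, ih, acceptedWords]
    change _ = bif Nat.beq (x.1 % 4) 0 then x.2 + finalCount v else finalCount v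
    cases h : Nat.beq (x.1 % 4) 0 with
    | true => simp [Nat.eq_of_beq_eq_true h]
    | false => simp [Nat.ne_of_beq_eq_false h]

lemma exists_closed_of_explore {f : ℕ} {todo : List (List (ℕ × ℕ))}
    {seen : List (ℕ × List (ℕ × ℕ))} (h : explore f todo seen = true) :
    ∃ S : Set (List (ℕ × ℕ)), (∀ v ∈ todo, v ∈ S) ∧ (∀ x ∈ seen, x.2 ∈ S) ∧
      ∀ v ∈ S, (∃ x ∈ seen, x.2 = v) ∨
        finalCount (step 0 v) ≤ 315 ∧ step 0 v ∈ S ∧ step 1 v ∈ S := by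
  induction f generalizing todo seen with
  | zero =>
    obtain _ | _ := todo
    · exact ⟨{v | ∃ x ∈ seen, x.2 = v}, by simp, fun x hx => ⟨x, hx, rfl⟩, fun v hv => Or.inl hv⟩
    · simp [explore] at h
  | succ f ih =>
    obtain _ | ⟨v, todo⟩ := todo
    · exact ⟨{v | ∃ x ∈ seen, x.2 = v}, by simp, fun x hx => ⟨x, hx, rfl⟩, fun v hv => Or.inl hv⟩
    rw [explore] at h
    cases hs : seen.any fun x => Nat.beq x.1 (hash v) && decide (x.2 = v) with
    | true =>
      rw [hs, cond_true] at h
      obtain ⟨S, h₁, h₂, h₃⟩ := ih h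
      obtain ⟨x, hx, hv⟩ := List.any_eq_true.1 hs
      rw [Bool.and_eq_true, decide_eq_true_iff] at hv
      exact ⟨S, List.forall_mem_cons.2 ⟨hv.2 ▸ h₂ x hx, h₁⟩, h₂, h₃⟩
    | false =>
      rw [hs, cond_false, Bool.and_eq_true] at h
      obtain ⟨S, h₁, h₂, h₃⟩ := ih h.2
      simp only [List.forall_mem_cons] at h₁ h₂
      refine ⟨S, List.forall_mem_cons.2 ⟨h₂.1, h₁.2.2⟩, h₂.2, fun w hw => ?_⟩
      obtain ⟨x, hx, rfl⟩ | h' := h₃ w hw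
      · obtain rfl | hx := List.mem_cons.1 hx
        · exact Or.inr ⟨Nat.le_of_ble_eq_true h.1, h₁.1, h₁.2.1⟩
        · exact Or.inl ⟨x, hx, rfl⟩
      · exact Or.inr h'

lemma wordCount_le {S : Set (List (ℕ × ℕ))}
    (hS : ∀ v ∈ S, finalCount (step 0 v) ≤ 315 ∧ step 0 v ∈ S ∧ step 1 v ∈ S) (L : ℕ) {n : ℕ}
    (hn : n < 2 ^ L) {v : List (ℕ × ℕ)} (hv : v ∈ S) : wordCount (L + 1) n v ≤ 315 := by
  induction L generalizing n v with
  | zero =>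
    obtain rfl : n = 0 := by omega
    rw [← wordCount_step, Nat.zero_mod, Nat.zero_div, wordCount_zero]
    exact (hS v hv).1
  | succ L ih =>
    rw [← wordCount_step]
    rw [pow_succ] at hn
    refine ih (by omega) ?_
    obtain h | h := Nat.mod_two_eq_zero_or_one n
    · rw [h]; exact (hS v hv).2.1
    · rw [h]; exact (hS v hv).2.2

lemma length_acceptedWords_le {f : ℕ} (h : explore f [[(0, 1)]] [] = true) {L n : ℕ}
    (hn : n < 2 ^ L) : (acceptedWords (L + 1) 0 n).length ≤ 315 := by
  obtain ⟨S, h₁, -, h₃⟩ := exists_closed_of_explore h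
  have := wordCount_le (fun v hv => (h₃ v hv).resolve_left (by simp)) L hn
    (h₁ _ (List.mem_singleton_self _))
  simpa [wordCount] using this

end Counting

section Verification

set_option maxRecDepth 100000 in
lemma checkTable_certificatesTwo : checkTable 2 certificatesTwo = true := by decide +kernel

set_option maxRecDepth 100000 in
lemma checkTable_certificatesThree : checkTable 3 certificatesThree = true := by decide +kernel

set_option maxRecDepth 100000 in
lemma checkTable_certificatesFour : checkTable 4 certificatesFour = true := by decide +kernel

set_option maxRecDepth 100000 in
lemma checkTable_certificatesFive : checkTable 5 certificatesFive = true := by decide +kernel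

set_option maxRecDepth 100000 in
lemma checkSuffixes_eq_true : checkSuffixes = true := by decide +kernel

set_option maxRecDepth 100000 in
lemma explore_eq_true : explore 1000 [[(0, 1)]] [] = true := by decide +kernel

lemma isReducible_of_mem_reducibleTables :
    ∀ p ∈ reducibleTables, ∀ x ∈ p.2, IsReducible (word p.1 x.1) := by
  simp only [reducibleTables, List.forall_mem_cons, List.not_mem_nil, false_implies, implies_true,
    and_true]
  exact ⟨fun x hx => isReducible_of_checkTable checkTable_certificatesTwo hx,
    fun x hx => isReducible_of_checkTable checkTable_certificatesThree hx,
    fun x hx => isReducible_of_checkTable checkTable_certificatesFour hx,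
    fun x hx => isReducible_of_checkTable checkTable_certificatesFive hx⟩

end Verification

section Dimension

lemma mem_acceptedWords_of_isAdmissible {l : List ℕ} (hl : IsWord l) (h : IsAdmissible l) :
    l ∈ acceptedWords l.length 0 (wordDegree l) := by
  refine mem_acceptedWords ?_ rfl
  exact accepts_of_isAdmissible checkSuffixes_eq_true isReducible_of_mem_reducibleTables
    (r := []) (a := []) hl h (p := (0, [(0, 0)])) (by simp [suffixes]) (x := (0, 0)) (by simp) rfl

/-- The span of the monomials of degree `n` of admissible words. -/
noncomputable def admissibleSpan (n : ℕ) : Submodule (ZMod 2) P :=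
  Submodule.span (ZMod 2) {g | ∃ t, t.length = n + 1 ∧ IsWord t ∧ wordDegree t = n ∧
    IsAdmissible t ∧ g = wordMonomial t}

open Classical in
lemma admissibleSpan_le (n : ℕ) : admissibleSpan n ≤ Submodule.span (ZMod 2)
    (((acceptedWords (n + 1) 0 n).map wordMonomial).toFinset : Set P) := by
  refine Submodule.span_mono ?_
  rintro _ ⟨t, hL, ht, rfl, h, rfl⟩
  rw [Finset.mem_coe, List.mem_toFinset]
  exact List.mem_map_of_mem (hL ▸ mem_acceptedWords_of_isAdmissible ht h)

instance finite_admissibleSpan (n : ℕ) : Module.Finite (ZMod 2) (admissibleSpan n) := by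
  classical
  have := FiniteDimensional.span_finset (ZMod 2)
    ((acceptedWords (n + 1) 0 n).map wordMonomial).toFinset
  exact Submodule.finiteDimensional_of_le (admissibleSpan_le n)

lemma finrank_admissibleSpan_le (n : ℕ) : Module.finrank (ZMod 2) (admissibleSpan n) ≤ 315 := by
  classical
  have := FiniteDimensional.span_finset (ZMod 2)
    ((acceptedWords (n + 1) 0 n).map wordMonomial).toFinset
  refine (Submodule.finrank_mono (admissibleSpan_le n)).trans
    ((finrank_span_finset_le_card _).trans ((List.toFinset_card_le _).trans ?_))
  rw [List.length_map]
  exact length_acceptedWords_le explore_eq_true n.lt_two_pow_self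

lemma admissibleSpan_le_homogeneousSubmodule (n : ℕ) :
    admissibleSpan n ≤ homogeneousSubmodule (Fin 4) (ZMod 2) n := by
  rw [admissibleSpan, Submodule.span_le]
  rintro _ ⟨t, -, -, rfl, -, rfl⟩
  exact isHomogeneous_wordMonomial t

lemma homogeneousSubmodule_le (n : ℕ) :
    homogeneousSubmodule (Fin 4) (ZMod 2) n ≤ hitSubmodule 4 ⊔ admissibleSpan n := by
  have hn : n < 2 ^ (n + 1) := n.lt_succ_self.trans (n + 1).lt_two_pow_self
  intro f hf
  refine Submodule.span_le.2 ?_ (mem_span_wordMonomial hn hf)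
  rintro _ ⟨l, hL, hl, hd, rfl⟩
  exact wordMonomial_mem_sup hn hl hL hd

lemma mkQ_comp_inclusion_surjective (n : ℕ) :
    Function.Surjective (((hitSubmodule 4).comap
      (homogeneousSubmodule (Fin 4) (ZMod 2) n).subtype).mkQ ∘ₗ
        Submodule.inclusion (admissibleSpan_le_homogeneousSubmodule n)) := by
  intro q
  obtain ⟨f, rfl⟩ := Submodule.mkQ_surjective _ q
  obtain ⟨x, hx, y, hy, h⟩ := Submodule.mem_sup.1 (homogeneousSubmodule_le n f.2)
  refine ⟨⟨y, hy⟩, ?_⟩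
  refine (Submodule.Quotient.eq _).2 ?_
  rw [Submodule.mem_comap, map_sub]
  change y - (f : P) ∈ hitSubmodule 4
  rw [← h, sub_add_cancel_right]
  exact neg_mem hx

end Dimension

end Kameko

/-- Kameko's conjecture holds for `k = 4`:
`dim (QP_4)_n ≤ (2 - 1)(2^2 - 1)(2^3 - 1)(2^4 - 1) = 315` for every `n`. -/
theorem stmt8 (n : ℕ) :
    Module.finrank (ZMod 2) (QP 4 n) ≤ (2 - 1) * (2 ^ 2 - 1) * (2 ^ 3 - 1) * (2 ^ 4 - 1) := by
  exact (LinearMap.finrank_le_finrank_of_surjective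
    (Kameko.mkQ_comp_inclusion_surjective n)).trans (Kameko.finrank_admissibleSpan_le n)
end

section
/- For every integer s ≥ 1, dim_{F_2}(QP_4)_{2^{s+1}−3} equals 4 if s = 1, equals 15 if s = 2, equals 35 if s = 3, and equals 45 if s ≥ 4. -/
open MvPolynomial

namespace HitProblem

/-- The polynomial algebra `P_k`. -/
abbrev Poly (k : ℕ) := MvPolynomial (Fin k) (ZMod 2)

/-- The total Steenrod square with a grading variable `t`: the coefficient of `t ^ i` in
`sqSeries k f` is `Sq^i f`. -/
noncomputable def sqSeries (k : ℕ) : Poly k →ₐ[ZMod 2] Polynomial (Poly k) :=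
  aeval fun j => Polynomial.C (X j) + Polynomial.X * Polynomial.C (X j ^ 2)

/-- The homogeneity condition satisfied by `sqSeries k f` for `f` homogeneous of degree `d`. -/
def IsGraded {k : ℕ} (d : ℕ) (p : Polynomial (Poly k)) : Prop :=
  ∀ i, (p.coeff i).IsHomogeneous (d + i)

section Series

variable {k : ℕ}

lemma IsGraded.mul {d e : ℕ} {p q : Polynomial (Poly k)} (hp : IsGraded d p)
    (hq : IsGraded e q) : IsGraded (d + e) (p * q) := by
  intro i
  rw [Polynomial.coeff_mul]
  refine IsHomogeneous.sum _ _ _ fun x hx => ?_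
  have := (hp x.1).mul (hq x.2)
  rwa [show d + x.1 + (e + x.2) = d + e + i by
    have := Finset.HasAntidiagonal.mem_antidiagonal.1 hx
    omega] at this

lemma isGraded_C {d : ℕ} {f : Poly k} (hf : f.IsHomogeneous d) :
    IsGraded d (Polynomial.C f) := by
  intro i
  rw [Polynomial.coeff_C]
  split_ifs with h
  · simpa [h] using hf
  · exact isHomogeneous_zero _ _ _

lemma sqSeries_X (j : Fin k) :
    sqSeries k (X j) = Polynomial.C (X j) + Polynomial.X * Polynomial.C (X j ^ 2) := by
  simp [sqSeries]

lemma add_pow_eq_sum_monomial (x : Poly k) (n : ℕ) :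
    (Polynomial.C x + Polynomial.X * Polynomial.C (x ^ 2)) ^ n =
      ∑ l ∈ Finset.range (n + 1), Polynomial.monomial l ((n.choose l : Poly k) * x ^ (n + l)) := by
  rw [add_comm, add_pow]
  refine Finset.sum_congr rfl fun l hl => ?_
  have hl' : l ≤ n := Nat.lt_succ_iff.1 (Finset.mem_range.1 hl)
  rw [← Polynomial.C_mul_X_pow_eq_monomial, show n + l = 2 * l + (n - l) by omega]
  simp only [map_mul, map_pow, map_natCast, pow_add, pow_mul, mul_pow]
  ring

lemma sqSeries_monomial (m : Fin k →₀ ℕ) :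
    sqSeries k (monomial m 1) =
      ∑ p ∈ Fintype.piFinset fun j => Finset.range (m j + 1),
        Polynomial.monomial (∑ j, p j) (monomial (m + Finsupp.equivFunOnFinite.symm p)
          (∏ j, ((m j).choose (p j) : ZMod 2))) := by
  have hm : (monomial m 1 : Poly k) = ∏ j, X j ^ m j := by
    rw [monomial_eq, Finsupp.prod_fintype _ _ (by simp)]; simp
  have hj : ∀ j, sqSeries k (X j ^ m j) = ∑ l ∈ Finset.range (m j + 1),
      Polynomial.monomial l (((m j).choose l : Poly k) * X j ^ (m j + l)) := fun j => by
    rw [map_pow, sqSeries_X, add_pow_eq_sum_monomial]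
  rw [hm, map_prod, Finset.prod_congr rfl fun j _ => hj j, Finset.prod_univ_sum]
  refine Finset.sum_congr rfl fun p _ => ?_
  simp only [← Polynomial.C_mul_X_pow_eq_monomial, Finset.prod_mul_distrib,
    Finset.prod_pow_eq_pow_sum, ← map_prod]
  congr 2
  rw [monomial_eq (s := m + _), Finsupp.prod_fintype _ _ (by simp)]
  simp

lemma sqSeries_isGraded {d : ℕ} {f : Poly k} (hf : f.IsHomogeneous d) :
    IsGraded d (sqSeries k f) := by
  intro i
  rw [f.as_sum, map_sum, Polynomial.finsetSum_coeff]
  refine IsHomogeneous.sum _ _ _ fun m hm => ?_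
  have hd : ∑ j, m j = d := by
    rw [← hf (mem_support_iff.1 hm)]; simp [Finsupp.weight_apply, Finsupp.sum_fintype]
  rw [show monomial m (coeff m f) = coeff m f • (monomial m 1 : Poly k) by simp [smul_monomial],
    map_smul, Polynomial.coeff_smul, smul_eq_C_mul]
  refine IsHomogeneous.C_mul ?_ _
  rw [sqSeries_monomial, Polynomial.finsetSum_coeff]
  refine IsHomogeneous.sum _ _ _ fun p _ => ?_
  rw [Polynomial.coeff_monomial]
  split_ifs with h
  · apply isHomogeneous_monomial
    simp [Finsupp.degree_eq_sum, Finset.sum_add_distrib, hd, h]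
  · exact isHomogeneous_zero _ _ _

lemma sqSeries_coeff_zero (f : Poly k) : (sqSeries k f).coeff 0 = f := by
  have : ((Polynomial.aeval (0 : Poly k)).restrictScalars (ZMod 2)).comp (sqSeries k) =
      AlgHom.id (ZMod 2) (Poly k) := by
    ext j; simp [sqSeries_X]
  simpa [Polynomial.coeff_zero_eq_aeval_zero] using DFunLike.congr_fun this f

lemma eval_one_sqSeries (f : Poly k) : (sqSeries k f).eval 1 = SqTotal k f := by
  have : ((Polynomial.aeval (1 : Poly k)).restrictScalars (ZMod 2)).comp (sqSeries k) =
      SqTotal k := by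
    ext j; simp [sqSeries_X, SqTotal]
  simpa [Polynomial.coe_aeval_eq_eval] using DFunLike.congr_fun this f

/-- `Sq^d f = f ^ 2` for `f` homogeneous of degree `d`. -/
lemma sqSeries_coeff_degree {d : ℕ} {f : Poly k} (hf : f.IsHomogeneous d) :
    (sqSeries k f).coeff d = f ^ 2 := by
  have key : ∀ m : Fin k →₀ ℕ,
      (sqSeries k (monomial m 1)).coeff m.degree = monomial m 1 ^ 2 := by
    intro m
    rw [sqSeries_monomial, Polynomial.finsetSum_coeff, Finset.sum_eq_single (⇑m)]
    · simp [Finsupp.degree_eq_sum, monomial_pow, two_smul]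
    · intro p hp hne
      rw [Polynomial.coeff_monomial, if_neg]
      intro h
      rw [Finsupp.degree_eq_sum] at h
      refine hne (funext fun j => ?_)
      exact (Finset.sum_eq_sum_iff_of_le fun j _ => Nat.lt_succ_iff.1
        (Finset.mem_range.1 (Fintype.mem_piFinset.1 hp j))).1 h j (Finset.mem_univ j)
    · intro h
      simp [Fintype.mem_piFinset] at h
  conv_lhs => rw [f.as_sum]
  conv_rhs => rw [f.as_sum, sum_pow_char 2]
  rw [map_sum, Polynomial.finsetSum_coeff]
  refine Finset.sum_congr rfl fun m hm => ?_
  have hd : m.degree = d := by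
    rw [← hf (mem_support_iff.1 hm)]
    simp [Finsupp.weight_apply, Finsupp.degree_eq_sum, Finsupp.sum_fintype]
  rw [show monomial m (coeff m f) = coeff m f • (monomial m 1 : Poly k) by simp [smul_monomial],
    map_smul, Polynomial.coeff_smul, smul_pow, ← key m, hd, ZMod.pow_card]

/-- `Sq^i` as a linear map. -/
noncomputable def sq (k i : ℕ) : Poly k →ₗ[ZMod 2] Poly k where
  toFun f := (sqSeries k f).coeff i
  map_add' f g := by simp
  map_smul' c f := by simp

lemma sq_apply (i : ℕ) (f : Poly k) : sq k i f = (sqSeries k f).coeff i := rfl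

lemma homogeneousComponent_SqTotal {d : ℕ} (i : ℕ) {f : Poly k} (hf : f.IsHomogeneous d) :
    homogeneousComponent (d + i) (SqTotal k f) = sq k i f := by
  rw [← eval_one_sqSeries, Polynomial.eval_eq_sum, Polynomial.sum, map_sum]
  simp only [one_pow, mul_one]
  have h : ∀ j, homogeneousComponent (d + i) ((sqSeries k f).coeff j) =
      if j = i then (sqSeries k f).coeff j else 0 := by
    intro j
    rw [homogeneousComponent_of_mem (sqSeries_isGraded hf j)]
    simp [eq_comm]
  simp only [h, Finset.sum_ite_eq', sq_apply]
  split_ifs with hi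
  · rfl
  · exact (Polynomial.notMem_support_iff.1 hi).symm

lemma SqOp_eq_sq (i : ℕ) (f : Poly k) : SqOp k i f = sq k i f := by
  conv_rhs => rw [← sum_homogeneousComponent f, map_sum]
  exact Finset.sum_congr rfl fun d _ =>
    homogeneousComponent_SqTotal i (homogeneousComponent_isHomogeneous d f)

lemma sq_mem_hit {i : ℕ} (hi : 0 < i) (f : Poly k) : sq k i f ∈ hitSubmodule k :=
  Submodule.subset_span ⟨i, f, hi, (SqOp_eq_sq i f).symm⟩

lemma coeff_sq_even (p : Polynomial (Poly k)) (i : ℕ) :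
    (p ^ 2).coeff (2 * i) = p.coeff i ^ 2 := by
  rw [← Polynomial.map_frobenius_expand 2 p, Polynomial.coeff_map, mul_comm,
    Polynomial.coeff_expand_mul two_pos, frobenius_def]

lemma coeff_sq_odd (p : Polynomial (Poly k)) (i : ℕ) : (p ^ 2).coeff (2 * i + 1) = 0 := by
  rw [← Polynomial.map_frobenius_expand 2 p, Polynomial.coeff_map,
    Polynomial.coeff_expand two_pos, if_neg (by omega), map_zero]

lemma coeff_X_mul_C_mul_sq (g : Poly k) (p : Polynomial (Poly k)) (i : ℕ) :
    (Polynomial.X * (Polynomial.C g * p ^ 2)).coeff (2 * i) = 0 := by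
  cases i with
  | zero => simp
  | succ i =>
    rw [show 2 * (i + 1) = 2 * i + 1 + 1 by ring, Polynomial.coeff_X_mul,
      Polynomial.coeff_C_mul, coeff_sq_odd, mul_zero]

lemma coeff_X_sq_mul_C_mul_sq (g : Poly k) (p : Polynomial (Poly k)) (i : ℕ) :
    (Polynomial.X ^ 2 * (Polynomial.C g * p ^ 2)).coeff (2 * (i + 1)) = g * p.coeff i ^ 2 := by
  rw [mul_add, mul_one, Polynomial.coeff_X_pow_mul, Polynomial.coeff_C_mul, coeff_sq_even]

/-- The extension of `sqSeries` to polynomials in `t`, fixing `t`. -/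
noncomputable def sqExt (k : ℕ) : Polynomial (Poly k) →+* Polynomial (Poly k) :=
  Polynomial.eval₂RingHom (sqSeries k : Poly k →+* Polynomial (Poly k)) Polynomial.X

lemma sqExt_C (f : Poly k) : sqExt k (Polynomial.C f) = sqSeries k f := by
  simp [sqExt]

lemma sqExt_X : sqExt k Polynomial.X = Polynomial.X := by
  simp [sqExt]

lemma coeff_sqExt_sub_mem (p : Polynomial (Poly k)) (n : ℕ) :
    (sqExt k p).coeff n - p.coeff n ∈ hitSubmodule k := by
  induction p using Polynomial.induction_on' with
  | add p q hp hq =>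
    rw [map_add, Polynomial.coeff_add, Polynomial.coeff_add, add_sub_add_comm]
    exact add_mem hp hq
  | monomial m f =>
    rw [← Polynomial.C_mul_X_pow_eq_monomial, map_mul, map_pow, sqExt_C, sqExt_X,
      Polynomial.coeff_mul_X_pow', Polynomial.coeff_C_mul_X_pow]
    rcases lt_trichotomy m n with h | h | h
    · rw [if_pos h.le, if_neg h.ne', sub_zero]
      exact sq_mem_hit (Nat.sub_pos_of_lt h) f
    · simp [h, sqSeries_coeff_zero]
    · simp [h.not_ge, h.ne]

/-- The conjugate total Steenrod square of `x_j`, truncated after `N` terms. -/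
noncomputable def conjSeries (j : Fin k) : ℕ → Polynomial (Poly k)
  | 0 => 0
  | N + 1 => Polynomial.C (X j) + Polynomial.X * conjSeries j N ^ 2

lemma sqExt_conjSeries (j : Fin k) (N : ℕ) :
    sqExt k (conjSeries j N) =
      Polynomial.C (X j) + Polynomial.X ^ (2 ^ N - 1) * Polynomial.C (X j ^ 2 ^ N) := by
  induction N with
  | zero => simp [conjSeries, CharTwo.add_self_eq_zero]
  | succ N ih =>
    have h : 2 ^ (N + 1) - 1 = (2 ^ N - 1) * 2 + 1 := by
      have := Nat.one_le_two_pow (n := N)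
      rw [pow_succ]; omega
    rw [conjSeries, map_add, map_mul, map_pow, ih, sqExt_C, sqExt_X, sqSeries_X, add_pow_char,
      mul_pow, ← pow_mul, h, pow_succ Polynomial.X, ← map_pow, ← map_pow, ← pow_mul, ← pow_succ,
      mul_add, ← add_assoc, add_assoc (Polynomial.C (X j)), CharTwo.add_self_eq_zero, add_zero]
    ring

lemma isGraded_conjSeries (j : Fin k) (N : ℕ) : IsGraded 1 (conjSeries j N) := by
  induction N with
  | zero => intro i; simpa [conjSeries] using isHomogeneous_zero _ _ _
  | succ N ih =>
    intro i
    rw [conjSeries, Polynomial.coeff_add]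
    refine (isGraded_C (isHomogeneous_X _ j) i).add ?_
    cases i with
    | zero => simpa using isHomogeneous_zero _ _ _
    | succ i =>
      rw [Polynomial.coeff_X_mul, pow_two]
      convert (ih.mul ih) i using 1
      ring

/-- A product `x_j y²` with `y` homogeneous of positive even degree is hit. -/
lemma X_mul_sq_mem_hit (j : Fin k) {d : ℕ} (hd : Even d) (hpos : 0 < d) {y : Poly k}
    (hy : y.IsHomogeneous d) : X j * y ^ 2 ∈ hitSubmodule k := by
  have h := coeff_sqExt_sub_mem (conjSeries j (d + 1) * Polynomial.C y) d
  obtain ⟨e, rfl⟩ := hd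
  rw [map_mul, sqExt_C, sqExt_conjSeries, add_mul, Polynomial.coeff_add, Polynomial.coeff_C_mul,
    sqSeries_coeff_degree hy, mul_assoc, Polynomial.coeff_X_pow_mul', if_neg, conjSeries,
    Polynomial.coeff_mul_C, Polynomial.coeff_add, Polynomial.coeff_C_of_ne_zero hpos.ne',
    ← one_mul (conjSeries _ _ ^ 2), ← map_one Polynomial.C, ← two_mul,
    coeff_X_mul_C_mul_sq] at h
  · simpa using h
  · have := Nat.lt_two_pow_self (n := e + e)
    rw [pow_succ]; omega

lemma homogeneousComponent_mem_hit_induction {n : ℕ} {p : Poly k → Prop} (h0 : p 0)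
    (hadd : ∀ f g, p f → p g → p (f + g))
    (hsq : ∀ i d f, 0 < i → d + i = n → f.IsHomogeneous d → p (sq k i f)) {f : Poly k}
    (hf : f ∈ hitSubmodule k) (hn : f.IsHomogeneous n) : p f := by
  rw [← homogeneousComponent_of_mem hn |>.trans (if_pos rfl)]
  clear hn
  induction hf using Submodule.span_induction with
  | mem g hg =>
    obtain ⟨i, f, hi, rfl⟩ := hg
    rw [SqOp_eq_sq, ← sum_homogeneousComponent f, map_sum, map_sum]
    refine Finset.sum_induction _ p hadd h0 fun d _ => ?_
    have hd := homogeneousComponent_isHomogeneous d f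
    rw [sq_apply, homogeneousComponent_of_mem (sqSeries_isGraded hd i)]
    split_ifs with h
    · exact hsq i d _ hi h.symm hd
    · exact h0
  | zero => simpa using h0
  | add f g _ _ hf hg => rw [map_add]; exact hadd _ _ hf hg
  | smul c f _ hf =>
    rw [map_smul]
    obtain rfl | rfl : c = 0 ∨ c = 1 := by decide +revert
    · simpa using h0
    · simpa using hf

end Series

/-- The product of the three variables other than `x_a`. -/
noncomputable def coX (a : Fin 4) : Poly 4 := ∏ b ∈ Finset.univ.erase a, X b

lemma exists_coX_eq (a : Fin 4) : ∃ b c d : Fin 4, coX a = X b * X c * X d := by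
  obtain ⟨b, c, d, h, hbc, hbd, hcd⟩ : ∃ b c d : Fin 4, Finset.univ.erase a = {b, c, d} ∧
      b ≠ c ∧ b ≠ d ∧ c ≠ d := by
    decide +revert
  exact ⟨b, c, d, by rw [coX, h, Finset.prod_insert (by simp [hbc, hbd]),
    Finset.prod_insert (by simp [hcd]), Finset.prod_singleton, mul_assoc]⟩

lemma X_mul_coX (a : Fin 4) : X a * coX a = ∏ b, X b :=
  Finset.mul_prod_erase _ _ (Finset.mem_univ a)

lemma coX_isHomogeneous (a : Fin 4) : (coX a).IsHomogeneous 3 := by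
  obtain ⟨b, c, d, h⟩ := exists_coX_eq a
  rw [h]
  exact ((isHomogeneous_X _ b).mul (isHomogeneous_X _ c)).mul (isHomogeneous_X _ d)

/-- The additive operator `f ↦ (∏_{b ≠ a} x_b) f²`. -/
noncomputable def lift (a : Fin 4) : Poly 4 →ₗ[ZMod 2] Poly 4 where
  toFun f := coX a * f ^ 2
  map_add' f g := by rw [add_pow_char, mul_add]
  map_smul' c f := by
    rw [smul_pow, ZMod.pow_card, mul_smul_comm]; rfl

lemma lift_apply (a : Fin 4) (f : Poly 4) : lift a f = coX a * f ^ 2 := rfl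

lemma lift_isHomogeneous (a : Fin 4) {n : ℕ} {f : Poly 4} (hf : f.IsHomogeneous n) :
    (lift a f).IsHomogeneous (2 * n + 3) := by
  rw [lift_apply, show 2 * n + 3 = 3 + n * 2 by ring]
  exact (coX_isHomogeneous a).mul (hf.pow 2)

lemma lift_sq_mem_hit (a : Fin 4) {i d : ℕ} (hodd : Odd (d + i)) (hi : 0 < i) {f : Poly 4}
    (hf : f.IsHomogeneous d) : lift a (sq 4 i f) ∈ hitSubmodule 4 := by
  obtain ⟨x, y, z, hx⟩ := exists_coX_eq a
  obtain ⟨i, rfl⟩ := Nat.exists_eq_add_one_of_ne_zero hi.ne'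
  set N := 2 * (i + 1) with hN
  set U := conjSeries x N with hU
  set V := conjSeries y N with hV
  set W := conjSeries z N with hW
  have hM : ¬ 2 ^ (N + 1) - 1 ≤ N := by
    have := Nat.lt_two_pow_self (n := N)
    rw [pow_succ]; omega
  have h := coeff_sqExt_sub_mem (conjSeries x (N + 1) * conjSeries y (N + 1) *
    conjSeries z (N + 1) * Polynomial.C f ^ 2) N
  have hleft : (sqExt 4 (conjSeries x (N + 1) * conjSeries y (N + 1) *
      conjSeries z (N + 1) * Polynomial.C f ^ 2)).coeff N = lift a (sq 4 (i + 1) f) := by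
    simp only [map_mul, map_pow, sqExt_conjSeries, sqExt_C]
    generalize 2 ^ (N + 1) - 1 = M at hM
    rw [lift_apply, hx, sq_apply, ← coeff_sq_even, ← hN, ← Polynomial.coeff_C_mul]
    generalize sqSeries 4 f ^ 2 = F
    generalize Polynomial.C (X x : Poly 4) ^ 2 ^ (N + 1) = A
    generalize Polynomial.C (X y : Poly 4) ^ 2 ^ (N + 1) = B
    generalize Polynomial.C (X z : Poly 4) ^ 2 ^ (N + 1) = D
    rw [map_mul, map_mul, ← sub_eq_zero, ← Polynomial.coeff_sub]
    set u : Polynomial (Poly 4) := Polynomial.C (X x)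
    set v : Polynomial (Poly 4) := Polynomial.C (X y)
    set w : Polynomial (Poly 4) := Polynomial.C (X z)
    rw [show (u + Polynomial.X ^ M * A) * (v + Polynomial.X ^ M * B) *
      (w + Polynomial.X ^ M * D) * F - u * v * w * F = Polynomial.X ^ M *
      ((A * v * w + u * B * w + u * v * D + Polynomial.X ^ M * (A * B * w + A * v * D + u * B * D) +
        Polynomial.X ^ M * Polynomial.X ^ M * (A * B * D)) * F) by ring,
      Polynomial.coeff_X_pow_mul', if_neg hM]
  have hright : (conjSeries x (N + 1) * conjSeries y (N + 1) *
      conjSeries z (N + 1) * Polynomial.C f ^ 2).coeff N ∈ hitSubmodule 4 := by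
    have hexp : conjSeries x (N + 1) * conjSeries y (N + 1) *
        conjSeries z (N + 1) * Polynomial.C f ^ 2 =
        Polynomial.C (X x * X y * X z * f ^ 2) +
        Polynomial.X * (Polynomial.C (X x * X y) * (W * Polynomial.C f) ^ 2) +
        Polynomial.X * (Polynomial.C (X x * X z) * (V * Polynomial.C f) ^ 2) +
        Polynomial.X * (Polynomial.C (X y * X z) * (U * Polynomial.C f) ^ 2) +
        Polynomial.X * (Polynomial.C 1 * (Polynomial.X * U * V * W * Polynomial.C f) ^ 2) +
        Polynomial.X ^ 2 * (Polynomial.C (X x) * (V * W * Polynomial.C f) ^ 2) +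
        Polynomial.X ^ 2 * (Polynomial.C (X y) * (U * W * Polynomial.C f) ^ 2) +
        Polynomial.X ^ 2 * (Polynomial.C (X z) * (U * V * Polynomial.C f) ^ 2) := by
      simp only [conjSeries, map_mul, map_pow, map_one, ← hU, ← hV, ← hW]
      ring
    have hg : ∀ u v : Fin 4,
        ((conjSeries u N * conjSeries v N * Polynomial.C f).coeff i).IsHomogeneous
        (d + (i + 1) + 1) := fun u v => by
      convert ((isGraded_conjSeries u N).mul (isGraded_conjSeries v N)).mul (isGraded_C hf) i
        using 1
      ring
    rw [hexp]
    simp only [Polynomial.coeff_add, hN, coeff_X_mul_C_mul_sq, coeff_X_sq_mul_C_mul_sq]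
    rw [Polynomial.coeff_C_of_ne_zero (by omega)]
    simp only [zero_add]
    exact add_mem (add_mem (X_mul_sq_mem_hit x hodd.add_one (by omega) (hg y z))
      (X_mul_sq_mem_hit y hodd.add_one (by omega) (hg x z)))
      (X_mul_sq_mem_hit z hodd.add_one (by omega) (hg x y))
  rw [hleft] at h
  simpa using add_mem h hright

/-- `lift a` preserves hit polynomials in odd degrees. -/
lemma lift_mem_hit (a : Fin 4) {n : ℕ} (hodd : Odd n) {f : Poly 4} (hf : f ∈ hitSubmodule 4)
    (hn : f.IsHomogeneous n) : lift a f ∈ hitSubmodule 4 := by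
  refine homogeneousComponent_mem_hit_induction (p := fun f => lift a f ∈ hitSubmodule 4)
    (by simp) (fun f g hf hg => by rw [map_add]; exact add_mem hf hg) ?_ hf hn
  rintro i d f hi rfl hf
  exact lift_sq_mem_hit a hodd hi hf

/-- `∑ a, lift a (x_a g)` is hit, being `Sq^1 (x_1 x_2 x_3 x_4 g²)`. -/
lemma sum_lift_X_mul_mem_hit (g : Poly 4) : ∑ a, lift a (X a * g) ∈ hitSubmodule 4 := by
  convert sq_mem_hit one_pos ((∏ b : Fin 4, X b) * g ^ 2) using 1
  rw [sq_apply, map_mul, map_pow, Polynomial.mul_coeff_one, ← zero_add 1, ← mul_zero 2,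
    coeff_sq_odd, mul_zero, zero_add, coeff_sq_even, sqSeries_coeff_zero]
  have h : ∀ a : Fin 4, lift a (X a * g) = (∏ b, X b) * X a * g ^ 2 := fun a => by
    rw [lift_apply, ← X_mul_coX a]; ring
  simp only [h, ← Finset.sum_mul, ← Finset.mul_sum]
  congr 1
  simp only [Fin.prod_univ_four, Fin.sum_univ_four, map_mul, sqSeries_X]
  simp [-map_pow, Polynomial.mul_coeff_one, Polynomial.mul_coeff_zero]
  ring

lemma lift_smodEq (a : Fin 4) {n : ℕ} (hodd : Odd n) {f g : Poly 4} (hf : f.IsHomogeneous n)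
    (hg : g.IsHomogeneous n) (h : f ≡ g [SMOD hitSubmodule 4]) :
    lift a f ≡ lift a g [SMOD hitSubmodule 4] := by
  rw [SModEq.sub_mem] at h ⊢
  rw [← map_sub]
  exact lift_mem_hit a hodd h (hf.sub hg)

lemma exists_sum_eq_and_coX_eq {a b : Fin 4} (hab : a ≠ b) : ∃ c d : Fin 4,
    (∀ F : Fin 4 → Poly 4, ∑ i, F i = F a + F b + (F c + F d)) ∧
    coX a = X b * X c * X d ∧ coX b = X a * X c * X d ∧
    coX c = X a * X b * X d ∧ coX d = X a * X b * X c := by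
  obtain ⟨c, d, hac, had, hbc, hbd, hcd, h⟩ : ∃ c d : Fin 4, a ≠ c ∧ a ≠ d ∧ b ≠ c ∧ b ≠ d ∧
      c ≠ d ∧ Finset.univ = {a, b, c, d} := by
    decide +revert
  have hprod : ∀ x y z u : Fin 4, x ≠ y → x ≠ z → x ≠ u → y ≠ z → y ≠ u → z ≠ u →
      Finset.univ = {x, y, z, u} → coX x = X y * X z * X u := by
    intro x y z u hxy hxz hxu hyz hyu hzu h
    have : Finset.univ.erase x = {y, z, u} := by
      rw [h, Finset.erase_insert (by simp [hxy, hxz, hxu])]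
    rw [coX, this, Finset.prod_insert (by simp [hyz, hyu]), Finset.prod_insert (by simp [hzu]),
      Finset.prod_singleton, mul_assoc]
  refine ⟨c, d, fun F => ?_, hprod a b c d hab hac had hbc hbd hcd h,
    hprod b a c d hab.symm hbc hbd hac had hcd (h.trans ?_),
    hprod c a b d hac.symm hbc.symm hcd hab had hbd (h.trans ?_),
    hprod d a b c had.symm hbd.symm hcd.symm hab hac hbc (h.trans ?_)⟩
  · rw [h, Finset.sum_insert (by simp [hab, hac, had]), Finset.sum_insert (by simp [hbc, hbd]),
      Finset.sum_insert (by simp [hcd]), Finset.sum_singleton, add_assoc]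
  all_goals ext x; simp only [Finset.mem_insert, Finset.mem_singleton]; tauto

lemma lift_X_mul_sq_mem_hit (a c d : Fin 4) {n : ℕ} (hodd : Odd n) {y : Poly 4}
    (hy : y.IsHomogeneous n) : lift a (X d * (X c * y) ^ 2) ∈ hitSubmodule 4 := by
  have hcy : (X c * y).IsHomogeneous (1 + n) := (isHomogeneous_X _ c).mul hy
  exact lift_mem_hit a (n := 1 + (1 + n) * 2) ⟨1 + n, by ring⟩
    (X_mul_sq_mem_hit d (odd_one.add_odd hodd) (by omega) hcy)
    ((isHomogeneous_X _ d).mul (hcy.pow 2))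

lemma smodEq_of_add_add_add_mem {M : Submodule (ZMod 2) (Poly 4)} {f g u v : Poly 4}
    (h : f + g + (u + v) ∈ M) (hu : u ∈ M) (hv : v ∈ M) : f ≡ g [SMOD M] := by
  rw [SModEq.sub_mem, CharTwo.sub_eq_add]
  exact (M.add_mem_iff_left (add_mem hu hv)).1 h

lemma lift_swap (a b : Fin 4) {n : ℕ} (hodd : Odd n) {y : Poly 4} (hy : y.IsHomogeneous n) :
    lift a (lift b y) ≡ lift b (lift a y) [SMOD hitSubmodule 4] := by
  rcases eq_or_ne a b with rfl | hab
  · rfl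
  obtain ⟨c, d, hsum, ha, hb, -, -⟩ := exists_sum_eq_and_coX_eq hab
  have h := sum_lift_X_mul_mem_hit (X c * X d * y ^ 2)
  rw [hsum] at h
  have h1 : X a * (X c * X d * y ^ 2) = lift b y := by rw [lift_apply, hb]; ring
  have h2 : X b * (X c * X d * y ^ 2) = lift a y := by rw [lift_apply, ha]; ring
  have h3 : X c * (X c * X d * y ^ 2) = X d * (X c * y) ^ 2 := by ring
  have h4 : X d * (X c * X d * y ^ 2) = X c * (X d * y) ^ 2 := by ring
  rw [h1, h2, h3, h4] at h
  exact smodEq_of_add_add_add_mem h (lift_X_mul_sq_mem_hit c c d hodd hy)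
    (lift_X_mul_sq_mem_hit d d c hodd hy)

lemma odd_two_mul_add_three (n : ℕ) : Odd (2 * n + 3) := ⟨n + 1, by ring⟩

lemma lift_lift_lift_smodEq (a b : Fin 4) {n : ℕ} (hodd : Odd n) {y : Poly 4}
    (hy : y.IsHomogeneous n) :
    lift a (lift a (lift b y)) ≡ lift a (lift b (lift b y)) [SMOD hitSubmodule 4] := by
  rcases eq_or_ne a b with rfl | hab
  · rfl
  obtain ⟨c, d, hsum, ha, hb, hc, hd⟩ := exists_sum_eq_and_coX_eq hab
  have h := sum_lift_X_mul_mem_hit (X a * X b * X c ^ 3 * X d ^ 3 * y ^ 4)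
  rw [hsum] at h
  have h1 : X a * (X a * X b * X c ^ 3 * X d ^ 3 * y ^ 4) = lift a (lift b y) := by
    simp only [lift_apply, ha, hb]; ring
  have h2 : X b * (X a * X b * X c ^ 3 * X d ^ 3 * y ^ 4) = lift b (lift a y) := by
    simp only [lift_apply, ha, hb]; ring
  have h3 : X c * (X a * X b * X c ^ 3 * X d ^ 3 * y ^ 4) = lift c (X d * (X c * y) ^ 2) := by
    simp only [lift_apply, hc]; ring
  have h4 : X d * (X a * X b * X c ^ 3 * X d ^ 3 * y ^ 4) = lift d (X c * (X d * y) ^ 2) := by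
    simp only [lift_apply, hd]; ring
  rw [h1, h2, h3, h4] at h
  have hhom : ∀ c d : Fin 4, (X d * (X c * y) ^ 2).IsHomogeneous (1 + (1 + n) * 2) := fun c d =>
    (isHomogeneous_X _ d).mul (((isHomogeneous_X _ c).mul hy).pow 2)
  have hodd' : Odd (2 * (1 + (1 + n) * 2) + 3) := odd_two_mul_add_three _
  have key := smodEq_of_add_add_add_mem h
    (lift_mem_hit c hodd' (lift_X_mul_sq_mem_hit c c d hodd hy) (lift_isHomogeneous c (hhom c d)))
    (lift_mem_hit d hodd' (lift_X_mul_sq_mem_hit d d c hodd hy) (lift_isHomogeneous d (hhom d c)))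
  have hyL : ∀ a, (lift a y).IsHomogeneous (2 * n + 3) := fun a => lift_isHomogeneous a hy
  have hL : ∀ a b, (lift a (lift b y)).IsHomogeneous (2 * (2 * n + 3) + 3) := fun a b =>
    lift_isHomogeneous a (hyL b)
  exact key.trans ((lift_smodEq b (odd_two_mul_add_three _) (hL b a) (hL a b)
    (lift_swap b a hodd hy)).trans (lift_swap b a (odd_two_mul_add_three n) (hyL b)))

/-- The composite of the operators `lift a` for `a` running through a list. -/
noncomputable def word : List (Fin 4) → Poly 4 →ₗ[ZMod 2] Poly 4
  | [] => LinearMap.id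
  | a :: w => lift a ∘ₗ word w

lemma word_nil (f : Poly 4) : word [] f = f := rfl

lemma word_cons (a : Fin 4) (w : List (Fin 4)) (f : Poly 4) :
    word (a :: w) f = lift a (word w f) := rfl

lemma word_append (v w : List (Fin 4)) (f : Poly 4) : word (v ++ w) f = word v (word w f) := by
  induction v with
  | nil => rfl
  | cons a v ih => rw [List.cons_append, word_cons, word_cons, ih]

/-- The degree of `word w f` for `w` of length `N` and `f` of degree `n`. -/
def wordDegree (n : ℕ) : ℕ → ℕ
  | 0 => n
  | N + 1 => 2 * wordDegree n N + 3

lemma wordDegree_odd {n : ℕ} (hn : Odd n) : ∀ N, Odd (wordDegree n N)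
  | 0 => hn
  | _ + 1 => odd_two_mul_add_three _

lemma wordDegree_one (N : ℕ) : wordDegree 1 N = 2 ^ (N + 2) - 3 := by
  suffices wordDegree 1 N + 3 = 2 ^ (N + 2) by omega
  induction N with
  | zero => rfl
  | succ N ih => rw [wordDegree, pow_succ, ← ih]; ring

lemma word_isHomogeneous (w : List (Fin 4)) {n : ℕ} {f : Poly 4} (hf : f.IsHomogeneous n) :
    (word w f).IsHomogeneous (wordDegree n w.length) := by
  induction w with
  | nil => exact hf
  | cons a w ih => exact lift_isHomogeneous a ih

lemma word_mem_hit (w : List (Fin 4)) {n : ℕ} (hodd : Odd n) {f : Poly 4}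
    (hf : f ∈ hitSubmodule 4) (hn : f.IsHomogeneous n) : word w f ∈ hitSubmodule 4 := by
  induction w with
  | nil => exact hf
  | cons a w ih => exact lift_mem_hit a (wordDegree_odd hodd _) ih (word_isHomogeneous w hn)

lemma word_cons_smodEq (a : Fin 4) {v w : List (Fin 4)} (hlen : v.length = w.length) {n : ℕ}
    (hodd : Odd n) {y : Poly 4} (hy : y.IsHomogeneous n)
    (h : word v y ≡ word w y [SMOD hitSubmodule 4]) :
    word (a :: v) y ≡ word (a :: w) y [SMOD hitSubmodule 4] :=
  lift_smodEq a (wordDegree_odd hodd v.length) (word_isHomogeneous v hy)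
    (hlen ▸ word_isHomogeneous w hy) h

lemma word_smodEq_of_perm {v w : List (Fin 4)} (h : v.Perm w) {n : ℕ} (hodd : Odd n) {y : Poly 4}
    (hy : y.IsHomogeneous n) : word v y ≡ word w y [SMOD hitSubmodule 4] := by
  induction h with
  | nil => rfl
  | cons a h ih => exact word_cons_smodEq a h.length_eq hodd hy ih
  | swap a b l => exact lift_swap b a (wordDegree_odd hodd _) (word_isHomogeneous l hy)
  | trans _ _ ih₁ ih₂ => exact ih₁.trans ih₂

lemma word_replicate_append_smodEq {a b : Fin 4} {u : List (Fin 4)} (ha : a ∈ u) (hb : b ∈ u)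
    (r : ℕ) {n : ℕ} (hodd : Odd n) {y : Poly 4} (hy : y.IsHomogeneous n) :
    word (List.replicate r a ++ u) y ≡ word (List.replicate r b ++ u) y
      [SMOD hitSubmodule 4] := by
  rcases eq_or_ne a b with rfl | hab
  · rfl
  obtain ⟨v, hv⟩ : ∃ v, u.Perm (a :: b :: v) :=
    ⟨(u.erase a).erase b, (List.perm_cons_erase ha).trans
      ((List.perm_cons_erase ((List.mem_erase_of_ne hab.symm).2 hb)).cons a)⟩
  have hperm : ∀ r, (List.replicate r b ++ u).Perm (a :: b :: (List.replicate r b ++ v)) :=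
    fun r => by
      refine (hv.append_left _).trans ?_
      exact List.perm_middle.trans (List.perm_middle.cons a)
  induction r with
  | zero => rfl
  | succ r ih =>
    have h₁ := word_cons_smodEq a (by simp) hodd hy ih
    have h₂ := word_smodEq_of_perm ((hperm r).cons a) hodd hy
    have h₃ := lift_lift_lift_smodEq a b (wordDegree_odd hodd _)
      (word_isHomogeneous (List.replicate r b ++ v) hy)
    have h₄ := word_smodEq_of_perm (hperm (r + 1)).symm hodd hy
    exact h₁.trans (h₂.trans (h₃.trans h₄))

lemma exists_word_smodEq_dedup (w : List (Fin 4)) {m : Fin 4} (hm : m ∈ w) {n : ℕ} (hodd : Odd n)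
    {y : Poly 4} (hy : y.IsHomogeneous n) : ∃ r, r + w.dedup.length = w.length ∧
      word w y ≡ word (List.replicate r m ++ w.dedup) y [SMOD hitSubmodule 4] := by
  induction w generalizing m with
  | nil => simp at hm
  | cons a w ih =>
    by_cases ha : a ∈ w
    · obtain ⟨r, hr, h⟩ := ih ha
      have hm' : m ∈ w.dedup := by
        rw [List.mem_dedup]
        exact (List.mem_cons.1 hm).elim (fun h => h ▸ ha) id
      rw [List.dedup_cons_of_mem ha]
      refine ⟨r + 1, by rw [List.length_cons, ← hr]; ring, ?_⟩
      exact (word_cons_smodEq a (by simp [hr]) hodd hy h).trans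
        (word_replicate_append_smodEq (List.mem_dedup.2 ha) hm' (r + 1) hodd hy)
    · rw [List.dedup_cons_of_notMem ha]
      rcases w with _ | ⟨c, w⟩
      · exact ⟨0, rfl, rfl⟩
      · obtain ⟨r, hr, h⟩ := ih (List.mem_cons_self (a := c))
        refine ⟨r, by rw [List.length_cons, List.length_cons, ← hr]; ring, ?_⟩
        have hmem : ∀ x ∈ a :: c :: w, x ∈ a :: (c :: w).dedup := fun x hx => by
          rw [List.mem_cons, List.mem_dedup]; exact List.mem_cons.1 hx
        exact ((word_cons_smodEq a (by simp [hr]) hodd hy h).trans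
          (word_smodEq_of_perm List.perm_middle.symm hodd hy)).trans
          (word_replicate_append_smodEq (hmem c (by simp)) (hmem m hm) r hodd hy)

/-- Modulo hit polynomials, `word w y` depends only on the length and the set of letters
of `w`. -/
lemma word_smodEq_of_toFinset_eq {v w : List (Fin 4)} (hlen : v.length = w.length)
    (hset : v.toFinset = w.toFinset) {n : ℕ} (hodd : Odd n) {y : Poly 4}
    (hy : y.IsHomogeneous n) : word v y ≡ word w y [SMOD hitSubmodule 4] := by
  rcases v with _ | ⟨m, v⟩
  · rw [List.length_eq_zero_iff.1 hlen.symm]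
  · have hmw : m ∈ w := by rw [← List.mem_toFinset, ← hset]; simp
    have hperm := List.toFinset_eq_iff_perm_dedup.1 hset
    obtain ⟨r, hr, h⟩ := exists_word_smodEq_dedup (m :: v) List.mem_cons_self hodd hy
    obtain ⟨r', hr', h'⟩ := exists_word_smodEq_dedup w hmw hodd hy
    obtain rfl : r = r' := by have := hperm.length_eq; omega
    exact h.trans ((word_smodEq_of_perm (hperm.append_left _) hodd hy).trans h'.symm)

lemma word_replicate_X (a : Fin 4) (r : ℕ) :
    word (List.replicate r a) (X a) = X a * (∏ b, X b) ^ (2 ^ r - 1) := by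
  induction r with
  | zero => simp [word_nil]
  | succ r ih =>
    have h : 2 ^ (r + 1) - 1 = (2 ^ r - 1) * 2 + 1 := by
      have := Nat.one_le_two_pow (n := r)
      rw [pow_succ]; omega
    rw [List.replicate_succ, word_cons, ih, lift_apply, h, ← X_mul_coX a]
    generalize 2 ^ r - 1 = e
    ring

lemma sum_word_mem_hit (w : List (Fin 4)) (r : ℕ) :
    ∑ a, word (w ++ List.replicate (r + 1) a) (X a) ∈ hitSubmodule 4 := by
  simp only [word_append]
  rw [← map_sum]
  refine word_mem_hit w (wordDegree_odd odd_one (r + 1)) ?_ (IsHomogeneous.sum _ _ _ fun a _ => ?_)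
  · simp only [List.replicate_succ, word_cons, word_replicate_X]
    exact sum_lift_X_mul_mem_hit _
  · simpa using word_isHomogeneous (List.replicate (r + 1) a) (isHomogeneous_X (ZMod 2) a)

/-- Pairs `(S, b)` indexing a basis of `QP_4` in degree `2 ^ (N + 2) - 3`. -/
def basisIndex (N : ℕ) : Finset (Finset (Fin 4) × Fin 4) :=
  {x | x.1.card ≤ N ∧ (x.1 = ∅ → N = 0) ∧ ¬ Finset.Iic x.2 ⊆ x.1}

/-- A word of length `N` with set of letters `S`. -/
noncomputable def letterWord (N : ℕ) (S : Finset (Fin 4)) : List (Fin 4) :=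
  List.replicate (N - S.card) (S.toList.headD 0) ++ S.toList

lemma length_letterWord {N : ℕ} {S : Finset (Fin 4)} (h : S.card ≤ N) :
    (letterWord N S).length = N := by
  simp [letterWord, h]

lemma toFinset_letterWord {N : ℕ} {S : Finset (Fin 4)} (h : S = ∅ → N = 0) :
    (letterWord N S).toFinset = S := by
  rcases S.eq_empty_or_nonempty with rfl | hS
  · simp [letterWord, h]
  · have hhead : S.toList.headD 0 ∈ S := by
      rw [← Finset.mem_toList]
      cases hl : S.toList with
      | nil => exact absurd (Finset.toList_eq_nil.1 hl) hS.ne_empty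
      | cons a l => simp
    ext x
    simp only [letterWord, List.toFinset_append, Finset.toList_toFinset, Finset.mem_union,
      List.mem_toFinset, List.mem_replicate, or_iff_right_iff_imp]
    rintro ⟨-, rfl⟩
    exact hhead

/-- The basis of `QP_4` in degree `2 ^ (N + 2) - 3`, as polynomials. -/
noncomputable def basisElt (N : ℕ) (x : Finset (Fin 4) × Fin 4) : Poly 4 :=
  word (letterWord N x.1) (X x.2)

/-- The polynomials congruent to a combination of basis elements modulo hit polynomials. -/
noncomputable def reducible (N : ℕ) : Submodule (ZMod 2) (Poly 4) :=
  Submodule.span (ZMod 2) (basisElt N '' basisIndex N) ⊔ hitSubmodule 4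

lemma mem_of_smodEq {M M' : Submodule (ZMod 2) (Poly 4)} (hM : M ≤ M') {f g : Poly 4}
    (h : f ≡ g [SMOD M]) (hg : g ∈ M') : f ∈ M' := by
  simpa using add_mem (hM (SModEq.sub_mem.1 h)) hg

lemma word_mem_reducible_of_mem {w : List (Fin 4)} {b : Fin 4}
    (h : (w.toFinset, b) ∈ basisIndex w.length) : word w (X b) ∈ reducible w.length := by
  have h' := h
  simp only [basisIndex, Finset.mem_filter, Finset.mem_univ, true_and] at h'
  refine mem_of_smodEq le_sup_right (word_smodEq_of_toFinset_eq
    (length_letterWord h'.1).symm (toFinset_letterWord h'.2.1).symm odd_one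
    (isHomogeneous_X _ b)) ?_
  exact Submodule.mem_sup_left (Submodule.subset_span ⟨_, h, rfl⟩)

lemma word_mem_reducible (N : ℕ) (w : List (Fin 4)) (hw : w.length = N) (b : Fin 4) :
    word w (X b) ∈ reducible N := by
  induction hc : w.toFinset.card using Nat.strong_induction_on generalizing w b with
  | _ c ih =>
  subst hc
  by_cases hmem : (w.toFinset, b) ∈ basisIndex w.length
  · exact hw ▸ word_mem_reducible_of_mem hmem
  have hsub : Finset.Iic b ⊆ w.toFinset := by
    by_contra h
    refine hmem ?_
    simp only [basisIndex, Finset.mem_filter, Finset.mem_univ, true_and]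
    exact ⟨List.toFinset_card_le w, fun h0 => by simpa using h0, h⟩
  have hb : b ∈ w.toFinset := hsub (Finset.mem_Iic.2 le_rfl)
  set U := w.toFinset.erase b with hU
  have hUcard : U.card + 1 = w.toFinset.card := Finset.card_erase_add_one hb
  obtain ⟨r, hr⟩ : ∃ r, U.card + (r + 1) = N :=
    ⟨N - w.toFinset.card, by have := List.toFinset_card_le w; omega⟩
  have hlen : ∀ a, (U.toList ++ List.replicate (r + 1) a).length = N := fun a => by simp [hr]
  have hset : ∀ a, (U.toList ++ List.replicate (r + 1) a).toFinset = insert a U := fun a => by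
    rw [List.toFinset_append, Finset.toList_toFinset,
      List.toFinset_replicate_of_ne_zero r.succ_ne_zero, Finset.union_comm, Finset.insert_eq]
  refine mem_of_smodEq le_sup_right (word_smodEq_of_toFinset_eq (hw.trans (hlen b).symm)
    (by rw [hset, hU, Finset.insert_erase hb]) odd_one (isHomogeneous_X _ b)) ?_
  have hsum := sum_word_mem_hit U.toList r
  rw [← Finset.add_sum_erase _ _ (Finset.mem_univ b)] at hsum
  refine ((reducible N).add_mem_iff_left (sum_mem fun a ha => ?_)).1
    (Submodule.mem_sup_right hsum)
  have hab := Finset.ne_of_mem_erase ha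
  by_cases haU : a ∈ U
  · exact ih _ (by rw [hset, Finset.insert_eq_of_mem haU]; omega) _ (hlen a) a rfl
  · have haw : a ∉ w.toFinset := fun h => haU (Finset.mem_erase.2 ⟨hab, h⟩)
    have hba : b ≤ a := (not_le.1 fun h => haw (hsub (Finset.mem_Iic.2 h))).le
    rw [← hlen a]
    refine word_mem_reducible_of_mem ?_
    simp only [basisIndex, Finset.mem_filter, Finset.mem_univ, true_and]
    refine ⟨List.toFinset_card_le _, fun h0 => by simp at h0, fun h => ?_⟩
    have hb' := h (Finset.mem_Iic.2 hba)
    rw [hset, Finset.mem_insert] at hb'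
    exact hb'.elim (fun h => hab h.symm) (by simp [hU])

lemma monomial_eq_prod_mul_sq (m : Fin 4 →₀ ℕ) : ∃ h : Fin 4 →₀ ℕ,
    m.degree = ({j | Odd (m j)} : Finset (Fin 4)).card + 2 * h.degree ∧
    (monomial m 1 : Poly 4) = (∏ j with Odd (m j), X j) * monomial h 1 ^ 2 := by
  refine ⟨Finsupp.equivFunOnFinite.symm fun j => m j / 2, ?_, ?_⟩
  · rw [Finset.card_filter, Finsupp.degree_eq_sum, Finsupp.degree_eq_sum, Finset.mul_sum,
      ← Finset.sum_add_distrib]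
    refine Finset.sum_congr rfl fun j _ => ?_
    simp only [Finsupp.coe_equivFunOnFinite_symm, Nat.odd_iff]
    split_ifs <;> omega
  · rw [monomial_eq, monomial_eq, Finsupp.prod_fintype _ _ (by simp),
      Finsupp.prod_fintype _ _ (by simp), Finset.prod_filter, map_one, one_mul, one_mul,
      ← Finset.prod_pow, ← Finset.prod_mul_distrib]
    refine Finset.prod_congr rfl fun j _ => ?_
    simp only [Finsupp.coe_equivFunOnFinite_symm]
    rw [← pow_mul]
    split_ifs with h
    · rw [← pow_succ', Nat.odd_iff] at *
      congr 1; omega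
    · rw [Nat.not_odd_iff] at h
      rw [one_mul]; congr 1; omega

lemma eq_singleton_or_eq_erase_of_odd_card (O : Finset (Fin 4)) (hO : Odd O.card) :
    (∃ a, O = {a}) ∨ ∃ a, O = Finset.univ.erase a := by
  revert O
  decide

/-- The span of the monomials `word w (X b)` with `w` of length `N`. -/
noncomputable def wordSpan (N : ℕ) : Submodule (ZMod 2) (Poly 4) :=
  Submodule.span (ZMod 2) {f | ∃ w b, w.length = N ∧ f = word w (X b)}

lemma isHomogeneous_of_mem_wordSpan {N : ℕ} {f : Poly 4} (hf : f ∈ wordSpan N) :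
    f.IsHomogeneous (wordDegree 1 N) := by
  rw [← mem_homogeneousSubmodule]
  refine Submodule.span_le.2 ?_ hf
  rintro _ ⟨w, b, rfl, rfl⟩
  exact word_isHomogeneous w (isHomogeneous_X _ b)

lemma lift_mem_wordSpan (a : Fin 4) {N : ℕ} {f : Poly 4} (hf : f ∈ wordSpan N) :
    lift a f ∈ wordSpan (N + 1) := by
  refine (Submodule.span_le.2 ?_ : wordSpan N ≤ (wordSpan (N + 1)).comap (lift a)) hf
  rintro _ ⟨w, b, rfl, rfl⟩
  exact Submodule.subset_span ⟨a :: w, b, rfl, rfl⟩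

lemma mem_of_forall_monomial_mem {M : Submodule (ZMod 2) (Poly 4)} {n : ℕ}
    (h : ∀ m : Fin 4 →₀ ℕ, m.degree = n → monomial m 1 ∈ M) {f : Poly 4}
    (hf : f.IsHomogeneous n) : f ∈ M := by
  rw [f.as_sum]
  refine sum_mem fun m hm => ?_
  rw [show monomial m (coeff m f) = coeff m f • (monomial m 1 : Poly 4) by simp [smul_monomial]]
  refine M.smul_mem _ (h m ?_)
  rw [← hf (mem_support_iff.1 hm)]
  simp [Finsupp.weight_apply, Finsupp.degree_eq_sum, Finsupp.sum_fintype]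

lemma mem_wordSpan_sup_hit (N : ℕ) {f : Poly 4} (hf : f.IsHomogeneous (wordDegree 1 N)) :
    f ∈ wordSpan N ⊔ hitSubmodule 4 := by
  induction N generalizing f with
  | zero =>
    refine Submodule.mem_sup_left (mem_of_forall_monomial_mem (fun m hm => ?_) hf)
    obtain ⟨b, rfl⟩ := (Finsupp.sum_eq_one_iff m).1 hm
    exact Submodule.subset_span ⟨[], b, rfl, rfl⟩
  | succ N ih =>
    refine mem_of_forall_monomial_mem (fun m hm => ?_) hf
    obtain ⟨h, hdeg, hmon⟩ := monomial_eq_prod_mul_sq m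
    obtain ⟨e, he⟩ := wordDegree_odd odd_one N
    rw [hm, wordDegree] at hdeg
    have hO : Odd ({j | Odd (m j)} : Finset (Fin 4)).card := by
      rw [Nat.odd_iff]; omega
    have hh : (monomial h (1 : ZMod 2)).IsHomogeneous h.degree := isHomogeneous_monomial _ rfl
    rcases eq_singleton_or_eq_erase_of_odd_card _ hO with ⟨a, ha⟩ | ⟨a, ha⟩
    · rw [ha, Finset.card_singleton] at hdeg
      rw [hmon, ha, Finset.prod_singleton]
      exact Submodule.mem_sup_right
        (X_mul_sq_mem_hit a (Nat.even_iff.2 (by omega)) (by omega) hh)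
    · rw [ha, Finset.card_erase_of_mem (Finset.mem_univ a), Finset.card_univ,
        Fintype.card_fin] at hdeg
      rw [hmon, ha]
      have hh' : (monomial h (1 : ZMod 2)).IsHomogeneous (wordDegree 1 N) := by
        rwa [show h.degree = wordDegree 1 N by omega] at hh
      obtain ⟨u, hu, v, hv, huv⟩ := Submodule.mem_sup.1 (ih hh')
      have hvhom : v.IsHomogeneous (wordDegree 1 N) := by
        rw [eq_sub_of_add_eq' huv]
        exact hh'.sub (isHomogeneous_of_mem_wordSpan hu)
      change lift a (monomial h 1) ∈ _
      rw [← huv, map_add]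
      exact Submodule.add_mem_sup (lift_mem_wordSpan a hu)
        (lift_mem_hit a (wordDegree_odd odd_one N) hv hvhom)

lemma mem_reducible {N : ℕ} {f : Poly 4} (hf : f.IsHomogeneous (wordDegree 1 N)) :
    f ∈ reducible N := by
  refine (sup_le (Submodule.span_le.2 ?_) le_sup_right : _ ≤ reducible N)
    (mem_wordSpan_sup_hit N hf)
  rintro _ ⟨w, b, hw, rfl⟩
  exact word_mem_reducible N w hw b

section Functionals

/-- The substitution of `∑_{a ≠ p} c a * x_a` for the variable `x_p`. -/
noncomputable def substLinear (p : Fin 4) (c : Fin 4 → ZMod 2) : Poly 4 →ₐ[ZMod 2] Poly 4 :=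
  aeval fun b => if b = p then ∑ a ∈ Finset.univ.erase p, c a • X a else X b

lemma substLinear_X_self (p : Fin 4) (c : Fin 4 → ZMod 2) :
    substLinear p c (X p) = ∑ a ∈ Finset.univ.erase p, c a • X a := by
  simp [substLinear]

lemma substLinear_X_of_ne {p b : Fin 4} (h : b ≠ p) (c : Fin 4 → ZMod 2) :
    substLinear p c (X b) = X b := by
  simp [substLinear, h]

lemma sqSeries_linear {k : ℕ} (s : Finset (Fin k)) (c : Fin k → ZMod 2) :
    sqSeries k (∑ a ∈ s, c a • X a) = Polynomial.C (∑ a ∈ s, c a • X a) +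
      Polynomial.X * Polynomial.C ((∑ a ∈ s, c a • X a) ^ 2) := by
  rw [sum_pow_char 2]
  simp only [map_sum, map_smul, sqSeries_X, Finset.mul_sum, ← Finset.sum_add_distrib, smul_pow,
    ZMod.pow_card]
  refine Finset.sum_congr rfl fun a _ => ?_
  rw [← Polynomial.smul_C, ← Polynomial.smul_C, smul_add, mul_smul_comm]

lemma sqSeries_substLinear (p : Fin 4) (c : Fin 4 → ZMod 2) (f : Poly 4) :
    sqSeries 4 (substLinear p c f) =
      (sqSeries 4 f).map (substLinear p c : Poly 4 →+* Poly 4) := by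
  have : (sqSeries 4).comp (substLinear p c) =
      (Polynomial.mapAlgHom (substLinear p c)).comp (sqSeries 4) := by
    ext1 b
    rcases eq_or_ne b p with rfl | hb
    · simp only [AlgHom.comp_apply, substLinear_X_self, sqSeries_X, sqSeries_linear,
        Polynomial.coe_mapAlgHom, Polynomial.map_add, Polynomial.map_mul, Polynomial.map_C,
        Polynomial.map_X, RingHom.coe_coe, Polynomial.map_pow, map_pow]
    · simp only [AlgHom.comp_apply, substLinear_X_of_ne hb, sqSeries_X,
        Polynomial.coe_mapAlgHom, Polynomial.map_add, Polynomial.map_mul, Polynomial.map_C,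
        Polynomial.map_X, RingHom.coe_coe, Polynomial.map_pow, map_pow]
  simpa using DFunLike.congr_fun this f

lemma substLinear_sq (p : Fin 4) (c : Fin 4 → ZMod 2) (i : ℕ) (f : Poly 4) :
    substLinear p c (sq 4 i f) = sq 4 i (substLinear p c f) := by
  rw [sq_apply, sq_apply, sqSeries_substLinear, Polynomial.coeff_map, RingHom.coe_coe]

lemma even_choose_of_add_eq (r : ℕ) {m n : ℕ} (h : m + n = 2 ^ r - 1) (hn : 0 < n) :
    Even (m.choose n) := by
  induction r generalizing m n with
  | zero => simp at h; omega
  | succ r ih =>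
    have h2 := Nat.one_le_two_pow (n := r)
    rw [pow_succ] at h
    have hp : Fact (Nat.Prime 2) := ⟨Nat.prime_two⟩
    have hl : m.choose n ≡ _ [MOD 2] := Choose.choose_modEq_choose_mod_mul_choose_div_nat
    rw [Nat.even_iff, hl, ← Nat.even_iff]
    rcases Nat.mod_two_eq_zero_or_one n with h0 | h1
    · exact (ih (m := m / 2) (n := n / 2) (by omega) (by omega)).mul_left _
    · rw [h1, show m % 2 = 0 by omega]
      simp

/-- A monomial all of whose exponents have the form `2 ^ r - 1` does not occur in any
`Sq^i g` with `i > 0`. -/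
lemma coeff_sq_eq_zero {k : ℕ} {d : Fin k →₀ ℕ} (hd : ∀ j, ∃ r, d j = 2 ^ r - 1) {i : ℕ}
    (hi : 0 < i) (g : Poly k) : coeff d (sq k i g) = 0 := by
  induction g using MvPolynomial.induction_on' with
  | add f g hf hg => rw [map_add, coeff_add, hf, hg, add_zero]
  | monomial m u =>
    rw [show monomial m u = u • (monomial m 1 : Poly k) by simp [smul_monomial], map_smul,
      coeff_smul, sq_apply, sqSeries_monomial, Polynomial.finsetSum_coeff, coeff_sum,
      Finset.sum_eq_zero, smul_zero]
    intro p _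
    rw [Polynomial.coeff_monomial]
    split_ifs with hp
    · rw [coeff_monomial]
      split_ifs with hmp
      · obtain ⟨j, hj⟩ : ∃ j, 0 < p j := by
          by_contra! h
          simp [Nat.le_zero.1 (h _)] at hp
          omega
        obtain ⟨r, hr⟩ := hd j
        refine Finset.prod_eq_zero (Finset.mem_univ j) ?_
        rw [ZMod.natCast_eq_zero_iff, ← even_iff_two_dvd]
        exact even_choose_of_add_eq r (by rw [← hr, ← hmp]; simp) hj
      · rfl
    · simp

lemma coeff_monomial_mul_sq {k : ℕ} (s m : Fin k →₀ ℕ) (g : Poly k) :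
    coeff (s + 2 • m) (monomial s 1 * g ^ 2) = coeff m g := by
  rw [coeff_monomial_mul, one_mul, ← expand_zmod, coeff_expand_smul _ two_ne_zero]

lemma coeff_monomial_mul_sq_eq_zero {k : ℕ} {s m : Fin k →₀ ℕ} {i : Fin k}
    (h : m i % 2 ≠ s i % 2) (u : ZMod 2) (g : Poly k) :
    coeff m (monomial s u * g ^ 2) = 0 := by
  rw [coeff_monomial_mul']
  split_ifs with hle
  · rw [← expand_zmod, coeff_expand_of_not_dvd (i := i), mul_zero]
    have := hle i
    rw [Finsupp.tsub_apply]
    omega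
  · rfl

/-- The exponent of `∏_{b ≠ p} x_b`. -/
noncomputable def coExponent (p : Fin 4) : Fin 4 →₀ ℕ :=
  ∑ b ∈ Finset.univ.erase p, Finsupp.single b 1

lemma coExponent_apply (p b : Fin 4) : coExponent p b = if b = p then 0 else 1 := by
  simp [coExponent, Finsupp.finsetSum_apply, Finsupp.single_apply]

lemma prod_X_eq_monomial (s : Finset (Fin 4)) :
    (∏ b ∈ s, X b : Poly 4) = monomial (∑ b ∈ s, Finsupp.single b 1) 1 := by
  rw [monomial_sum_one]; rfl

lemma coX_eq_monomial (p : Fin 4) : coX p = monomial (coExponent p) 1 :=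
  prod_X_eq_monomial _

/-- The exponent equal to `0` at `p`, to `2 ^ (N + 1) - 1` at `j`, and to `2 ^ N - 1`
elsewhere. -/
noncomputable def spike (p j : Fin 4) : ℕ → Fin 4 →₀ ℕ
  | 0 => Finsupp.single j 1
  | N + 1 => coExponent p + 2 • spike p j N

lemma spike_self {p j : Fin 4} (h : j ≠ p) (N : ℕ) : spike p j N p = 0 := by
  induction N with
  | zero => simp [spike, h]
  | succ N ih => simp [spike, coExponent_apply, ih]

lemma exists_spike_eq {p j : Fin 4} (h : j ≠ p) (N : ℕ) (a : Fin 4) :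
    ∃ r, spike p j N a = 2 ^ r - 1 := by
  rcases eq_or_ne a p with rfl | ha
  · exact ⟨0, spike_self h N⟩
  induction N with
  | zero =>
    rcases eq_or_ne j a with rfl | hj
    · exact ⟨1, by simp [spike]⟩
    · exact ⟨0, by simp [spike, hj]⟩
  | succ N ih =>
    obtain ⟨r, hr⟩ := ih
    refine ⟨r + 1, ?_⟩
    have := Nat.one_le_two_pow (n := r)
    simp only [spike, Finsupp.add_apply, Finsupp.smul_apply, coExponent_apply, if_neg ha, hr,
      smul_eq_mul]
    omega

lemma coeff_spike_of_mem_hit {p j : Fin 4} (h : j ≠ p) (N : ℕ) (c : Fin 4 → ZMod 2) {f : Poly 4}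
    (hf : f ∈ hitSubmodule 4) : coeff (spike p j N) (substLinear p c f) = 0 := by
  refine (Submodule.span_le.2 ?_ : hitSubmodule 4 ≤
    ((lcoeff (ZMod 2) (spike p j N)) ∘ₗ (substLinear p c).toLinearMap).ker) hf
  rintro _ ⟨i, g, hi, rfl⟩
  change coeff _ (substLinear p c _) = 0
  rw [SqOp_eq_sq, substLinear_sq]
  exact coeff_sq_eq_zero (exists_spike_eq h N) hi _

lemma substLinear_coX {p a : Fin 4} (ha : a ≠ p) (c : Fin 4 → ZMod 2) :
    substLinear p c (coX a) = c a • coX p + ∑ e ∈ (Finset.univ.erase p).erase a,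
      c e • (X e * ∏ b ∈ (Finset.univ.erase p).erase a, X b) := by
  have hmem : a ∈ Finset.univ.erase p := by simp [ha]
  have hprod : ∏ b ∈ (Finset.univ.erase p).erase a, substLinear p c (X b) =
      ∏ b ∈ (Finset.univ.erase p).erase a, X b :=
    Finset.prod_congr rfl fun b hb => substLinear_X_of_ne
      (Finset.ne_of_mem_erase (Finset.mem_of_mem_erase hb)) c
  rw [coX, map_prod, ← Finset.mul_prod_erase _ _ (show p ∈ Finset.univ.erase a by simp [ha.symm]),
    Finset.erase_right_comm, hprod, substLinear_X_self, ← Finset.add_sum_erase _ _ hmem, add_mul,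
    Finset.sum_mul, smul_mul_assoc, Finset.mul_prod_erase _ _ hmem, coX]
  simp only [smul_mul_assoc]

lemma coeff_spike_lift {p : Fin 4} (j : Fin 4) {c : Fin 4 → ZMod 2} (hc : c p = 1)
    (N : ℕ) (a : Fin 4) (g : Poly 4) :
    coeff (spike p j (N + 1)) (substLinear p c (lift a g)) =
      c a * coeff (spike p j N) (substLinear p c g) := by
  rw [lift_apply, map_mul, map_pow]
  rcases eq_or_ne a p with rfl | ha
  · have : substLinear a c (coX a) = coX a := by
      rw [coX, map_prod]
      exact Finset.prod_congr rfl fun b hb => substLinear_X_of_ne (Finset.ne_of_mem_erase hb) c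
    rw [this, coX_eq_monomial, hc, one_mul, spike, coeff_monomial_mul_sq]
  · rw [substLinear_coX ha, add_mul, coeff_add, smul_mul_assoc, coeff_smul, coX_eq_monomial, spike,
      coeff_monomial_mul_sq, Finset.sum_mul, coeff_sum, Finset.sum_eq_zero, add_zero, smul_eq_mul]
    intro e he
    rw [smul_mul_assoc, coeff_smul, prod_X_eq_monomial, X, monomial_mul,
      coeff_monomial_mul_sq_eq_zero (i := a), smul_zero]
    have hea := Finset.ne_of_mem_erase he
    simp [coExponent_apply, ha, Finsupp.single_apply, hea]

lemma coeff_spike_word {p j : Fin 4} (hj : j ≠ p) {c : Fin 4 → ZMod 2} (hc : c p = 1)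
    (w : List (Fin 4)) (b : Fin 4) :
    coeff (spike p j w.length) (substLinear p c (word w (X b))) =
      (w.map c).prod * if b = p then c j else if b = j then 1 else 0 := by
  induction w with
  | nil =>
    rw [word_nil]
    split_ifs with hb hbj
    · subst hb
      simp [substLinear_X_self, spike, coeff_sum, coeff_X, Finsupp.single_left_inj]
      exact fun h => absurd h.symm hj
    · subst hbj; simp [substLinear_X_of_ne hb, spike]
    · simp [substLinear_X_of_ne hb, spike, coeff_X, Finsupp.single_left_inj, hbj]
  | cons a w ih => rw [word_cons, List.length_cons, coeff_spike_lift j hc, ih]; simp [mul_assoc]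

lemma coeff_spike_basisElt {p j : Fin 4} (hj : j ≠ p) {C : Finset (Fin 4)} (hp : p ∈ C) {N : ℕ}
    {x : Finset (Fin 4) × Fin 4} (hx : x ∈ basisIndex N) :
    coeff (spike p j N) (substLinear p (fun a => if a ∈ C then 1 else 0) (basisElt N x)) =
      if x.1 ⊆ C then (if x.2 = j then 1 else 0) + (if x.2 = p ∧ j ∈ C then 1 else 0) else 0 := by
  simp only [basisIndex, Finset.mem_filter, Finset.mem_univ, true_and] at hx
  have h := coeff_spike_word hj (c := fun a => if a ∈ C then 1 else 0) (by simp [hp])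
    (letterWord N x.1) x.2
  rw [length_letterWord hx.1] at h
  rw [basisElt, h]
  have hprod : ((letterWord N x.1).map fun a => if a ∈ C then (1 : ZMod 2) else 0).prod =
      if x.1 ⊆ C then 1 else 0 := by
    have hset := toFinset_letterWord hx.2.1
    split_ifs with hC
    · refine List.prod_eq_one fun u hu => ?_
      obtain ⟨a, ha, rfl⟩ := List.mem_map.1 hu
      rw [if_pos (hC (hset ▸ List.mem_toFinset.2 ha))]
    · obtain ⟨a, ha, haC⟩ := Finset.not_subset.1 hC
      rw [← hset, List.mem_toFinset] at ha
      exact List.prod_eq_zero (List.mem_map.2 ⟨a, ha, if_neg haC⟩)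
  rw [hprod]
  rcases eq_or_ne x.2 p with hb | hb
  · simp [hb, hj.symm, ← ite_and, and_comm]
  · simp [hb, ← ite_and, and_comm]

end Functionals

section LinearIndependence

lemma sum_powerset_sdiff_eq_zero {l : Finset (Fin 4) → ZMod 2} {T : Finset (Fin 4)}
    (hl : ∀ S, T ⊆ S → l S = 0) (U : Finset (Fin 4)) :
    ∑ D ∈ T.powerset, ∑ S ∈ (U \ D).powerset, l S = 0 := by
  rw [Finset.sum_comm' (t' := U.powerset) (s' := fun S => (T \ S).powerset)]
  · refine Finset.sum_eq_zero fun S _ => ?_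
    rw [Finset.sum_const, Finset.card_powerset]
    by_cases hS : T ⊆ S
    · rw [hl S hS, smul_zero]
    · obtain ⟨n, hn⟩ := Nat.exists_eq_succ_of_ne_zero
        (Finset.card_ne_zero.2 (Finset.sdiff_nonempty.2 hS))
      rw [hn, pow_succ, mul_smul, two_nsmul, CharTwo.add_self_eq_zero, smul_zero]
  · intro D S
    simp only [Finset.mem_powerset, Finset.subset_sdiff]
    constructor
    · rintro ⟨h1, h2, h3⟩; exact ⟨⟨h1, h3.symm⟩, h2⟩
    · rintro ⟨⟨h1, h3⟩, h2⟩; exact ⟨h1, h2, h3.symm⟩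

lemma eq_zero_of_sum_powerset_eq_zero {l : Finset (Fin 4) → ZMod 2}
    (h : ∀ C : Finset (Fin 4), ∑ S ∈ C.powerset, l S = 0) (S : Finset (Fin 4)) : l S = 0 := by
  induction S using Finset.strongInduction with
  | H S ih =>
    rw [← h S]
    refine (Finset.sum_eq_single S (fun D hD hne => ih D ?_) (by simp)).symm
    exact (Finset.mem_powerset.1 hD).ssubset_of_ne hne

lemma coefficients_eq_zero {l : Finset (Fin 4) → Fin 4 → ZMod 2}
    (hrel : ∀ C : Finset (Fin 4), ∀ p ∈ C, ∀ j ≠ p, ∑ S ∈ C.powerset, l S j +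
      (if j ∈ C then ∑ S ∈ C.powerset, l S p else 0) = 0)
    (hIic : ∀ S b, Finset.Iic b ⊆ S → l S b = 0) (hempty : ∀ b, l ∅ b = 0)
    (S : Finset (Fin 4)) (b : Fin 4) : l S b = 0 := by
  refine eq_zero_of_sum_powerset_eq_zero (l := fun S => l S b) (fun C => ?_) S
  have hnotMem : ∀ (b : Fin 4) (C : Finset (Fin 4)), b ∉ C → ∑ S ∈ C.powerset, l S b = 0 := by
    intro b C hb
    rcases C.eq_empty_or_nonempty with rfl | ⟨p, hp⟩
    · simp [hempty]
    · simpa [hb] using hrel C p hp b fun h => hb (h ▸ hp)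
  have hmem : ∀ (a b : Fin 4) (C : Finset (Fin 4)), a ∈ C → b ∈ C → a ≠ b →
      ∑ S ∈ C.powerset, l S b = ∑ S ∈ C.powerset, l S a := by
    intro a b C ha hb hab
    have := hrel C a ha b hab.symm
    rwa [if_pos hb, CharTwo.add_eq_zero] at this
  induction b using Fin.strong_induction_on generalizing C with
  | _ b ih =>
    by_cases hb : b ∈ C
    swap
    · exact hnotMem b C hb
    by_cases hlt : ∃ a < b, a ∈ C
    · obtain ⟨a, hab, ha⟩ := hlt
      rw [hmem a b C ha hb hab.ne, ih a hab]
    push Not at hlt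
    have hsum := sum_powerset_sdiff_eq_zero (l := fun S => l S b) (fun S => hIic S b)
      (C ∪ Finset.Iic b)
    have hC : (C ∪ Finset.Iic b) \ Finset.Iio b = C := by
      ext x
      simp only [Finset.mem_sdiff, Finset.mem_union, Finset.mem_Iic, Finset.mem_Iio, not_lt]
      constructor
      · rintro ⟨hx | hx, hbx⟩
        · exact hx
        · exact le_antisymm hx hbx ▸ hb
      · exact fun hx => ⟨Or.inl hx, not_lt.1 fun h => hlt x h hx⟩
    rw [Finset.sum_eq_single (Finset.Iio b), hC] at hsum
    · exact hsum
    · intro D hD hne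
      rw [Finset.mem_powerset] at hD
      by_cases hbD : b ∈ D
      · exact hnotMem b _ (by simp [hbD])
      · obtain ⟨a, ha, haD⟩ : ∃ a ∈ Finset.Iio b, a ∉ D := by
          by_contra! h
          refine hne (Finset.Subset.antisymm (fun x hx => ?_) h)
          exact Finset.mem_Iio.2 (lt_of_le_of_ne (Finset.mem_Iic.1 (hD hx)) fun e => hbD (e ▸ hx))
        rw [Finset.mem_Iio] at ha
        rw [hmem a b _ (by simp [ha.le, haD]) (by simp [hbD]) ha.ne, ih a ha]
    · simp [Finset.Iio_subset_Iic_self]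

lemma sum_coefficients_eq_zero {N : ℕ} {g : Finset (Fin 4) × Fin 4 → ZMod 2}
    (hg : ∑ x ∈ basisIndex N, g x • basisElt N x ∈ hitSubmodule 4) {C : Finset (Fin 4)}
    {p j : Fin 4} (hp : p ∈ C) (hj : j ≠ p) :
    ∑ S ∈ C.powerset, (if (S, j) ∈ basisIndex N then g (S, j) else 0) +
      (if j ∈ C then ∑ S ∈ C.powerset, (if (S, p) ∈ basisIndex N then g (S, p) else 0)
        else 0) = 0 := by
  have h := coeff_spike_of_mem_hit hj N (fun a => if a ∈ C then 1 else 0) hg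
  simp only [map_sum, map_smul, coeff_sum, coeff_smul, smul_eq_mul] at h
  rw [Finset.sum_congr rfl fun x hx => by rw [coeff_spike_basisElt hj hp hx],
    ← Finset.univ_inter (basisIndex N), ← Finset.sum_ite_mem, Fintype.sum_prod_type] at h
  have hpow : C.powerset = Finset.univ.filter (· ⊆ C) := by ext; simp
  refine Eq.trans ?_ h
  simp only [hpow, Finset.sum_filter, ← ite_zero_mul]
  by_cases hjC : j ∈ C
  · rw [if_pos hjC, ← Finset.sum_add_distrib]
    refine Finset.sum_congr rfl fun S _ => ?_
    by_cases hS : S ⊆ C <;> simp [hS, hjC, mul_add, Finset.sum_add_distrib]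
  · rw [if_neg hjC, add_zero]
    refine Finset.sum_congr rfl fun S _ => ?_
    by_cases hS : S ⊆ C <;> simp [hS, hjC]

lemma linearIndepOn_basisElt (N : ℕ) :
    LinearIndepOn (ZMod 2) ((hitSubmodule 4).mkQ ∘ basisElt N) (basisIndex N) := by
  rw [linearIndepOn_finset_iff]
  intro g hg x hx
  have hg' : ∑ x ∈ basisIndex N, g x • basisElt N x ∈ hitSubmodule 4 := by
    rw [← (hitSubmodule 4).ker_mkQ, LinearMap.mem_ker, map_sum]
    simpa using hg
  have hrel := fun (C : Finset (Fin 4)) p (hp : p ∈ C) j (hj : j ≠ p) =>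
    sum_coefficients_eq_zero hg' hp hj
  have key := coefficients_eq_zero
    (l := fun S b => if (S, b) ∈ basisIndex N then g (S, b) else 0) hrel
    (fun S b h => by simp [basisIndex, h]) (fun b => ?_) x.1 x.2
  · simpa [hx] using key
  · rcases Nat.eq_zero_or_pos N with rfl | hN
    · obtain ⟨p, hp⟩ := exists_ne b
      have := hrel {p} p (Finset.mem_singleton_self p) b hp.symm
      rw [if_neg (by simpa using hp.symm), add_zero, Finset.sum_eq_single ∅] at this
      · exact this
      · intro S _ hS
        simp [basisIndex, hS]
      · simp
    · simp [basisIndex, hN.ne']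

end LinearIndependence

lemma finrank_QP (N : ℕ) :
    Module.finrank (ZMod 2) (QP 4 (wordDegree 1 N)) = (basisIndex N).card := by
  have hker : ((hitSubmodule 4).mkQ ∘ₗ
      (homogeneousSubmodule (Fin 4) (ZMod 2) (wordDegree 1 N)).subtype).ker =
      (hitSubmodule 4).comap
        (homogeneousSubmodule (Fin 4) (ZMod 2) (wordDegree 1 N)).subtype := by
    rw [LinearMap.ker_comp, Submodule.ker_mkQ]
  have hrange : ((hitSubmodule 4).mkQ ∘ₗ
      (homogeneousSubmodule (Fin 4) (ZMod 2) (wordDegree 1 N)).subtype).range =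
      Submodule.span (ZMod 2) ((hitSubmodule 4).mkQ ∘ basisElt N '' basisIndex N) := by
    rw [LinearMap.range_comp, Submodule.range_subtype, Set.image_comp, ← Submodule.map_span]
    apply le_antisymm
    · rintro _ ⟨f, hf, rfl⟩
      obtain ⟨u, hu, v, hv, rfl⟩ := Submodule.mem_sup.1 (mem_reducible hf)
      refine ⟨u, hu, ?_⟩
      rw [map_add, Submodule.mkQ_apply _ v, (Submodule.Quotient.mk_eq_zero _).2 hv, add_zero]
    · refine Submodule.map_mono (Submodule.span_le.2 ?_)
      rintro _ ⟨x, hx, rfl⟩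
      have hcard : x.1.card ≤ N := by
        simp only [basisIndex, Finset.coe_filter, Set.mem_ofPred_eq] at hx
        exact hx.2.1
      have h := word_isHomogeneous (letterWord N x.1) (isHomogeneous_X (ZMod 2) x.2)
      rwa [length_letterWord hcard] at h
  rw [(Submodule.quotEquivOfEq _ _ hker.symm).finrank_eq, (LinearMap.quotKerEquivRange _).finrank_eq,
    hrange, Set.image_eq_range, finrank_span_eq_card (linearIndepOn_basisElt N)]
  simp

lemma basisIndex_eq_of_three_le {N : ℕ} (hN : 3 ≤ N) : basisIndex N = basisIndex 3 := by
  refine Finset.filter_congr fun x _ => ?_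
  have hcard : ¬ Finset.Iic x.2 ⊆ x.1 → x.1.card ≤ 3 := by
    rcases x with ⟨S, b⟩
    intro h
    have hne : S ≠ Finset.univ := fun e => h (e ▸ Finset.subset_univ _)
    have : S.card < 4 := Finset.card_lt_iff_ne_univ S |>.2 hne
    exact Nat.le_of_lt_succ this
  constructor
  · rintro ⟨-, h2, h3⟩
    exact ⟨hcard h3, fun e => absurd (h2 e) (by omega), h3⟩
  · rintro ⟨-, h2, h3⟩
    exact ⟨(hcard h3).trans hN, fun e => absurd (h2 e) (by omega), h3⟩

end HitProblem

/-- `dim (QP_4)_{2^{s+1} - 3}` equals `4, 15, 35, 45` for `s = 1, 2, 3` and `s ≥ 4`. -/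
theorem stmt9 (s : ℕ) (hs : 1 ≤ s) :
    (s = 1 → Module.finrank (ZMod 2) (QP 4 (2 ^ (s + 1) - 3)) = 4) ∧
    (s = 2 → Module.finrank (ZMod 2) (QP 4 (2 ^ (s + 1) - 3)) = 15) ∧
    (s = 3 → Module.finrank (ZMod 2) (QP 4 (2 ^ (s + 1) - 3)) = 35) ∧
    (4 ≤ s → Module.finrank (ZMod 2) (QP 4 (2 ^ (s + 1) - 3)) = 45) := by
  obtain ⟨N, rfl⟩ := Nat.exists_eq_add_of_le' hs
  rw [← HitProblem.wordDegree_one, HitProblem.finrank_QP]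
  refine ⟨fun h => ?_, fun h => ?_, fun h => ?_, fun h => ?_⟩
  · obtain rfl : N = 0 := by omega
    decide
  · obtain rfl : N = 1 := by omega
    decide
  · obtain rfl : N = 2 := by omega
    decide
  · rw [HitProblem.basisIndex_eq_of_three_le (by omega)]
    decide
end
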